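/- arXiv:2408.00567 — 6 statements merged into one kernel-verified Lean document; each statement's English description precedes it below -/
import Mathlib

section
/- Let ρ ∈ ℂ with 0 < |ρ| ≤ 1. Then 𝓔_ρ = e^{i·arg(ρ)/2}·𝓔_{|ρ|}, i.e. 𝓔_ρ is the set 𝓔_{|ρ|} rotated counterclockwise about the origin by the angle arg(ρ)/2. -/
noncomputable section

/-- The elliptic region 𝓔_ρ := {z ∈ ℂ : z = x + ρ·conj(x) for some |x| ≤ 1}. -/
def ellipticSet (ρ : ℂ) : Set ℂ :=
  {z | ∃ x : ℂ, ‖x‖ ≤ 1 ∧ z = x + ρ * (starRingEnd ℂ) x}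

/-- For 0 < |ρ| ≤ 1, 𝓔_ρ is 𝓔_{|ρ|} rotated counterclockwise about the origin by arg(ρ)/2. -/
theorem stmt1 (ρ : ℂ) (h0 : 0 < ‖ρ‖) (h1 : ‖ρ‖ ≤ 1) :
    ellipticSet ρ =
      (fun s => Complex.exp ((ρ.arg / 2 : ℝ) * Complex.I) * s) ''
        ellipticSet ((‖ρ‖ : ℝ) : ℂ) := by
  have hρ : ρ = (‖ρ‖ : ℂ) * (Complex.exp ((ρ.arg / 2 : ℝ) * Complex.I) *
      Complex.exp ((ρ.arg / 2 : ℝ) * Complex.I)) := by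
    rw [← Complex.exp_add, ← add_mul, ← Complex.ofReal_add, add_halves]
    exact (Complex.norm_mul_exp_arg_mul_I ρ).symm
  have hn : ‖Complex.exp ((ρ.arg / 2 : ℝ) * Complex.I)‖ = 1 :=
    Complex.norm_exp_ofReal_mul_I _
  generalize Complex.exp ((ρ.arg / 2 : ℝ) * Complex.I) = w at hρ hn
  have hw : w * (starRingEnd ℂ) w = 1 := by
    rw [Complex.mul_conj, Complex.normSq_eq_norm_sq, hn]; simp
  generalize ‖ρ‖ = r at hρ
  subst hρ
  ext z
  constructor
  · rintro ⟨x, hx, rfl⟩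
    refine ⟨_, ⟨(starRingEnd ℂ) w * x, ?_, rfl⟩, ?_⟩
    · simpa [hn] using hx
    · simp only [map_mul, Complex.conj_conj]
      linear_combination x * hw
  · rintro ⟨_, ⟨y, hy, rfl⟩, rfl⟩
    refine ⟨w * y, ?_, ?_⟩
    · simpa [hn] using hy
    · simp only [map_mul]
      linear_combination (-(r : ℂ) * w * (starRingEnd ℂ) y) * hw

end
end

section
/- Fix ρ ∈ ℂ with |ρ| ≤ 1 and ε > 0. There exist constants C₁ > 0 and c₀ > 0 depending only on ρ and ε such that: for every integer N ≥ 2 and every N×N Gaussian random matrix X with E[X] = 0, E[XX*] = E[X*X] = I_N, and E[X²] = (ρ + D)·I_N for some D ∈ ℂ with |D| ≤ c₀/log N, and satisfying ṽ(X) ≤ (log N)^{−1} and σ*(X) ≤ (log N)^{−3/2}, the probability that every eigenvalue of X lies in 𝓔_{ρ,ε} is at least 1 − C₁·N^{−1.5}. -/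
open MeasureTheory ProbabilityTheory Filter Matrix
open scoped ENNReal Classical

noncomputable section

/-- The ε-neighborhood 𝓔_{ρ,ε}. -/
def ellipticNbhd (ρ : ℂ) (ε : ℝ) : Set ℂ :=
  {z | Metric.infDist z (ellipticSet ρ) ≤ ε}

/-- Eigenvalues with multiplicity: the roots of the characteristic polynomial. -/
def eigs {N : ℕ} (M : Matrix (Fin N) (Fin N) ℂ) : Multiset ℂ :=
  M.charpoly.roots

/-- Operator (ℓ²→ℓ²) norm of a complex matrix. -/
def opNorm {m n : Type*} [Fintype m] [Fintype n] [DecidableEq n] (M : Matrix m n ℂ) : ℝ :=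
  ‖LinearMap.toContinuousLinearMap (Matrix.toEuclideanLin M)‖

/-- Entrywise expectation of a random matrix. -/
def matExp {Ω : Type*} [MeasurableSpace Ω] (μ : Measure Ω) {N : ℕ}
    (X : Ω → Matrix (Fin N) (Fin N) ℂ) : Matrix (Fin N) (Fin N) ℂ :=
  Matrix.of fun i j => ∫ ω, X ω i j ∂μ

/-- The covariance matrix Cov(X) ∈ M_{N²}(ℂ). -/
def covMatrix {Ω : Type*} [MeasurableSpace Ω] (μ : Measure Ω) {N : ℕ}
    (X : Ω → Matrix (Fin N) (Fin N) ℂ) :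
    Matrix (Fin N × Fin N) (Fin N × Fin N) ℂ :=
  Matrix.of fun p q =>
    ∫ ω, (X ω - matExp μ X) p.1 p.2 * (starRingEnd ℂ) ((X ω - matExp μ X) q.1 q.2) ∂μ

/-- v(X) := ‖Cov(X)‖^{1/2}. -/
def vParam {Ω : Type*} [MeasurableSpace Ω] (μ : Measure Ω) {N : ℕ}
    (X : Ω → Matrix (Fin N) (Fin N) ℂ) : ℝ :=
  Real.sqrt (opNorm (covMatrix μ X))

/-- σ(X) := min(‖E[(X−EX)*(X−EX)]‖, ‖E[(X−EX)(X−EX)*]‖)^{1/2}. -/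
def sigmaParam {Ω : Type*} [MeasurableSpace Ω] (μ : Measure Ω) {N : ℕ}
    (X : Ω → Matrix (Fin N) (Fin N) ℂ) : ℝ :=
  Real.sqrt (min
    (opNorm (matExp μ fun ω => (X ω - matExp μ X)ᴴ * (X ω - matExp μ X)))
    (opNorm (matExp μ fun ω => (X ω - matExp μ X) * (X ω - matExp μ X)ᴴ)))

/-- σ*(X) := (sup over unit vectors u,w ∈ ℂ^N of E[|⟨u,(X−EX)w⟩|²])^{1/2}. -/
def sigmaStarParam {Ω : Type*} [MeasurableSpace Ω] (μ : Measure Ω) {N : ℕ}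
    (X : Ω → Matrix (Fin N) (Fin N) ℂ) : ℝ :=
  Real.sqrt (sSup {s : ℝ | ∃ u w : Fin N → ℂ,
    (∑ i, ‖u i‖ ^ 2) = 1 ∧ (∑ i, ‖w i‖ ^ 2) = 1 ∧
    s = ∫ ω, ‖∑ i, ∑ j,
      (starRingEnd ℂ) (u i) * (X ω - matExp μ X) i j * w j‖ ^ 2 ∂μ})

/-- ṽ(X) := (v(X)·σ(X))^{1/2}. -/
def vTildeParam {Ω : Type*} [MeasurableSpace Ω] (μ : Measure Ω) {N : ℕ}
    (X : Ω → Matrix (Fin N) (Fin N) ℂ) : ℝ :=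
  Real.sqrt (vParam μ X * sigmaParam μ X)

/-- A standard real Gaussian random variable. -/
def IsStdGaussian {Ω : Type*} [MeasurableSpace Ω] (μ : Measure Ω) (g : Ω → ℝ) : Prop :=
  Measurable g ∧ Measure.map g μ = gaussianReal 0 1

/-- A Gaussian random matrix: X = A₀ + Σᵢ gᵢ Aᵢ with independent standard real Gaussians gᵢ. -/
def IsGaussianMatrix {Ω : Type*} [MeasurableSpace Ω] (μ : Measure Ω) {N : ℕ}
    (X : Ω → Matrix (Fin N) (Fin N) ℂ) : Prop :=
  ∃ (n : ℕ) (A₀ : Matrix (Fin N) (Fin N) ℂ) (A : Fin n → Matrix (Fin N) (Fin N) ℂ)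
    (g : Fin n → Ω → ℝ),
    (∀ i, IsStdGaussian μ (g i)) ∧
    iIndepFun g μ ∧
    ∀ ω, X ω = A₀ + ∑ i, g i ω • A i

set_option linter.unusedSectionVars false

/-- Abstract bosonic Fock structure with matrix coefficients `A i` and adjoints `B i`. -/
structure FockData (F : Type*) [SeminormedAddCommGroup F] [InnerProductSpace ℂ F]
    (ι : Type*) where
  a : ι → F →ₗ[ℂ] F
  c : ι → F →ₗ[ℂ] F
  A : ι → F →ₗ[ℂ] F
  B : ι → F →ₗ[ℂ] F
  W : ℕ → Submodule ℂ F
  adj_a : ∀ i x y, inner ℂ (a i x) y = inner ℂ x (c i y)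
  adj_A : ∀ i x y, inner ℂ (A i x) y = inner ℂ x (B i y)
  ccr : ∀ i j x, a i (c j x) = c j (a i x) + if i = j then x else 0
  comm_aa : ∀ i j x, a i (a j x) = a j (a i x)
  comm_aA : ∀ i j x, a i (A j x) = A j (a i x)
  comm_aB : ∀ i j x, a i (B j x) = B j (a i x)
  comm_cA : ∀ i j x, c i (A j x) = A j (c i x)
  comm_cB : ∀ i j x, c i (B j x) = B j (c i x)
  W_mono : ∀ n x, x ∈ W n → x ∈ W (n + 1)
  a_W : ∀ n i x, x ∈ W (n + 1) → a i x ∈ W n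
  a_W0 : ∀ i x, x ∈ W 0 → a i x = 0
  c_W : ∀ n i x, x ∈ W n → c i x ∈ W (n + 1)
  A_W : ∀ n i x, x ∈ W n → A i x ∈ W n
  B_W : ∀ n i x, x ∈ W n → B i x ∈ W n

namespace FockData

variable {F : Type*} [SeminormedAddCommGroup F] [InnerProductSpace ℂ F] {ι : Type*} [Fintype ι]

/-- Exchange the roles of `A` and `B`. -/
def swap (D : FockData F ι) : FockData F ι where
  a := D.a
  c := D.c
  A := D.B
  B := D.A
  W := D.W
  adj_a := D.adj_a
  adj_A i x y := by
    rw [← inner_conj_symm, ← D.adj_A, inner_conj_symm]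
  ccr := D.ccr
  comm_aa := D.comm_aa
  comm_aA := D.comm_aB
  comm_aB := D.comm_aA
  comm_cA := D.comm_cB
  comm_cB := D.comm_cA
  W_mono := D.W_mono
  a_W := D.a_W
  a_W0 := D.a_W0
  c_W := D.c_W
  A_W := D.B_W
  B_W := D.A_W

variable (D : FockData F ι)

lemma adj_c (i : ι) (x y : F) : inner ℂ (D.c i x) y = inner ℂ x (D.a i y) := by
  rw [← inner_conj_symm, ← D.adj_a, inner_conj_symm]

lemma a_W' (n : ℕ) (i : ι) (x : F) (hx : x ∈ D.W n) : D.a i x ∈ D.W n := by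
  cases n with
  | zero => rw [D.a_W0 i x hx]; exact Submodule.zero_mem _
  | succ n => exact D.W_mono _ _ (D.a_W n i x hx)

lemma ca_W (n : ℕ) (i j : ι) (x : F) (hx : x ∈ D.W n) : D.c j (D.a i x) ∈ D.W n := by
  cases n with
  | zero => rw [D.a_W0 i x hx, map_zero]; exact Submodule.zero_mem _
  | succ n => exact D.c_W _ _ _ (D.a_W n i x hx)

lemma W_le {m n : ℕ} (h : m ≤ n) (x : F) (hx : x ∈ D.W m) : x ∈ D.W n := by
  induction n, h using Nat.le_induction with
  | base => exact hx
  | succ n _ ih => exact D.W_mono _ _ ih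

lemma sum_a_sq (n : ℕ) : ∀ x ∈ D.W n, ∑ i, ‖D.a i x‖ ^ 2 ≤ n * ‖x‖ ^ 2 := by
  induction n with
  | zero =>
    intro x hx
    simp [D.a_W0 _ x hx]
  | succ n ih =>
    intro x hx
    set Nx := ∑ i, D.c i (D.a i x) with hNx
    set S := ∑ i, ‖D.a i x‖ ^ 2 with hS
    have h1 : ∀ y, (inner ℂ y (∑ i, D.c i (D.a i y)) : ℂ).re = ∑ i, ‖D.a i y‖ ^ 2 := by
      intro y
      rw [inner_sum, Complex.re_sum]
      refine Finset.sum_congr rfl fun i _ => ?_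
      rw [← D.adj_a]
      exact (norm_sq_eq_re_inner (𝕜 := ℂ) (D.a i y)).symm
    have h2 : ∀ i, D.a i Nx = (∑ j, D.c j (D.a j (D.a i x))) + D.a i x := by
      intro i
      simp only [hNx, map_sum, D.ccr, Finset.sum_add_distrib, Finset.sum_ite_eq, Finset.mem_univ,
        if_true]
      congr 1
      refine Finset.sum_congr rfl fun j _ => ?_
      rw [D.comm_aa]
    have h3 : ‖Nx‖ ^ 2 ≤ (n + 1) * S := by
      have : ‖Nx‖ ^ 2 = ∑ i, (∑ j, ‖D.a j (D.a i x)‖ ^ 2 + ‖D.a i x‖ ^ 2) := by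
        rw [norm_sq_eq_re_inner (𝕜 := ℂ) Nx]
        conv_lhs => rw [hNx, sum_inner, ← hNx]
        simp only [RCLike.re_to_complex, Complex.re_sum]
        refine Finset.sum_congr rfl fun i _ => ?_
        rw [D.adj_c, h2, inner_add_right, Complex.add_re, h1]
        congr 1
        exact (norm_sq_eq_re_inner (𝕜 := ℂ) _).symm
      rw [this, hS, Finset.mul_sum]
      refine Finset.sum_le_sum fun i _ => ?_
      have := ih _ (D.a_W n i x hx)
      linarith
    have h4 : S ≤ ‖x‖ * ‖Nx‖ := by
      rw [hS, ← h1 x]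
      exact (Complex.re_le_norm _).trans (norm_inner_le_norm _ _)
    have hS0 : 0 ≤ S := Finset.sum_nonneg fun i _ => sq_nonneg _
    push_cast
    by_contra hcon
    push Not at hcon
    have h5 : S ^ 2 ≤ ‖x‖ ^ 2 * ((n + 1) * S) := by
      calc S ^ 2 ≤ (‖x‖ * ‖Nx‖) ^ 2 := by gcongr
        _ = ‖x‖ ^ 2 * ‖Nx‖ ^ 2 := by ring
        _ ≤ _ := by gcongr
    have : 0 < S := lt_of_le_of_lt (by positivity) hcon
    nlinarith

/-- creation part -/
def L : Module.End ℂ F := ∑ i, D.A i ∘ₗ D.c i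

/-- annihilation part -/
def R : Module.End ℂ F := ∑ i, D.A i ∘ₗ D.a i

/-- crossing operator -/
def T : Module.End ℂ F := ∑ i, ∑ j, D.A i ∘ₗ D.A j ∘ₗ D.c j ∘ₗ D.a i

lemma L_apply (x : F) : D.L x = ∑ i, D.A i (D.c i x) := by simp [L]
lemma R_apply (x : F) : D.R x = ∑ i, D.A i (D.a i x) := by simp [R]
lemma T_apply (x : F) : D.T x = ∑ i, ∑ j, D.A i (D.A j (D.c j (D.a i x))) := by simp [T]

lemma L_W (n : ℕ) (x : F) (hx : x ∈ D.W n) : D.L x ∈ D.W (n + 1) := by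
  rw [L_apply]
  exact Submodule.sum_mem _ fun i _ => D.A_W _ _ _ (D.c_W _ _ _ hx)

lemma R_W (n : ℕ) (x : F) (hx : x ∈ D.W n) : D.R x ∈ D.W n := by
  rw [R_apply]
  exact Submodule.sum_mem _ fun i _ => D.A_W _ _ _ (D.a_W' _ _ _ hx)

lemma T_W (n : ℕ) (x : F) (hx : x ∈ D.W n) : D.T x ∈ D.W n := by
  rw [T_apply]
  exact Submodule.sum_mem _ fun i _ => Submodule.sum_mem _ fun j _ =>
    D.A_W _ _ _ (D.A_W _ _ _ (D.ca_W _ _ _ _ hx))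

lemma L_bound (v2 : ℝ) (hv : 0 ≤ v2)
    (h2 : ∀ x y : ι → F, (∑ i, ∑ j, inner ℂ (y j) (D.B i (D.A j (x i))) : ℂ).re ≤
      v2 / 2 * (∑ i, ‖x i‖ ^ 2 + ∑ i, ‖y i‖ ^ 2))
    (hone : ∀ x, ∑ i, D.B i (D.A i x) = x)
    (n : ℕ) (δ : ℝ) (hδ : 0 ≤ δ) (hn : n * v2 ≤ δ) (x : F) (hx : x ∈ D.W n) :
    ‖D.L x‖ ≤ (1 + δ) * ‖x‖ := by
  have key : ‖D.L x‖ ^ 2 ≤ (1 + δ) * ‖x‖ ^ 2 := by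
    have e1 : ∀ i j, (inner ℂ (D.A i (D.c i x)) (D.A j (D.c j x)) : ℂ) =
        inner ℂ (D.a j x) (D.B i (D.A j (D.a i x))) + if i = j then inner ℂ x (D.B i (D.A i x))
          else 0 := by
      intro i j
      rw [D.adj_A, D.adj_c, D.comm_aB, D.comm_aA, D.ccr, map_add, map_add, inner_add_right,
        ← D.comm_cA, ← D.comm_cB, ← D.adj_a]
      congr 1
      split_ifs with h
      · subst h; rfl
      · simp
    have e2 : (inner ℂ (D.L x) (D.L x) : ℂ) =
        (∑ i, ∑ j, inner ℂ (D.a j x) (D.B i (D.A j (D.a i x)))) + inner ℂ x x := by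
      rw [L_apply]
      simp only [sum_inner, inner_sum, e1]
      rw [Finset.sum_comm]
      simp only [Finset.sum_add_distrib]
      congr 1
      rw [Finset.sum_comm]
      simp only [Finset.sum_ite_eq', Finset.mem_univ, if_true]
      rw [← inner_sum, hone]
    have e3 := h2 (fun i => D.a i x) (fun i => D.a i x)
    have e4 := D.sum_a_sq n x hx
    have e5 := norm_sq_eq_re_inner (𝕜 := ℂ) (D.L x)
    have e6 := norm_sq_eq_re_inner (𝕜 := ℂ) x
    rw [e2] at e5
    simp only [RCLike.re_to_complex, Complex.add_re] at e5 e6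
    rw [e5, ← e6]
    have e7 : v2 * ∑ i, ‖D.a i x‖ ^ 2 ≤ δ * ‖x‖ ^ 2 := by
      calc v2 * ∑ i, ‖D.a i x‖ ^ 2 ≤ v2 * (n * ‖x‖ ^ 2) := by gcongr
        _ = (n * v2) * ‖x‖ ^ 2 := by ring
        _ ≤ _ := by gcongr
    linarith
  refine le_of_sq_le_sq ?_ (by positivity) |> fun h => h
  calc ‖D.L x‖ ^ 2 ≤ (1 + δ) * ‖x‖ ^ 2 := key
    _ ≤ ((1 + δ) * ‖x‖) ^ 2 := by
      rw [mul_pow]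
      gcongr
      nlinarith

lemma R_bound (v2 : ℝ) (hv : 0 ≤ v2)
    (h3 : ∀ x y : ι → F, (∑ i, ∑ j, inner ℂ (y j) (D.A i (D.B j (x i))) : ℂ).re ≤
      v2 / 2 * (∑ i, ‖x i‖ ^ 2 + ∑ i, ‖y i‖ ^ 2))
    (hone : ∀ x, ∑ i, D.A i (D.B i x) = x)
    (n : ℕ) (δ : ℝ) (hδ : 0 ≤ δ) (hn : n * v2 ≤ δ) (x : F) (hx : x ∈ D.W n) :
    ‖D.R x‖ ≤ (1 + δ) * ‖x‖ := by
  have h := D.swap.L_bound v2 hv h3 hone n δ hδ hn (D.R x) (D.R_W n x hx)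
  have e : (inner ℂ (D.R x) (D.R x) : ℂ) = inner ℂ x (D.swap.L (D.R x)) := by
    conv_lhs => rw [show inner ℂ (D.R x) (D.R x) =
      inner ℂ (∑ i, D.A i (D.a i x)) (D.R x) by rw [← R_apply]]
    rw [L_apply, sum_inner, inner_sum]
    refine Finset.sum_congr rfl fun i _ => ?_
    rw [D.adj_A, D.adj_a, D.comm_cB]
    rfl
  have e5 := norm_sq_eq_re_inner (𝕜 := ℂ) (D.R x)
  rw [e] at e5
  have e6 : ‖D.R x‖ ^ 2 ≤ ‖x‖ * ((1 + δ) * ‖D.R x‖) := by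
    rw [e5]
    refine (Complex.re_le_norm _).trans ((norm_inner_le_norm _ _).trans ?_)
    gcongr
  rcases eq_or_lt_of_le (norm_nonneg (D.R x)) with h0 | h0
  · rw [← h0]; positivity
  · nlinarith

lemma T_bound (v2 : ℝ) (hv : 0 ≤ v2)
    (h1 : ∀ x y : ι → F, (∑ i, ∑ j, inner ℂ (y j) (D.A i (D.A j (x i))) : ℂ).re ≤
      v2 / 2 * (∑ i, ‖x i‖ ^ 2 + ∑ i, ‖y i‖ ^ 2))
    (n : ℕ) (δ : ℝ) (hδ : 0 < δ) (hn : n * v2 ≤ δ) (x : F) (hx : x ∈ D.W n) :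
    ‖D.T x‖ ≤ δ * ‖x‖ := by
  have e1 : ∀ y ∈ D.W n, (inner ℂ y (D.T x) : ℂ).re ≤ δ / 2 * (‖x‖ ^ 2 + ‖y‖ ^ 2) := by
    intro y hy
    have e2 : (inner ℂ y (D.T x) : ℂ) = ∑ i, ∑ j, inner ℂ (D.a j y) (D.A i (D.A j (D.a i x))) := by
      rw [T_apply]
      simp only [inner_sum]
      refine Finset.sum_congr rfl fun i _ => Finset.sum_congr rfl fun j _ => ?_
      rw [D.adj_a, D.comm_cA, D.comm_cA]
    rw [e2]
    refine (h1 (fun i => D.a i x) (fun i => D.a i y)).trans ?_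
    have := D.sum_a_sq n x hx
    have := D.sum_a_sq n y hy
    calc v2 / 2 * (∑ i, ‖D.a i x‖ ^ 2 + ∑ i, ‖D.a i y‖ ^ 2)
        ≤ v2 / 2 * (n * ‖x‖ ^ 2 + n * ‖y‖ ^ 2) := by gcongr
      _ = (n * v2) / 2 * (‖x‖ ^ 2 + ‖y‖ ^ 2) := by ring
      _ ≤ _ := by gcongr
  have e3 := e1 (((δ⁻¹ : ℝ) : ℂ) • D.T x) (Submodule.smul_mem _ _ (D.T_W n x hx))
  rw [inner_smul_left, Complex.conj_ofReal, Complex.re_ofReal_mul, norm_smul, Complex.norm_real,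
    Real.norm_of_nonneg (by positivity)] at e3
  have e5 := norm_sq_eq_re_inner (𝕜 := ℂ) (D.T x)
  rw [RCLike.re_to_complex] at e5
  rw [← e5, mul_pow] at e3
  refine le_of_sq_le_sq ?_ (by positivity) |> fun h => h
  have : δ⁻¹ * ‖D.T x‖ ^ 2 ≤ δ * ‖x‖ ^ 2 := by
    have : δ / 2 * (δ⁻¹ ^ 2 * ‖D.T x‖ ^ 2) = δ⁻¹ * ‖D.T x‖ ^ 2 / 2 := by
      field_simp
    nlinarith
  calc ‖D.T x‖ ^ 2 = δ * (δ⁻¹ * ‖D.T x‖ ^ 2) := by field_simp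
    _ ≤ δ * (δ * ‖x‖ ^ 2) := by gcongr
    _ = _ := by ring

lemma R_L (r : ℂ) (hr : ∀ x, ∑ i, D.A i (D.A i x) = r • x) (x : F) :
    D.R (D.L x) = r • x + D.T x := by
  rw [R_apply, T_apply, ← hr, ← Finset.sum_add_distrib]
  refine Finset.sum_congr rfl fun i _ => ?_
  rw [L_apply]
  simp only [map_sum, D.comm_aA, D.ccr, map_add, Finset.sum_add_distrib]
  rw [add_comm]
  congr 1
  rw [Finset.sum_eq_single i]
  · simp
  · intro j _ hj
    simp [Ne.symm hj]
  · simp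

/-- Chebyshev-type polynomials (shifted) in an endomorphism. -/
def P {S : Type*} [Ring S] [Module ℂ S] (r : ℂ) (X : S) : ℕ → S
  | 0 => 0
  | 1 => 1
  | (m + 2) => X * P r X (m + 1) - r • P r X m

/-- normal ordered version -/
def Q : ℕ → Module.End ℂ F
  | 0 => 0
  | (m + 1) => D.L * Q m + D.R ^ m

lemma Q_rec (r : ℂ) (hr : ∀ x, ∑ i, D.A i (D.A i x) = r • x) (m : ℕ) :
    D.Q (m + 2) = (D.L + D.R) * D.Q (m + 1) - r • D.Q m - D.T * D.Q m := by
  have h : D.R * D.L = r • (1 : Module.End ℂ F) + D.T := by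
    ext x
    simp [D.R_L r hr]
  have e : D.R * D.Q (m + 1) = r • D.Q m + D.T * D.Q m + D.R ^ (m + 1) := by
    rw [Q, mul_add, ← mul_assoc, h, add_mul, smul_mul_assoc, one_mul, pow_succ']
  rw [add_mul, e, Q]
  abel

lemma P_eq (r : ℂ) (hr : ∀ x, ∑ i, D.A i (D.A i x) = r • x) (m : ℕ) :
    P r (D.L + D.R) m = D.Q m +
      ∑ j ∈ Finset.range m, P r (D.L + D.R) (m - 1 - j) * (D.T * D.Q j) := by
  induction m using Nat.strong_induction_on with
  | _ m ih =>
    match m with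
    | 0 => simp [P, Q]
    | 1 => simp [P, Q]
    | (m + 2) =>
      rw [P, ih (m + 1) (by omega), ih m (by omega), D.Q_rec r hr]
      have h1 : ∑ j ∈ Finset.range (m + 2), P r (D.L + D.R) (m + 2 - 1 - j) * (D.T * D.Q j)
        = (∑ j ∈ Finset.range m, P r (D.L + D.R) (m + 1 - j) * (D.T * D.Q j)) + D.T * D.Q m := by
        rw [Finset.sum_range_succ, Finset.sum_range_succ]
        simp [P]
      have h2 : ∑ j ∈ Finset.range (m + 1), P r (D.L + D.R) (m + 1 - 1 - j) * (D.T * D.Q j)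
        = (∑ j ∈ Finset.range m, P r (D.L + D.R) (m - j) * (D.T * D.Q j)) := by
        rw [Finset.sum_range_succ]
        simp [P]
      have h3 : ∑ j ∈ Finset.range m, P r (D.L + D.R) (m + 1 - j) * (D.T * D.Q j) =
        (D.L + D.R) * (∑ j ∈ Finset.range m, P r (D.L + D.R) (m - j) * (D.T * D.Q j)) -
        r • (∑ j ∈ Finset.range m, P r (D.L + D.R) (m - 1 - j) * (D.T * D.Q j)) := by
        rw [Finset.mul_sum, Finset.smul_sum, ← Finset.sum_sub_distrib]
        refine Finset.sum_congr rfl fun j hj => ?_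
        rw [Finset.mem_range] at hj
        obtain ⟨p, rfl⟩ : ∃ p, m = j + 1 + p := ⟨m - j - 1, by omega⟩
        rw [show j + 1 + p + 1 - j = p + 2 by omega, show j + 1 + p - j = p + 1 by omega,
          show j + 1 + p - 1 - j = p by omega, P, sub_mul, smul_mul_assoc, mul_assoc]
      rw [h1, h2, h3, mul_add, smul_add]
      abel

lemma Rpow_W (n m : ℕ) (x : F) (hx : x ∈ D.W n) : (D.R ^ m) x ∈ D.W n := by
  induction m with
  | zero => simpa using hx
  | succ m ih => rw [pow_succ']; exact D.R_W _ _ ih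

lemma Q_W (n m : ℕ) (x : F) (hx : x ∈ D.W n) : D.Q m x ∈ D.W (n + m) := by
  induction m with
  | zero => simp [Q]
  | succ m ih =>
    rw [Q]
    exact Submodule.add_mem _ (D.L_W _ _ ih) (D.W_le (by omega) _ (D.Rpow_W n m x hx))

theorem P_bound (v2 : ℝ) (hv : 0 ≤ v2) (r : ℂ)
    (h1 : ∀ x y : ι → F, (∑ i, ∑ j, inner ℂ (y j) (D.A i (D.A j (x i))) : ℂ).re ≤
      v2 / 2 * (∑ i, ‖x i‖ ^ 2 + ∑ i, ‖y i‖ ^ 2))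
    (h2 : ∀ x y : ι → F, (∑ i, ∑ j, inner ℂ (y j) (D.B i (D.A j (x i))) : ℂ).re ≤
      v2 / 2 * (∑ i, ‖x i‖ ^ 2 + ∑ i, ‖y i‖ ^ 2))
    (h3 : ∀ x y : ι → F, (∑ i, ∑ j, inner ℂ (y j) (D.A i (D.B j (x i))) : ℂ).re ≤
      v2 / 2 * (∑ i, ‖x i‖ ^ 2 + ∑ i, ‖y i‖ ^ 2))
    (hr : ∀ x, ∑ i, D.A i (D.A i x) = r • x)
    (hBA : ∀ x, ∑ i, D.B i (D.A i x) = x)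
    (hAB : ∀ x, ∑ i, D.A i (D.B i x) = x)
    (K : ℕ) (δ : ℝ) (hδ : 0 < δ) (hK : K * v2 ≤ δ) (hδK : δ * K ^ 2 ≤ 1 / 6) (m n : ℕ)
    (hmn : m + n ≤ K) (x : F) (hx : x ∈ D.W n) :
    ‖P r (D.L + D.R) m x‖ ≤ 6 * m * ‖x‖ := by
  have hn : ∀ n : ℕ, n ≤ K → (n : ℝ) * v2 ≤ δ := by
    intro n hn
    refine le_trans ?_ hK
    gcongr
  have hR : ∀ (n : ℕ) (m : ℕ), n ≤ K → ∀ x ∈ D.W n, ‖(D.R ^ m) x‖ ≤ (1 + δ) ^ m * ‖x‖ := by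
    intro n m hnK x hx
    induction m with
    | zero => simp
    | succ m ih =>
      rw [pow_succ', Module.End.mul_apply]
      refine (D.R_bound v2 hv h3 hAB n δ hδ.le (hn n hnK) _ (D.Rpow_W n m x hx)).trans ?_
      rw [pow_succ', mul_assoc]
      gcongr
  have hQ : ∀ (n m : ℕ), m + n ≤ K → ∀ x ∈ D.W n, ‖D.Q m x‖ ≤ m * (1 + δ) ^ m * ‖x‖ := by
    intro n m hnK x hx
    induction m with
    | zero => simp [Q]
    | succ m ih =>
      rw [Q, LinearMap.add_apply, Module.End.mul_apply]
      refine (norm_add_le _ _).trans ?_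
      have b1 := D.L_bound v2 hv h2 hBA (n + m) δ hδ.le (hn _ (by omega)) _ (D.Q_W n m x hx)
      have b2 := hR n m (by omega) x hx
      have b3 := ih (by omega)
      have b4 : (1 + δ) ^ m ≤ (1 + δ) ^ (m + 1) := pow_le_pow_right₀ (by linarith) (by omega)
      calc ‖D.L (D.Q m x)‖ + ‖(D.R ^ m) x‖
          ≤ (1 + δ) * (m * (1 + δ) ^ m * ‖x‖) + (1 + δ) ^ (m + 1) * ‖x‖ := by
            refine add_le_add (b1.trans ?_) (b2.trans ?_) <;> gcongr
        _ = _ := by push_cast; ring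
  have hexp : ∀ m : ℕ, m ≤ K → (1 + δ) ^ m ≤ 3 := by
    intro m hm
    rcases Nat.eq_zero_or_pos m with rfl | hm0
    · norm_num
    have : (1 + δ) ^ m ≤ Real.exp (δ * m) := by
      rw [mul_comm, Real.exp_nat_mul]
      gcongr
      rw [add_comm]; exact Real.add_one_le_exp δ
    refine this.trans ?_
    have h1K : (1 : ℝ) ≤ K := by exact_mod_cast (by omega : 1 ≤ K)
    have hmK : (m : ℝ) ≤ K := by exact_mod_cast hm
    have : δ * m ≤ 1 := by nlinarith
    calc Real.exp (δ * m) ≤ Real.exp 1 := Real.exp_le_exp.2 this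
      _ ≤ 3 := by have := Real.exp_one_lt_d9; linarith
  induction m using Nat.strong_induction_on generalizing n x with
  | _ m ih =>
    rw [D.P_eq r hr, LinearMap.add_apply, LinearMap.sum_apply]
    refine (norm_add_le _ _).trans ?_
    have c1 : ‖D.Q m x‖ ≤ 3 * m * ‖x‖ := by
      refine (hQ n m hmn x hx).trans ?_
      have := hexp m (by omega)
      rw [mul_comm (3 : ℝ)]
      gcongr
    have c2 : ‖∑ j ∈ Finset.range m, (P r (D.L + D.R) (m - 1 - j) * (D.T * D.Q j)) x‖ ≤
        3 * m * ‖x‖ := by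
      refine (norm_sum_le _ _).trans ?_
      calc _ ≤ ∑ j ∈ Finset.range m, 3 * ‖x‖ := ?_
        _ = _ := by simp; ring
      refine Finset.sum_le_sum fun j hj => ?_
      rw [Finset.mem_range] at hj
      rw [Module.End.mul_apply, Module.End.mul_apply]
      have d1 := D.Q_W n j x hx
      have d2 := hQ n j (by omega) x hx
      have d3 := D.T_bound v2 hv h1 (n + j) δ hδ (hn _ (by omega)) _ d1
      have d4 := ih (m - 1 - j) (by omega) (n + j) (by omega) _ (D.T_W _ _ d1)
      have d5 := hexp j (by omega)
      have d6 : ((m - 1 - j : ℕ) : ℝ) ≤ K := by exact_mod_cast (by omega)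
      have d7 : (j : ℝ) ≤ K := by exact_mod_cast (by omega)
      refine d4.trans ?_
      calc 6 * ((m - 1 - j : ℕ) : ℝ) * ‖D.T (D.Q j x)‖
          ≤ 6 * K * (δ * (K * 3 * ‖x‖)) := by
            gcongr
            refine d3.trans ?_
            gcongr
            refine d2.trans ?_
            gcongr
        _ = 18 * (δ * K ^ 2) * ‖x‖ := by ring
        _ ≤ 18 * (1 / 6) * ‖x‖ := by gcongr
        _ = _ := by ring
    linarith

end FockData

lemma gauss_moment (k : ℕ) :
    ∫ x : ℝ, ((x : ℂ)) ^ (k + 1) ∂(gaussianReal 0 1) =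
      k * ∫ x : ℝ, ((x : ℂ)) ^ (k - 1) ∂(gaussianReal 0 1) := by
  have hpowInt : ∀ k : ℕ, Integrable (fun x : ℝ => x ^ k * gaussianPDFReal 0 1 x) := by
    intro k
    have h1 : Integrable (fun x : ℝ => x ^ k) (gaussianReal 0 1) := by
      have := (memLp_id_gaussianReal (μ := 0) (v := 1) k).integrable_norm_pow'
      refine this.mono' (by fun_prop) ?_
      filter_upwards with x
      simp
    rw [gaussianReal_of_var_ne_zero _ one_ne_zero] at h1
    rw [integrable_withDensity_iff (measurable_gaussianPDF 0 1) (by simp [gaussianPDF])] at h1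
    simpa only [toReal_gaussianPDF] using h1
  have hre : ∀ k : ℕ, ∫ x : ℝ, ((x : ℂ)) ^ k ∂(gaussianReal 0 1) =
      ((∫ x : ℝ, x ^ k * gaussianPDFReal 0 1 x : ℝ) : ℂ) := by
    intro k
    rw [show (fun x : ℝ => (x : ℂ) ^ k) = fun x : ℝ => ((x ^ k : ℝ) : ℂ) by ext; simp,
      integral_complex_ofReal, integral_gaussianReal_eq_integral_smul one_ne_zero]
    congr 2
    ext x
    simp [mul_comm]
  rw [hre, hre]
  norm_cast
  have hd : ∀ x : ℝ, HasDerivAt (gaussianPDFReal 0 1) (-x * gaussianPDFReal 0 1 x) x := by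
    intro x
    have h1 : HasDerivAt (fun x : ℝ => (√(2 * Real.pi * ((1 : NNReal) : ℝ)))⁻¹ *
        Real.exp (-(x - 0) ^ 2 / (2 * ((1 : NNReal) : ℝ))))
        ((√(2 * Real.pi * ((1 : NNReal) : ℝ)))⁻¹ *
        (Real.exp (-(x - 0) ^ 2 / (2 * ((1 : NNReal) : ℝ))) * (-x))) x := by
      refine HasDerivAt.const_mul _ (HasDerivAt.exp ?_)
      have := ((((hasDerivAt_id x).sub_const 0).pow 2).neg).div_const (2 * ((1 : NNReal) : ℝ))
      convert! this using 1
      simp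
      ring
    have h2 : gaussianPDFReal 0 1 = (fun x : ℝ => (√(2 * Real.pi * ((1 : NNReal) : ℝ)))⁻¹ *
        Real.exp (-(x - 0) ^ 2 / (2 * ((1 : NNReal) : ℝ)))) := rfl
    rw [h2]
    convert! h1 using 1
    ring
  have := integral_mul_deriv_eq_deriv_mul_of_integrable
    (u := fun x : ℝ => x ^ k) (v := gaussianPDFReal 0 1)
    (u' := fun x : ℝ => k * x ^ (k - 1)) (v' := fun x => -x * gaussianPDFReal 0 1 x)
    (fun x _ => hasDerivAt_pow k x) (fun x _ => hd x) ?_ ?_ (hpowInt k)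
  · have e1 : ∫ x : ℝ, x ^ (k + 1) * gaussianPDFReal 0 1 x =
        - ∫ x : ℝ, x ^ k * (-x * gaussianPDFReal 0 1 x) := by
      rw [← integral_neg]
      congr 1; ext x; ring
    rw [e1, this, neg_neg, ← integral_const_mul]
    congr 1; ext x; ring
  · refine (hpowInt (k + 1)).neg.congr ?_
    filter_upwards with x
    simp; ring
  · refine ((hpowInt (k - 1)).const_mul (k : ℝ)).congr ?_
    filter_upwards with x
    simp; ring

section poly
variable {Ω : Type*} [MeasurableSpace Ω] {μ : Measure Ω} [IsProbabilityMeasure μ]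
  {m : ℕ} {g : Fin m → Ω → ℝ}

/-- evaluation of a polynomial at the Gaussians -/
def ev (g : Fin m → Ω → ℝ) (ω : Ω) : MvPolynomial (Fin m) ℂ →ₐ[ℂ] ℂ :=
  MvPolynomial.aeval (fun i => (g i ω : ℂ))

lemma ev_memLp (hg : ∀ i, IsStdGaussian μ (g i)) (p : MvPolynomial (Fin m) ℂ) :
    ∀ q : ℝ≥0∞, q ≠ ∞ → MemLp (fun ω => ev g ω p) q μ := by
  induction p using MvPolynomial.induction_on with
  | C a => intro q _; simpa [ev] using memLp_const a
  | add p q hp hq =>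
    intro r hr
    simp only [map_add]
    exact (hp r hr).add (hq r hr)
  | mul_X p i hp =>
    intro r hr
    have hX : MemLp (fun ω => (g i ω : ℂ)) (2 * r) μ := by
      have h0 : MemLp id (2 * r) (Measure.map (g i) μ) := by
        rw [(hg i).2]
        exact memLp_id_gaussianReal' _ (ENNReal.mul_ne_top (by simp) hr)
      have := h0.comp_of_map (hg i).1.aemeasurable
      exact this.ofReal
    have : ENNReal.HolderTriple (2 * r) (2 * r) r := ⟨by
      rw [ENNReal.mul_inv (by simp) (by simp), ← add_mul, ENNReal.inv_two_add_inv_two, one_mul]⟩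
    have h2 := hX.mul (hp (2 * r) (ENNReal.mul_ne_top (by simp) hr)) (r := r)
    convert! h2 using 2 with ω
    simp [ev]

lemma ev_integrable (hg : ∀ i, IsStdGaussian μ (g i)) (p : MvPolynomial (Fin m) ℂ) :
    Integrable (fun ω => ev g ω p) μ :=
  memLp_one_iff_integrable.1 (ev_memLp hg p 1 (by simp))

lemma ev_mul_integrable (hg : ∀ i, IsStdGaussian μ (g i)) (p q : MvPolynomial (Fin m) ℂ) :
    Integrable (fun ω => (starRingEnd ℂ) (ev g ω p) * ev g ω q) μ := by
  have h1 := ev_memLp hg p 2 (by simp)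
  have h2 := ev_memLp hg q 2 (by simp)
  exact MemLp.integrable_mul h1.star h2

lemma ev_monomial (hg : ∀ i, IsStdGaussian μ (g i)) (hi : iIndepFun g μ) (s : Fin m →₀ ℕ) (c : ℂ) :
    ∫ ω, ev g ω (MvPolynomial.monomial s c) ∂μ =
      c * ∏ j, ∫ x : ℝ, (x : ℂ) ^ (s j) ∂(gaussianReal 0 1) := by
  have h := hi.integral_fun_prod_comp (f := fun j (x : ℝ) => (x : ℂ) ^ (s j))
    (fun i => (hg i).1.aemeasurable) (fun i => by fun_prop)
  have h' : ∀ j, ∫ ω, ((g j ω : ℝ) : ℂ) ^ (s j) ∂μ = ∫ x : ℝ, (x : ℂ) ^ (s j) ∂(gaussianReal 0 1) := by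
    intro j
    rw [← (hg j).2, integral_map (hg j).1.aemeasurable (by fun_prop)]
  simp only [h'] at h
  rw [← h, ← integral_const_mul]
  congr 1; ext ω
  simp only [ev, MvPolynomial.aeval_monomial]
  rw [Finsupp.prod_fintype _ _ (by simp)]
  simp

lemma ibp (hg : ∀ i, IsStdGaussian μ (g i)) (hi : iIndepFun g μ) (i : Fin m)
    (p : MvPolynomial (Fin m) ℂ) :
    ∫ ω, ev g ω (MvPolynomial.X i * p) ∂μ = ∫ ω, ev g ω (MvPolynomial.pderiv i p) ∂μ := by
  have hadd : ∀ p q : MvPolynomial (Fin m) ℂ,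
      ∫ ω, ev g ω (p + q) ∂μ = ∫ ω, ev g ω p ∂μ + ∫ ω, ev g ω q ∂μ := by
    intro p q
    simp only [map_add]
    exact integral_add (ev_integrable hg p) (ev_integrable hg q)
  induction p using MvPolynomial.induction_on' with
  | add p q hp hq => rw [mul_add, hadd, hp, hq, map_add, hadd]
  | monomial s c =>
    rw [MvPolynomial.pderiv_monomial, MvPolynomial.X, MvPolynomial.monomial_mul, one_mul,
      ev_monomial hg hi, ev_monomial hg hi, ← Finset.mul_prod_erase _ _ (Finset.mem_univ i),
      ← Finset.mul_prod_erase (a := i) _ _ (Finset.mem_univ i)]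
    have e : ∀ j ∈ Finset.univ.erase i,
        ∫ x : ℝ, (x : ℂ) ^ ((Finsupp.single i 1 + s : Fin m →₀ ℕ) j) ∂(gaussianReal 0 1) =
        ∫ x : ℝ, (x : ℂ) ^ ((s - Finsupp.single i 1 : Fin m →₀ ℕ) j) ∂(gaussianReal 0 1) := by
      intro j hj
      have : i ≠ j := (Finset.ne_of_mem_erase hj).symm
      simp [this]
    rw [Finset.prod_congr rfl e]
    have e2 := gauss_moment (s i)
    simp only [Finsupp.add_apply, Finsupp.single_eq_same, Finsupp.tsub_apply, add_comm 1 (s i)]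
    rw [e2]
    ring

end poly


/-- vector of polynomials -/
abbrev PV (N m : ℕ) := Fin N → MvPolynomial (Fin m) ℂ

section poly2
variable {Ω : Type*} [MeasurableSpace Ω] {μ : Measure Ω} [IsProbabilityMeasure μ]
  {m N : ℕ} {g : Fin m → Ω → ℝ}

/-- evaluation of a polynomial vector -/
def evV (g : Fin m → Ω → ℝ) (ω : Ω) : PV N m →ₗ[ℂ] (Fin N → ℂ) where
  toFun f := fun b => ev g ω (f b)
  map_add' f h := by ext; simp
  map_smul' f h := by ext; simp

lemma evV_apply (ω : Ω) (f : PV N m) (b : Fin N) : evV g ω f b = ev g ω (f b) := rfl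

/-- annihilation -/
def opa (i : Fin m) : PV N m →ₗ[ℂ] PV N m where
  toFun f := fun b => MvPolynomial.pderiv i (f b)
  map_add' f h := by ext1; simp
  map_smul' f h := by ext1; simp

/-- creation -/
def opc (i : Fin m) : PV N m →ₗ[ℂ] PV N m where
  toFun f := fun b => MvPolynomial.X i * f b - MvPolynomial.pderiv i (f b)
  map_add' f h := by ext1; simp; ring
  map_smul' f h := by ext1; simp [smul_sub]

/-- matrix action -/
def opM (M : Matrix (Fin N) (Fin N) ℂ) : PV N m →ₗ[ℂ] PV N m where
  toFun f := fun b => ∑ d, M b d • f d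
  map_add' f h := by ext1; simp [Finset.sum_add_distrib]
  map_smul' r f := by
    ext1 b
    simp only [Pi.smul_apply, Finset.smul_sum, RingHom.id_apply]
    exact Finset.sum_congr rfl fun d _ => smul_comm _ _ _

/-- degree filtration -/
def opW (n : ℕ) : Submodule ℂ (PV N m) where
  carrier := {f | ∀ b s, n < s.degree → MvPolynomial.coeff s (f b) = 0}
  add_mem' := by
    intro f h hf hh b s hs
    simp [hf b s hs, hh b s hs]
  zero_mem' := by intro b s hs; simp
  smul_mem' := by
    intro c f hf b s hs
    simp [hf b s hs]

lemma evV_opM (ω : Ω) (M : Matrix (Fin N) (Fin N) ℂ) (f : PV N m) :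
    evV g ω (opM M f) = M *ᵥ evV g ω f := by
  ext b
  simp [evV, opM, Matrix.mulVec, dotProduct]

lemma opM_mul (M M' : Matrix (Fin N) (Fin N) ℂ) (f : PV N m) :
    opM M (opM M' f) = opM (M * M') f := by
  funext b
  simp only [opM, LinearMap.coe_mk, AddHom.coe_mk, Matrix.mul_apply, Finset.smul_sum,
    Finset.sum_smul, smul_smul]
  rw [Finset.sum_comm]

lemma opM_sum {ι : Type*} (s : Finset ι) (M : ι → Matrix (Fin N) (Fin N) ℂ) (f : PV N m) :
    opM (∑ i ∈ s, M i) f = ∑ i ∈ s, opM (M i) f := by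
  funext b
  simp only [opM, LinearMap.coe_mk, AddHom.coe_mk, Matrix.sum_apply, Finset.sum_apply,
    Finset.sum_smul]
  rw [Finset.sum_comm]

lemma opM_smul_one (r : ℂ) (f : PV N m) : opM (r • (1 : Matrix (Fin N) (Fin N) ℂ)) f = r • f := by
  funext b
  simp [opM, Matrix.one_apply]

lemma opa_opM (i : Fin m) (M : Matrix (Fin N) (Fin N) ℂ) (f : PV N m) :
    opa i (opM M f) = opM M (opa i f) := by
  funext b
  simp [opa, opM]

lemma opc_opM (i : Fin m) (M : Matrix (Fin N) (Fin N) ℂ) (f : PV N m) :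
    opc i (opM M f) = opM M (opc i f) := by
  funext b
  simp [opc, opM, smul_sub, Finset.mul_sum]

lemma opa_opc (i j : Fin m) (f : PV N m) :
    opa i (opc j f) = opc j (opa i f) + if i = j then f else 0 := by
  funext b
  have hcomm : ∀ p : MvPolynomial (Fin m) ℂ, MvPolynomial.pderiv i (MvPolynomial.pderiv j p) =
      MvPolynomial.pderiv j (MvPolynomial.pderiv i p) := by
    intro p
    ext s
    simp only [MvPolynomial.coeff_pderiv]
    by_cases h : i = j
    · subst h; rfl
    · simp [h, Ne.symm h, add_right_comm]
      ring
  by_cases h : i = j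
  · subst h
    simp [opa, opc, Derivation.leibniz]
    ring
  · simp [opa, opc, Derivation.leibniz, h, hcomm, MvPolynomial.pderiv_X_of_ne (Ne.symm h)]

lemma opa_opa (i j : Fin m) (f : PV N m) : opa i (opa j f) = opa j (opa i f) := by
  funext b
  simp only [opa, LinearMap.coe_mk, AddHom.coe_mk]
  ext s
  simp only [MvPolynomial.coeff_pderiv]
  by_cases h : i = j
  · subst h; rfl
  · simp [h, Ne.symm h, add_right_comm]
    ring

lemma opa_W (n : ℕ) (i : Fin m) (f : PV N m) (hf : f ∈ opW (n + 1)) : opa i f ∈ opW n := by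
  intro b s hs
  simp only [opa, LinearMap.coe_mk, AddHom.coe_mk, MvPolynomial.coeff_pderiv]
  rw [hf b _ (by simpa using hs), zero_mul]

lemma opa_W0 (i : Fin m) (f : PV N m) (hf : f ∈ opW 0) : opa i f = 0 := by
  funext b
  ext s
  simp only [opa, LinearMap.coe_mk, AddHom.coe_mk, MvPolynomial.coeff_pderiv]
  rw [hf b _ (by simp), zero_mul]
  simp

lemma opW_mono (n : ℕ) (f : PV N m) (hf : f ∈ opW n) : f ∈ opW (n + 1) :=
  fun b s hs => hf b s (by omega)

lemma opc_W (n : ℕ) (i : Fin m) (f : PV N m) (hf : f ∈ opW n) : opc i f ∈ opW (n + 1) := by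
  intro b s hs
  have h1 := opa_W n i f (opW_mono n f hf) b s (by omega)
  simp only [opa, LinearMap.coe_mk, AddHom.coe_mk] at h1
  simp only [opc, LinearMap.coe_mk, AddHom.coe_mk, MvPolynomial.coeff_sub, h1, sub_zero,
    MvPolynomial.coeff_X_mul']
  split_ifs with h
  · apply hf
    have h2 : s = (s - Finsupp.single i 1) + Finsupp.single i 1 := by
      rw [tsub_add_cancel_of_le]
      rw [Finsupp.single_le_iff]
      have := Finsupp.mem_support_iff.1 h
      omega
    have h3 := congrArg Finsupp.degree h2
    rw [map_add, Finsupp.degree_single] at h3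
    omega
  · rfl

lemma opM_W (n : ℕ) (M : Matrix (Fin N) (Fin N) ℂ) (f : PV N m) (hf : f ∈ opW n) :
    opM M f ∈ opW n := by
  intro b s hs
  simp only [opM, LinearMap.coe_mk, AddHom.coe_mk, MvPolynomial.coeff_sum, MvPolynomial.coeff_smul]
  exact Finset.sum_eq_zero fun d _ => by rw [hf d s hs, smul_zero]

/-- Gaussian inner product -/
def gip (μ : Measure Ω) (g : Fin m → Ω → ℝ) (f h : PV N m) : ℂ :=
  ∫ ω, ∑ b, (starRingEnd ℂ) (evV g ω f b) * evV g ω h b ∂μ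

lemma gip_integrable (hg : ∀ i, IsStdGaussian μ (g i)) (f h : PV N m) :
    Integrable (fun ω => ∑ b, (starRingEnd ℂ) (evV g ω f b) * evV g ω h b) μ :=
  integrable_finsetSum _ fun b _ => ev_mul_integrable hg (f b) (h b)

lemma gip_add_left (hg : ∀ i, IsStdGaussian μ (g i)) (f f' h : PV N m) :
    gip μ g (f + f') h = gip μ g f h + gip μ g f' h := by
  unfold gip
  rw [← integral_add (gip_integrable hg f h) (gip_integrable hg f' h)]
  congr 1; ext ω
  simp [add_mul, Finset.sum_add_distrib]

lemma gip_smul_left (f h : PV N m) (r : ℂ) :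
    gip μ g (r • f) h = (starRingEnd ℂ) r * gip μ g f h := by
  unfold gip
  rw [← integral_const_mul]
  congr 1; ext ω
  simp [Finset.mul_sum, mul_assoc]

lemma gip_conj (f h : PV N m) : (starRingEnd ℂ) (gip μ g h f) = gip μ g f h := by
  unfold gip
  rw [← integral_conj]
  congr 1; ext ω
  simp [mul_comm]

lemma gip_self (f : PV N m) : gip μ g f f = ((∫ ω, ∑ b, ‖evV g ω f b‖ ^ 2 ∂μ : ℝ) : ℂ) := by
  unfold gip
  rw [← integral_complex_ofReal]
  congr 1; ext ω
  push_cast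
  refine Finset.sum_congr rfl fun b _ => ?_
  rw [Complex.conj_mul']

lemma gip_adj_M (M : Matrix (Fin N) (Fin N) ℂ) (f h : PV N m) :
    gip μ g (opM M f) h = gip μ g f (opM Mᴴ h) := by
  unfold gip
  congr 1; ext ω
  rw [evV_opM, evV_opM]
  simp only [Matrix.mulVec, dotProduct, map_sum, Finset.sum_mul, Finset.mul_sum, map_mul,
    Matrix.conjTranspose_apply, RCLike.star_def]
  rw [Finset.sum_comm]
  refine Finset.sum_congr rfl fun b _ => Finset.sum_congr rfl fun d _ => ?_
  ring

lemma ev_conj (ω : Ω) (p : MvPolynomial (Fin m) ℂ) :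
    (starRingEnd ℂ) (ev g ω p) = ev g ω (MvPolynomial.map (starRingEnd ℂ) p) := by
  simp only [ev, MvPolynomial.aeval_def, MvPolynomial.eval₂_map]
  rw [MvPolynomial.hom_eval₂]
  congr 1
  ext i; simp

lemma gip_adj_a (hg : ∀ i, IsStdGaussian μ (g i)) (hi : iIndepFun g μ) (i : Fin m) (f h : PV N m) :
    gip μ g (opa i f) h = gip μ g f (opc i h) := by
  unfold gip
  simp only [evV_apply]
  rw [integral_finsetSum _ fun b _ => ev_mul_integrable hg _ _,
    integral_finsetSum _ fun b _ => ev_mul_integrable hg _ _]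
  refine Finset.sum_congr rfl fun b _ => ?_
  simp only [ev_conj, ← map_mul, opa, opc, LinearMap.coe_mk, AddHom.coe_mk]
  have h1 := ibp hg hi i (MvPolynomial.map (starRingEnd ℂ) (f b) * h b)
  set p := MvPolynomial.map (starRingEnd ℂ) (f b) with hp
  rw [← MvPolynomial.pderiv_map, ← hp]
  have h2 : p * (MvPolynomial.X i * h b - MvPolynomial.pderiv i (h b)) =
    MvPolynomial.X i * (p * h b) - p * MvPolynomial.pderiv i (h b) := by ring
  have h3 : MvPolynomial.pderiv i (p * h b) =
     p * MvPolynomial.pderiv i (h b) + MvPolynomial.pderiv i p * h b := by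
    rw [MvPolynomial.pderiv_mul]; ring
  rw [h2]
  simp only [map_sub]
  rw [integral_sub (ev_integrable hg _) (ev_integrable hg _), h1, h3]
  simp only [map_add]
  rw [integral_add (ev_integrable hg _) (ev_integrable hg _)]
  ring

/-- Gaussian semi-inner product core -/
@[reducible] def gcore (hg : ∀ i, IsStdGaussian μ (g i)) : PreInnerProductSpace.Core ℂ (PV N m) where
  inner := gip μ g
  conj_inner_symm f h := gip_conj f h
  re_inner_nonneg f := by
    change 0 ≤ (gip μ g f f).re
    rw [gip_self, Complex.ofReal_re]
    exact integral_nonneg fun ω => Finset.sum_nonneg fun b _ => sq_nonneg _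
  add_left := gip_add_left hg
  smul_left := gip_smul_left

/-- seminormed group -/
@[reducible] def gsn (hg : ∀ i, IsStdGaussian μ (g i)) : SeminormedAddCommGroup (PV N m) :=
  @InnerProductSpace.Core.toSeminormedAddCommGroup ℂ _ _ _ _ (gcore hg)

/-- inner product space -/
@[reducible] def gips (hg : ∀ i, IsStdGaussian μ (g i)) : @InnerProductSpace ℂ (PV N m) _ (gsn hg) :=
  InnerProductSpace.ofCore (gcore hg)

/-- The Gaussian Fock structure -/
def gfock (hg : ∀ i, IsStdGaussian μ (g i)) (hi : iIndepFun g μ)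
    (A : Fin m → Matrix (Fin N) (Fin N) ℂ) :
    @FockData (PV N m) (gsn hg) (gips hg) (Fin m) :=
  letI := gsn (N := N) hg
  letI := gips (N := N) hg
  { a := opa
    c := opc
    A := fun i => opM (A i)
    B := fun i => opM (A i)ᴴ
    W := opW
    adj_a := gip_adj_a hg hi
    adj_A := fun i => gip_adj_M (A i)
    ccr := fun i j f => by rw [opa_opc]; congr
    comm_aa := opa_opa
    comm_aA := fun i j => opa_opM i (A j)
    comm_aB := fun i j => opa_opM i (A j)ᴴ
    comm_cA := fun i j => opc_opM i (A j)
    comm_cB := fun i j => opc_opM i (A j)ᴴ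
    W_mono := opW_mono
    a_W := opa_W
    a_W0 := opa_W0
    c_W := opc_W
    A_W := fun n i => opM_W n (A i)
    B_W := fun n i => opM_W n (A i)ᴴ }

end poly2


section poly3
variable {Ω : Type*} [MeasurableSpace Ω] {μ : Measure Ω} [IsProbabilityMeasure μ]
  {m N : ℕ} {g : Fin m → Ω → ℝ}

/-- the `v`-bound on the coefficient tensor -/
def VB (A : Fin m → Matrix (Fin N) (Fin N) ℂ) (v2 : ℝ) : Prop :=
  ∀ x : Fin m → ℂ, ∑ a, ∑ b, ‖∑ i, A i a b * x i‖ ^ 2 ≤ v2 * ∑ i, ‖x i‖ ^ 2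

lemma VB.ct {A : Fin m → Matrix (Fin N) (Fin N) ℂ} {v2 : ℝ} (h : VB A v2) :
    VB (fun i => (A i)ᴴ) v2 := by
  intro x
  have := h (fun i => (starRingEnd ℂ) (x i))
  rw [Finset.sum_comm] at this
  simp only [RCLike.norm_conj] at this
  refine le_trans (le_of_eq ?_) this
  refine Finset.sum_congr rfl fun a _ => Finset.sum_congr rfl fun b _ => ?_
  rw [← RCLike.norm_conj]
  simp [Matrix.conjTranspose_apply]

lemma cross {G H : Fin m → Matrix (Fin N) (Fin N) ℂ} {v2 : ℝ} (hG : VB G v2) (hH : VB H v2)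
    (x y : Fin m → Fin N → ℂ) :
    (∑ i, ∑ j, ∑ c, (starRingEnd ℂ) (y j c) * (G i *ᵥ (H j *ᵥ x i)) c).re ≤
      v2 / 2 * (∑ i, ∑ b, ‖x i b‖ ^ 2 + ∑ j, ∑ b, ‖y j b‖ ^ 2) := by
  have e1 : ∑ i, ∑ j, ∑ c, (starRingEnd ℂ) (y j c) * (G i *ᵥ (H j *ᵥ x i)) c =
      ∑ c, ∑ a, ∑ b, (∑ j, H j a b * (starRingEnd ℂ) (y j c)) * (∑ i, G i c a * x i b) := by
    simp only [Matrix.mulVec, dotProduct, Finset.sum_mul, Finset.mul_sum]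
    calc _ = ∑ i, ∑ c, ∑ j, ∑ a, ∑ b,
          (starRingEnd ℂ) (y j c) * (G i c a * (H j a b * x i b)) :=
          Finset.sum_congr rfl fun i _ => Finset.sum_comm
      _ = ∑ c, ∑ i, ∑ j, ∑ a, ∑ b,
          (starRingEnd ℂ) (y j c) * (G i c a * (H j a b * x i b)) := Finset.sum_comm
      _ = ∑ c, ∑ i, ∑ a, ∑ j, ∑ b,
          (starRingEnd ℂ) (y j c) * (G i c a * (H j a b * x i b)) :=
          Finset.sum_congr rfl fun c _ => Finset.sum_congr rfl fun i _ => Finset.sum_comm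
      _ = ∑ c, ∑ a, ∑ i, ∑ j, ∑ b,
          (starRingEnd ℂ) (y j c) * (G i c a * (H j a b * x i b)) :=
          Finset.sum_congr rfl fun c _ => Finset.sum_comm
      _ = ∑ c, ∑ a, ∑ i, ∑ b, ∑ j,
          (starRingEnd ℂ) (y j c) * (G i c a * (H j a b * x i b)) :=
          Finset.sum_congr rfl fun c _ => Finset.sum_congr rfl fun a _ =>
            Finset.sum_congr rfl fun i _ => Finset.sum_comm
      _ = ∑ c, ∑ a, ∑ b, ∑ i, ∑ j,
          (starRingEnd ℂ) (y j c) * (G i c a * (H j a b * x i b)) :=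
          Finset.sum_congr rfl fun c _ => Finset.sum_congr rfl fun a _ => Finset.sum_comm
      _ = _ := by
          refine Finset.sum_congr rfl fun c _ => Finset.sum_congr rfl fun a _ =>
            Finset.sum_congr rfl fun b _ => Finset.sum_congr rfl fun i _ =>
            Finset.sum_congr rfl fun j _ => ?_
          ring
  rw [e1]
  simp only [Complex.re_sum]
  have e2 : ∀ p q : ℂ, (p * q).re ≤ (‖p‖ ^ 2 + ‖q‖ ^ 2) / 2 := by
    intro p q
    refine (Complex.re_le_norm _).trans ?_
    rw [norm_mul]
    nlinarith [sq_nonneg (‖p‖ - ‖q‖)]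
  refine (Finset.sum_le_sum fun c _ => Finset.sum_le_sum fun a _ =>
    Finset.sum_le_sum fun b _ => e2 _ _).trans ?_
  simp only [add_div, Finset.sum_add_distrib, ← Finset.sum_div]
  have f1 : ∑ c, ∑ a, ∑ b, ‖∑ j, H j a b * (starRingEnd ℂ) (y j c)‖ ^ 2 ≤
      v2 * ∑ j, ∑ b, ‖y j b‖ ^ 2 := by
    calc ∑ c, ∑ a, ∑ b, ‖∑ j, H j a b * (starRingEnd ℂ) (y j c)‖ ^ 2
        ≤ ∑ c, v2 * ∑ j, ‖y j c‖ ^ 2 :=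
          Finset.sum_le_sum fun c _ =>
            (hH (fun j => (starRingEnd ℂ) (y j c))).trans (by simp)
      _ = v2 * ∑ j, ∑ b, ‖y j b‖ ^ 2 := by rw [← Finset.mul_sum, Finset.sum_comm]
  have f2 : ∑ c, ∑ a, ∑ b, ‖∑ i, G i c a * x i b‖ ^ 2 ≤
      v2 * ∑ j, ∑ b, ‖x j b‖ ^ 2 := by
    calc _ = ∑ b, ∑ c, ∑ a, ‖∑ i, G i c a * x i b‖ ^ 2 :=
          (Finset.sum_congr rfl fun c _ => Finset.sum_comm).trans Finset.sum_comm
      _ ≤ ∑ b, v2 * ∑ i, ‖x i b‖ ^ 2 := Finset.sum_le_sum fun b _ => hG (fun i => x i b)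
      _ = _ := by rw [← Finset.mul_sum, Finset.sum_comm]
  linarith

lemma gnorm_sq (hg : ∀ i, IsStdGaussian μ (g i)) (f : PV N m) :
    (@norm _ (gsn hg).toNorm f) ^ 2 = ∫ ω, ∑ b, ‖evV g ω f b‖ ^ 2 ∂μ := by
  letI := gsn (N := N) hg
  letI := gips (N := N) hg
  have h := norm_sq_eq_re_inner (𝕜 := ℂ) f
  rw [h]
  change (gip μ g f f).re = _
  rw [gip_self, Complex.ofReal_re]

lemma gsq_integrable (hg : ∀ i, IsStdGaussian μ (g i)) (f : PV N m) :
    Integrable (fun ω => ∑ b, ‖evV g ω f b‖ ^ 2) μ :=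
  integrable_finsetSum _ fun b _ =>
    (memLp_two_iff_integrable_sq_norm (ev_memLp hg (f b) 2 (by simp)).1).1 (ev_memLp hg (f b) 2 (by simp))

lemma gcross (hg : ∀ i, IsStdGaussian μ (g i)) {G H : Fin m → Matrix (Fin N) (Fin N) ℂ} {v2 : ℝ}
    (hG : VB G v2) (hH : VB H v2) (x y : Fin m → PV N m) :
    (∑ i, ∑ j, gip μ g (y j) (opM (G i) (opM (H j) (x i)))).re ≤
      v2 / 2 * (∑ i, (@norm _ (gsn hg).toNorm (x i)) ^ 2 +
        ∑ i, (@norm _ (gsn hg).toNorm (y i)) ^ 2) := by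
  simp only [gnorm_sq]
  rw [← integral_finsetSum _ fun i _ => gsq_integrable hg _,
    ← integral_finsetSum _ fun i _ => gsq_integrable hg _,
    ← integral_add (integrable_finsetSum _ fun i _ => gsq_integrable hg _)
      (integrable_finsetSum _ fun i _ => gsq_integrable hg _), ← integral_const_mul]
  unfold gip
  have hI : Integrable (fun ω => ∑ i, ∑ j, ∑ b, (starRingEnd ℂ) (evV g ω (y j) b) *
      evV g ω (opM (G i) (opM (H j) (x i))) b) μ :=
    integrable_finsetSum _ fun i _ => integrable_finsetSum _ fun j _ => gip_integrable hg _ _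
  have e : ∑ i, ∑ j, ∫ ω, ∑ b, (starRingEnd ℂ) (evV g ω (y j) b) *
      evV g ω (opM (G i) (opM (H j) (x i))) b ∂μ = ∫ ω, ∑ i, ∑ j, ∑ b,
      (starRingEnd ℂ) (evV g ω (y j) b) * evV g ω (opM (G i) (opM (H j) (x i))) b ∂μ := by
    rw [integral_finsetSum _ fun i _ => integrable_finsetSum _ fun j _ => gip_integrable hg _ _]
    refine Finset.sum_congr rfl fun i _ => ?_
    rw [integral_finsetSum _ fun j _ => gip_integrable hg _ _]
  rw [e, ← RCLike.re_to_complex, ← integral_re hI]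
  refine integral_mono hI.re ?_ ?_
  · exact ((integrable_finsetSum _ fun i _ => gsq_integrable hg _).add
      (integrable_finsetSum _ fun i _ => gsq_integrable hg _)).const_mul _
  · intro ω
    simp only [evV_opM, RCLike.re_to_complex]
    exact cross hG hH (fun i => evV g ω (x i)) (fun i => evV g ω (y i))

/-- constant basis vector -/
def cvec (b : Fin N) : PV N m := fun d => if d = b then 1 else 0

lemma cvec_W (b : Fin N) : (cvec b : PV N m) ∈ (opW 0 : Submodule ℂ (PV N m)) := by
  intro d s hs
  have : s ≠ 0 := by rintro rfl; simp at hs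
  unfold cvec
  split_ifs
  · rw [MvPolynomial.coeff_one, if_neg (Ne.symm this)]
  · simp

lemma evV_cvec (ω : Ω) (b : Fin N) : evV g ω (cvec b : PV N m) = Pi.single b 1 := by
  ext d
  simp only [evV_apply, cvec, Pi.single_apply]
  split_ifs <;> simp

theorem moment_bound (hg : ∀ i, IsStdGaussian μ (g i)) (hi : iIndepFun g μ)
    (A : Fin m → Matrix (Fin N) (Fin N) ℂ) (v2 : ℝ) (hv : 0 ≤ v2) (hA : VB A v2) (r : ℂ)
    (hr : ∑ i, A i * A i = r • (1 : Matrix (Fin N) (Fin N) ℂ))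
    (hBA : ∑ i, (A i)ᴴ * A i = 1) (hAB : ∑ i, A i * (A i)ᴴ = 1)
    (K : ℕ) (δ : ℝ) (hδ : 0 < δ) (hK : K * v2 ≤ δ) (hδK : δ * K ^ 2 ≤ 1 / 6) :
    Integrable (fun ω => ∑ b, ∑ c, ‖FockData.P r (∑ i, g i ω • A i) K c b‖ ^ 2) μ ∧
    ∫ ω, ∑ b, ∑ c, ‖FockData.P r (∑ i, g i ω • A i) K c b‖ ^ 2 ∂μ ≤ N * (6 * K) ^ 2 := by
  letI := gsn (N := N) hg
  letI := gips (N := N) hg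
  let D := gfock hg hi A
  have hX : ∀ (f : PV N m) ω, evV g ω ((D.L + D.R) f) = (∑ i, g i ω • A i) *ᵥ evV g ω f := by
    intro f ω
    rw [LinearMap.add_apply, D.L_apply, D.R_apply, ← Finset.sum_add_distrib]
    have : ∀ i, evV g ω (D.A i (D.c i f) + D.A i (D.a i f)) = (g i ω • A i) *ᵥ evV g ω f := by
      intro i
      rw [← map_add]
      have e : D.c i f + D.a i f = fun b => MvPolynomial.X i * f b := by
        change opc i f + opa i f = _
        funext b
        simp [opc, opa]
      rw [e]
      change evV g ω (opM (A i) _) = _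
      rw [evV_opM]
      have e2 : evV g ω (fun b => MvPolynomial.X i * f b) = g i ω • evV g ω f := by
        ext b
        simp [evV_apply, ev]
      rw [e2, Matrix.mulVec_smul, Matrix.smul_mulVec]
    rw [map_sum, Matrix.sum_mulVec]
    exact Finset.sum_congr rfl fun i _ => this i
  have hP : ∀ (k : ℕ) (f : PV N m) ω, evV g ω (FockData.P r (D.L + D.R) k f) =
      (FockData.P r (∑ i, g i ω • A i) k) *ᵥ evV g ω f := by
    intro k
    induction k using Nat.strong_induction_on with
    | _ k ih =>
      intro f ω
      match k with
      | 0 => simp [FockData.P]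
      | 1 => simp [FockData.P]
      | (k + 2) =>
        rw [FockData.P, FockData.P, LinearMap.sub_apply, Module.End.mul_apply, map_sub, hX,
          ih (k + 1) (by omega), LinearMap.smul_apply, map_smul, ih k (by omega),
          Matrix.sub_mulVec, Matrix.smul_mulVec, Matrix.mulVec_mulVec]
  have hentry : ∀ ω b c, FockData.P r (∑ i, g i ω • A i) K c b =
      evV g ω (FockData.P r (D.L + D.R) K (cvec b)) c := by
    intro ω b c
    rw [hP, evV_cvec, Matrix.mulVec_single_one]
    rfl
  simp only [hentry]
  refine ⟨integrable_finsetSum _ fun b _ => gsq_integrable hg _, ?_⟩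
  rw [integral_finsetSum _ fun b _ => gsq_integrable hg _]
  calc _ ≤ ∑ b : Fin N, (6 * (K : ℝ)) ^ 2 := Finset.sum_le_sum fun b _ => ?_
    _ = _ := by simp
  rw [← gnorm_sq hg]
  have hb := D.P_bound v2 hv r (gcross hg hA hA) (gcross hg hA.ct hA) (gcross hg hA hA.ct)
    (fun x => by
      change ∑ i, opM (A i) (opM (A i) x) = _
      simp only [opM_mul]
      rw [← opM_sum, hr, opM_smul_one])
    (fun x => by
      change ∑ i, opM (A i)ᴴ (opM (A i) x) = _
      simp only [opM_mul]
      rw [← opM_sum, hBA]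
      simpa using opM_smul_one 1 x)
    (fun x => by
      change ∑ i, opM (A i) (opM (A i)ᴴ x) = _
      simp only [opM_mul]
      rw [← opM_sum, hAB]
      simpa using opM_smul_one 1 x)
    K δ hδ hK hδK K 0 (by omega) (cvec b) (cvec_W b)
  have h1 : ‖(cvec b : PV N m)‖ = 1 := by
    have := gnorm_sq hg (cvec b : PV N m)
    simp only [evV_cvec] at this
    have e : ∑ d, ‖(Pi.single b (1 : ℂ) : Fin N → ℂ) d‖ ^ 2 = 1 := by
      rw [Finset.sum_eq_single b] <;> simp +contextual [Pi.single_apply]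
    rw [e] at this
    simp only [integral_const, probReal_univ, smul_eq_mul, mul_one] at this
    nlinarith [norm_nonneg (cvec b : PV N m)]
  rw [h1, mul_one] at hb
  gcongr

end poly3


section reduce
variable {Ω : Type*} [MeasurableSpace Ω] {μ : Measure Ω} [IsProbabilityMeasure μ]
  {m N : ℕ} {g : Fin m → Ω → ℝ}

lemma E_g (hg : ∀ i, IsStdGaussian μ (g i)) (hi : iIndepFun g μ) (i : Fin m) :
    ∫ ω, (g i ω : ℂ) ∂μ = 0 := by
  have := ibp hg hi i 1
  simpa [ev] using this

lemma E_gg (hg : ∀ i, IsStdGaussian μ (g i)) (hi : iIndepFun g μ) (i j : Fin m) :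
    ∫ ω, (g i ω : ℂ) * (g j ω : ℂ) ∂μ = if i = j then 1 else 0 := by
  have := ibp hg hi i (MvPolynomial.X j)
  simp only [ev, map_mul, MvPolynomial.aeval_X, MvPolynomial.pderiv_X] at this
  rw [this]
  by_cases h : i = j
  · subst h; simp
  · simp [h, Ne.symm h]

lemma I_g (hg : ∀ i, IsStdGaussian μ (g i)) (i : Fin m) :
    Integrable (fun ω => (g i ω : ℂ)) μ := by
  simpa [ev] using ev_integrable hg (MvPolynomial.X i)

lemma I_gg (hg : ∀ i, IsStdGaussian μ (g i)) (i j : Fin m) :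
    Integrable (fun ω => (g i ω : ℂ) * (g j ω : ℂ)) μ := by
  have h := ev_integrable hg (MvPolynomial.X i * MvPolynomial.X j)
  simp only [ev, map_mul, MvPolynomial.aeval_X] at h
  exact h

lemma E_bil (hg : ∀ i, IsStdGaussian μ (g i)) (hi : iIndepFun g μ) (u w : Fin m → ℂ) :
    ∫ ω, (∑ i, (g i ω : ℂ) * u i) * (∑ i, (g i ω : ℂ) * w i) ∂μ = ∑ i, u i * w i := by
  have e : ∀ ω, (∑ i, (g i ω : ℂ) * u i) * (∑ i, (g i ω : ℂ) * w i) =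
      ∑ i, ∑ j, ((g i ω : ℂ) * (g j ω : ℂ)) * (u i * w j) := by
    intro ω
    rw [Finset.sum_mul_sum]
    exact Finset.sum_congr rfl fun i _ => Finset.sum_congr rfl fun j _ => by ring
  simp only [e]
  rw [integral_finsetSum _ fun i _ => integrable_finsetSum _ fun j _ => (I_gg hg i j).mul_const _]
  refine Finset.sum_congr rfl fun i _ => ?_
  rw [integral_finsetSum _ fun j _ => (I_gg hg i j).mul_const _]
  simp only [integral_mul_const, E_gg hg hi]
  simp

lemma I_bil (hg : ∀ i, IsStdGaussian μ (g i)) (u w : Fin m → ℂ) :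
    Integrable (fun ω => (∑ i, (g i ω : ℂ) * u i) * (∑ i, (g i ω : ℂ) * w i)) μ := by
  have e : ∀ ω, (∑ i, (g i ω : ℂ) * u i) * (∑ i, (g i ω : ℂ) * w i) =
      ∑ i, ∑ j, ((g i ω : ℂ) * (g j ω : ℂ)) * (u i * w j) := by
    intro ω
    rw [Finset.sum_mul_sum]
    exact Finset.sum_congr rfl fun i _ => Finset.sum_congr rfl fun j _ => by ring
  simp only [e]
  exact integrable_finsetSum _ fun i _ => integrable_finsetSum _ fun j _ => (I_gg hg i j).mul_const _

lemma X_entry (A : Fin m → Matrix (Fin N) (Fin N) ℂ) (ω : Ω) (a b : Fin N) :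
    (∑ i, g i ω • A i) a b = ∑ i, (g i ω : ℂ) * A i a b := by
  rw [Matrix.sum_apply]
  exact Finset.sum_congr rfl fun i _ => by simp

lemma matExp_mul (hg : ∀ i, IsStdGaussian μ (g i)) (hi : iIndepFun g μ)
    (A B : Fin m → Matrix (Fin N) (Fin N) ℂ) :
    matExp μ (fun ω => (∑ i, g i ω • A i) * (∑ i, g i ω • B i)) = ∑ i, A i * B i := by
  ext a b
  simp only [matExp, Matrix.of_apply, Matrix.mul_apply, X_entry]
  rw [Matrix.sum_apply]
  simp only [Matrix.mul_apply]
  rw [integral_finsetSum _ fun c _ => I_bil hg _ _]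
  simp only [E_bil hg hi]
  exact Finset.sum_comm

lemma X_ct (A : Fin m → Matrix (Fin N) (Fin N) ℂ) (ω : Ω) :
    (∑ i, g i ω • A i)ᴴ = ∑ i, g i ω • (A i)ᴴ := by
  rw [Matrix.conjTranspose_sum]
  exact Finset.sum_congr rfl fun i _ => by simp

lemma matExp_affine (hg : ∀ i, IsStdGaussian μ (g i)) (hi : iIndepFun g μ)
    (A0 : Matrix (Fin N) (Fin N) ℂ) (A : Fin m → Matrix (Fin N) (Fin N) ℂ) :
    matExp μ (fun ω => A0 + ∑ i, g i ω • A i) = A0 := by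
  ext a b
  simp only [matExp, Matrix.of_apply, Matrix.add_apply, X_entry]
  rw [integral_add (integrable_const _)
    (integrable_finsetSum _ fun i _ => (I_g hg i).mul_const _),
    integral_finsetSum _ fun i _ => (I_g hg i).mul_const _]
  simp [integral_mul_const, E_g hg hi]

lemma opNorm_one' (hN : 2 ≤ N) : opNorm (1 : Matrix (Fin N) (Fin N) ℂ) = 1 := by
  have : Nontrivial (EuclideanSpace ℂ (Fin N)) := by
    have : Nonempty (Fin N) := ⟨⟨0, by omega⟩⟩
    infer_instance
  unfold opNorm
  have : LinearMap.toContinuousLinearMap (Matrix.toEuclideanLin (1 : Matrix (Fin N) (Fin N) ℂ)) =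
      ContinuousLinearMap.id ℂ _ := by
    ext x; simp
  rw [this, ContinuousLinearMap.norm_id]

def coefV (A : Fin m → Matrix (Fin N) (Fin N) ℂ) : Matrix (Fin N × Fin N) (Fin m) ℂ :=
  Matrix.of fun p r => A r p.1 p.2

lemma cov_eq (hg : ∀ i, IsStdGaussian μ (g i)) (hi : iIndepFun g μ)
    (A : Fin m → Matrix (Fin N) (Fin N) ℂ)
    (h0 : matExp μ (fun ω => ∑ i, g i ω • A i) = 0) :
    covMatrix μ (fun ω => ∑ i, g i ω • A i) = coefV A * (coefV A)ᴴ := by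
  ext p q
  simp only [covMatrix, h0, sub_zero, Matrix.of_apply, X_entry, coefV, Matrix.mul_apply,
    Matrix.conjTranspose_apply, map_sum, map_mul, Complex.conj_ofReal]
  rw [E_bil hg hi (fun i => A i p.1 p.2) (fun i => (starRingEnd ℂ) (A i q.1 q.2))]
  rfl

open scoped Matrix.Norms.L2Operator in
lemma vb_of_cov (A : Fin m → Matrix (Fin N) (Fin N) ℂ) (x : Fin m → ℂ) :
    ∑ a, ∑ b, ‖∑ i, A i a b * x i‖ ^ 2 ≤
      opNorm (coefV A * (coefV A)ᴴ) * ∑ i, ‖x i‖ ^ 2 := by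
  have h1 : opNorm (coefV A * (coefV A)ᴴ) = ‖coefV A‖ * ‖coefV A‖ := by
    have := Matrix.l2_opNorm_conjTranspose_mul_self ((coefV A)ᴴ)
    rw [Matrix.conjTranspose_conjTranspose, Matrix.l2_opNorm_conjTranspose] at this
    rw [← this, Matrix.l2_opNorm_def]
    rfl
  have h2 := Matrix.l2_opNorm_mulVec (coefV A) (WithLp.toLp 2 x)
  have h3 := mul_self_le_mul_self (norm_nonneg _) h2
  rw [mul_mul_mul_comm, ← h1, ← sq, ← sq, EuclideanSpace.norm_sq_eq, EuclideanSpace.norm_sq_eq] at h3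
  refine le_trans (le_of_eq ?_) h3
  rw [Fintype.sum_prod_type]
  rfl

lemma opNorm_nonneg' {a b : Type*} [Fintype a] [Fintype b] [DecidableEq b] (M : Matrix a b ℂ) :
    0 ≤ opNorm M := norm_nonneg _

end reduce



section scal

lemma ell_inside (w1 w2 : ℂ) (h1 : ‖w1‖ ≤ 1) (h2 : ‖w2‖ ≤ 1) :
    ∃ x : ℂ, ‖x‖ ≤ 1 ∧ w1 + w2 = x + (w1 * w2) * (starRingEnd ℂ) x := by
  set s := ‖w1‖ with hs
  set t := ‖w2‖ with ht
  have hs0 : 0 ≤ s := norm_nonneg _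
  have ht0 : 0 ≤ t := norm_nonneg _
  have c1 : w1 * (starRingEnd ℂ) w1 = ((s ^ 2 : ℝ) : ℂ) := by
    rw [Complex.mul_conj, Complex.normSq_eq_norm_sq]
  have c2 : w2 * (starRingEnd ℂ) w2 = ((t ^ 2 : ℝ) : ℂ) := by
    rw [Complex.mul_conj, Complex.normSq_eq_norm_sq]
  rcases eq_or_lt_of_le h1 with e | l
  · refine ⟨w1, h1, ?_⟩
    rw [e] at c1
    have : w1 * w2 * (starRingEnd ℂ) w1 = w2 * (w1 * (starRingEnd ℂ) w1) := by ring
    rw [this, c1]; simp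
  · have hst : s * t < 1 := by nlinarith
    have hd : 0 < 1 - (s * t) ^ 2 := by nlinarith [mul_nonneg hs0 ht0]
    have hd' : ((1 - (s * t) ^ 2 : ℝ) : ℂ) ≠ 0 := by exact_mod_cast hd.ne'
    set u : ℂ := w1 * ((1 - t ^ 2 : ℝ) : ℂ) + w2 * ((1 - s ^ 2 : ℝ) : ℂ) with hu
    refine ⟨u / ((1 - (s * t) ^ 2 : ℝ) : ℂ), ?_, ?_⟩
    · rw [norm_div, Complex.norm_real, Real.norm_of_nonneg hd.le, div_le_one hd]
      have : ‖u‖ ≤ s * (1 - t ^ 2) + t * (1 - s ^ 2) := by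
        refine (norm_add_le _ _).trans ?_
        rw [norm_mul, norm_mul, Complex.norm_real, Complex.norm_real,
          Real.norm_of_nonneg (by nlinarith), Real.norm_of_nonneg (by nlinarith)]
      refine this.trans ?_
      have k1 : 0 ≤ (1 - s) * (1 - t) := mul_nonneg (by linarith) (by linarith)
      nlinarith [mul_nonneg k1 (by linarith : 0 ≤ 1 - s * t)]
    · rw [map_div₀, Complex.conj_ofReal]
      rw [← mul_div_assoc, ← add_div, eq_div_iff hd']
      simp only [hu, map_add, map_mul, Complex.conj_ofReal]
      push_cast at c1 c2 ⊢
      linear_combination (-(w2 * (1 - (t:ℂ) ^ 2))) * c1 - (w1 * (1 - (s:ℂ) ^ 2)) * c2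

lemma ell_outside (ρ D : ℂ) (hρ : ‖ρ‖ ≤ 1) (ε : ℝ) (hε : 0 < ε) (hD : ‖D‖ ≤ ε / 4) (z : ℂ)
    (hz : z ∉ ellipticNbhd ρ ε) :
    ∃ w1 w2 : ℂ, w1 + w2 = z ∧ w1 * w2 = ρ + D ∧ 1 + ε / 4 ≤ ‖w1‖ ∧ ‖w2‖ ≤ 1 := by
  obtain ⟨w1, w2, hs, hp, hle⟩ : ∃ w1 w2 : ℂ, w1 + w2 = z ∧ w1 * w2 = ρ + D ∧ ‖w2‖ ≤ ‖w1‖ := by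
    obtain ⟨d, hd⟩ := IsAlgClosed.exists_eq_mul_self (z ^ 2 - 4 * (ρ + D))
    rcases le_total ‖(z - d) / 2‖ ‖(z + d) / 2‖ with h | h
    · exact ⟨_, _, by ring, by linear_combination hd / 4, h⟩
    · exact ⟨_, _, by ring, by linear_combination hd / 4, h⟩
  have key : ∀ x : ℂ, ‖x‖ ≤ 1 → ε < ‖z - (x + ρ * (starRingEnd ℂ) x)‖ := by
    intro x hx
    by_contra hc
    push Not at hc
    apply hz
    change Metric.infDist z (ellipticSet ρ) ≤ ε
    refine (Metric.infDist_le_dist_of_mem (show x + ρ * (starRingEnd ℂ) x ∈ ellipticSet ρ from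
      ⟨x, hx, rfl⟩)).trans ?_
    rwa [dist_eq_norm]
  have hr : ‖w1‖ * ‖w2‖ ≤ 1 + ε / 4 := by
    rw [← norm_mul, hp]
    exact (norm_add_le _ _).trans (by linarith)
  have h1 : 1 + ε / 4 ≤ ‖w1‖ := by
    by_contra hlt
    push Not at hlt
    rcases le_total ‖w1‖ 1 with h | h
    · obtain ⟨x, hx, he⟩ := ell_inside w1 w2 h (hle.trans h)
      have := key x hx
      rw [← hs, he, hp] at this
      have e : x + (ρ + D) * (starRingEnd ℂ) x - (x + ρ * (starRingEnd ℂ) x) =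
        D * (starRingEnd ℂ) x := by ring
      rw [e, norm_mul, RCLike.norm_conj] at this
      nlinarith [norm_nonneg D, norm_nonneg x]
    · set s := ‖w1‖ with hsd
      have hs0 : (s : ℂ) ≠ 0 := by
        have : s ≠ 0 := by linarith
        exact_mod_cast this
      have hx : ‖w1 / (s : ℂ)‖ = 1 := by
        rw [norm_div, Complex.norm_real, Real.norm_of_nonneg (by linarith), ← hsd]
        exact div_self (by linarith)
      have := key (w1 / s) hx.le
      have c1 : w1 * (starRingEnd ℂ) w1 = (s : ℂ) ^ 2 := by
        rw [Complex.mul_conj, Complex.normSq_eq_norm_sq]; push_cast; rfl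
      have e : z - (w1 / s + ρ * (starRingEnd ℂ) (w1 / s)) =
          (w1 / s) * ((s - 1 : ℝ) : ℂ) - w2 * ((s - 1 : ℝ) : ℂ)
            + D * (starRingEnd ℂ) (w1 / s) := by
        have hρ' : ρ = w1 * w2 - D := by rw [hp]; ring
        rw [hρ', ← hs, map_div₀, Complex.conj_ofReal]
        push_cast
        field_simp
        linear_combination (-w2) * c1
      rw [e] at this
      have b : ‖(w1 / s) * ((s - 1 : ℝ) : ℂ) - w2 * ((s - 1 : ℝ) : ℂ)
            + D * (starRingEnd ℂ) (w1 / s)‖ ≤ (s - 1) + ‖w2‖ * (s - 1) + ‖D‖ := by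
        refine (norm_add_le _ _).trans (add_le_add ((norm_sub_le _ _).trans ?_) ?_)
        · rw [norm_mul, norm_mul, hx, Complex.norm_real, Real.norm_of_nonneg (by linarith), one_mul]
        · rw [norm_mul, RCLike.norm_conj, hx, mul_one]
      have b2 : ‖w2‖ * (s - 1) ≤ ε / 4 := by
        have : s * (‖w2‖ * (s - 1)) ≤ s * (ε / 4) := by
          nlinarith [mul_le_mul_of_nonneg_right hr (by linarith : 0 ≤ s - 1)]
        exact le_of_mul_le_mul_left this (by linarith)
      linarith
  refine ⟨w1, w2, hs, hp, h1, ?_⟩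
  by_contra hc
  push Not at hc
  nlinarith [norm_nonneg w2]

lemma P_scalar (w1 w2 : ℂ) : ∀ k : ℕ,
    (w1 - w2) * FockData.P (w1 * w2) (w1 + w2) k = w1 ^ k - w2 ^ k ∧
    (w1 - w2) * FockData.P (w1 * w2) (w1 + w2) (k + 1) = w1 ^ (k + 1) - w2 ^ (k + 1)
  | 0 => by simp [FockData.P]
  | k + 1 => by
    obtain ⟨h1, h2⟩ := P_scalar w1 w2 k
    refine ⟨h2, ?_⟩
    rw [FockData.P, smul_eq_mul]
    linear_combination (w1 + w2) * h2 - w1 * w2 * h1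

lemma P_lower (w1 w2 : ℂ) (q : ℝ) (hq : 1 ≤ q) (h1 : q ≤ ‖w1‖) (h2 : ‖w2‖ ≤ 1) (k : ℕ) :
    (q ^ k - 1) / 2 ≤ ‖FockData.P (w1 * w2) (w1 + w2) (k + 1)‖ := by
  set p := FockData.P (w1 * w2) (w1 + w2) (k + 1)
  have h := congrArg norm (P_scalar w1 w2 k).2
  rw [norm_mul] at h
  have a : ‖w1 - w2‖ ≤ 2 * ‖w1‖ := (norm_sub_le _ _).trans (by linarith)
  have b : ‖w1‖ ^ (k + 1) - 1 ≤ ‖w1 ^ (k + 1) - w2 ^ (k + 1)‖ := by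
    have := norm_sub_norm_le (w1 ^ (k + 1)) (w2 ^ (k + 1))
    rw [norm_pow, norm_pow] at this
    have := pow_le_one₀ (n := k + 1) (norm_nonneg w2) h2
    linarith
  have c : q ^ k ≤ ‖w1‖ ^ k := pow_le_pow_left₀ (by linarith) h1 k
  have d := mul_le_mul_of_nonneg_right a (norm_nonneg p)
  have hs : 1 ≤ ‖w1‖ := hq.trans h1
  rw [pow_succ] at b
  have : ‖w1‖ * (q ^ k - 1) ≤ ‖w1‖ * (2 * ‖p‖) := by nlinarith
  have := le_of_mul_le_mul_left this (by linarith)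
  linarith

lemma P_mulVec {N : ℕ} (M : Matrix (Fin N) (Fin N) ℂ) (r z : ℂ) (y : Fin N → ℂ)
    (h : M *ᵥ y = z • y) : ∀ k : ℕ,
    FockData.P r M k *ᵥ y = FockData.P r z k • y ∧
    FockData.P r M (k + 1) *ᵥ y = FockData.P r z (k + 1) • y
  | 0 => by simp [FockData.P]
  | k + 1 => by
    obtain ⟨h1, h2⟩ := P_mulVec M r z y h k
    refine ⟨h2, ?_⟩
    rw [FockData.P, FockData.P, Matrix.sub_mulVec, ← Matrix.mulVec_mulVec, h2, Matrix.smul_mulVec, h1,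
      Matrix.mulVec_smul, h]
    simp only [smul_eq_mul, sub_smul, smul_smul, mul_comm]

lemma eig_frob {N : ℕ} (M : Matrix (Fin N) (Fin N) ℂ) (p : ℂ) (y : Fin N → ℂ) (hy : y ≠ 0)
    (h : M *ᵥ y = p • y) : ‖p‖ ^ 2 ≤ ∑ b, ∑ c, ‖M c b‖ ^ 2 := by
  have hpos : 0 < ∑ b, ‖y b‖ ^ 2 := by
    obtain ⟨b, hb⟩ := Function.ne_iff.1 hy
    refine Finset.sum_pos' (fun _ _ => by positivity) ⟨b, Finset.mem_univ _, ?_⟩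
    have : 0 < ‖y b‖ := norm_pos_iff.2 hb
    positivity
  have hc : ∀ c, ‖p‖ ^ 2 * ‖y c‖ ^ 2 ≤ (∑ b, ‖M c b‖ ^ 2) * ∑ b, ‖y b‖ ^ 2 := by
    intro c
    have e := congrFun h c
    have : ‖p‖ * ‖y c‖ ≤ ∑ b, ‖M c b‖ * ‖y b‖ := by
      rw [← norm_mul]
      change _ = p * y c at e
      rw [← e]
      change ‖∑ b, M c b * y b‖ ≤ _
      refine (norm_sum_le Finset.univ (fun b => M c b * y b)).trans (le_of_eq ?_)
      simp
    rw [← mul_pow]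
    exact (pow_le_pow_left₀ (by positivity) this 2).trans (Finset.sum_mul_sq_le_sq_mul_sq _ _ _)
  have := Finset.sum_le_sum fun c (_ : c ∈ Finset.univ) => hc c
  rw [← Finset.mul_sum, ← Finset.sum_mul, Finset.sum_comm] at this
  exact le_of_mul_le_mul_right this hpos

lemma eig_vec {N : ℕ} (M : Matrix (Fin N) (Fin N) ℂ) (z : ℂ) (hz : z ∈ eigs M) :
    ∃ y : Fin N → ℂ, y ≠ 0 ∧ M *ᵥ y = z • y := by
  have h := Polynomial.isRoot_of_mem_roots hz
  rw [Polynomial.IsRoot, Matrix.eval_charpoly] at h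
  obtain ⟨y, hy, e⟩ := Matrix.exists_mulVec_eq_zero_iff.2 h
  refine ⟨y, hy, ?_⟩
  rw [Matrix.sub_mulVec, sub_eq_zero] at e
  rw [← e]
  simp

lemma bad_bound {N : ℕ} (M : Matrix (Fin N) (Fin N) ℂ) (ρ D : ℂ) (hρ : ‖ρ‖ ≤ 1) (ε : ℝ)
    (hε : 0 < ε) (hD : ‖D‖ ≤ ε / 4) (k : ℕ)
    (h : ¬ ∀ z ∈ eigs M, z ∈ ellipticNbhd ρ ε) :
    (((1 + ε / 4) ^ k - 1) / 2) ^ 2 ≤ ∑ b, ∑ c, ‖FockData.P (ρ + D) M (k + 1) c b‖ ^ 2 := by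
  push Not at h
  obtain ⟨z, hz, hn⟩ := h
  obtain ⟨w1, w2, hs, hp, h1, h2⟩ := ell_outside ρ D hρ ε hε hD z hn
  obtain ⟨y, hy, e⟩ := eig_vec M z hz
  have a := P_lower w1 w2 (1 + ε / 4) (by linarith) h1 h2 k
  rw [hs, hp] at a
  have b := eig_frob _ _ y hy (P_mulVec M (ρ + D) z y e k).2
  refine le_trans (pow_le_pow_left₀ ?_ a 2) b
  have : 1 ≤ (1 + ε / 4) ^ k := one_le_pow₀ (by linarith)
  linarith

end scal


/-- deterministic parameter choice -/
lemma param_choice (ε : ℝ) (hε : 0 < ε) : ∃ κ Λ : ℝ, 0 < κ ∧ 1 ≤ Λ ∧ ∀ N : ℕ, 2 ≤ N →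
    Λ ≤ Real.log N → ∃ k : ℕ, (N : ℝ) ^ 3 ≤ (1 + ε / 4) ^ k ∧ ((k + 1 : ℕ) : ℝ) ≤ κ * Real.log N ∧
      (((k + 1 : ℕ) : ℝ) * (Real.log N)⁻¹ ^ 4) * ((k + 1 : ℕ) : ℝ) ^ 2 ≤ 1 / 6 := by
  set ℓ := Real.log (1 + ε / 4) with hℓ
  have hℓ0 : 0 < ℓ := Real.log_pos (by linarith)
  set κ := 3 / ℓ + 2 with hκ
  have h3 : 0 < 3 / ℓ := by positivity
  have hκ2 : 2 ≤ κ := by linarith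
  refine ⟨κ, 6 * κ ^ 3, by linarith, ?_, ?_⟩
  · have : (2 : ℝ) ^ 3 ≤ κ ^ 3 := pow_le_pow_left₀ (by norm_num) hκ2 3
    linarith
  intro N hN hL
  set L := Real.log N with hLd
  have hκ3 : (2 : ℝ) ^ 3 ≤ κ ^ 3 := pow_le_pow_left₀ (by norm_num) hκ2 3
  have hL1 : 1 ≤ L := by linarith
  have hK : ((⌈3 * L / ℓ⌉₊ + 1 : ℕ) : ℝ) ≤ κ * L := by
    have := Nat.ceil_lt_add_one (a := 3 * L / ℓ) (by positivity)
    have e : κ * L = 3 * L / ℓ + 2 * L := by rw [hκ]; ring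
    push_cast
    linarith
  refine ⟨⌈3 * L / ℓ⌉₊, ?_, hK, ?_⟩
  · have hN0 : (0 : ℝ) < N := by positivity
    rw [← Real.log_le_log_iff (by positivity) (by positivity), Real.log_pow, Real.log_pow]
    have := Nat.le_ceil (3 * L / ℓ)
    rw [div_le_iff₀ hℓ0] at this
    exact_mod_cast this
  · set K : ℝ := ((⌈3 * L / ℓ⌉₊ + 1 : ℕ) : ℝ)
    have hK0 : 0 ≤ K := Nat.cast_nonneg _
    have e : K * L⁻¹ ^ 4 * K ^ 2 = K ^ 3 / L ^ 4 := by
      rw [inv_pow, div_eq_mul_inv]; ring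
    rw [e, div_le_iff₀ (by positivity)]
    have := pow_le_pow_left₀ hK0 hK 3
    have h2 : 6 * κ ^ 3 * L ^ 3 ≤ L * L ^ 3 := mul_le_mul_of_nonneg_right hL (by positivity)
    nlinarith

lemma cov_small {Ω : Type*} [MeasurableSpace Ω] {μ : Measure Ω} [IsProbabilityMeasure μ]
    {N : ℕ} (hN : 2 ≤ N) (X : Ω → Matrix (Fin N) (Fin N) ℂ) (h0 : matExp μ X = 0)
    (h1 : matExp μ (fun ω => X ω * (X ω)ᴴ) = 1) (h2 : matExp μ (fun ω => (X ω)ᴴ * X ω) = 1)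
    (x : ℝ) (hx : 0 ≤ x) (hv : vTildeParam μ X ≤ x) : opNorm (covMatrix μ X) ≤ x ^ 4 := by
  have hs : sigmaParam μ X = 1 := by
    unfold sigmaParam
    simp only [h0, sub_zero, h1, h2, opNorm_one' hN, min_self, Real.sqrt_one]
  unfold vTildeParam vParam at hv
  rw [hs, mul_one] at hv
  have a := (Real.sqrt_le_left hx).1 hv
  have b := (Real.sqrt_le_left (by positivity)).1 a
  calc _ ≤ _ := b
    _ = _ := by ring

lemma prob_core {Ω : Type*} [MeasurableSpace Ω] {μ : Measure Ω} [IsProbabilityMeasure μ]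
    {N : ℕ} (hN : 2 ≤ N) (X : Ω → Matrix (Fin N) (Fin N) ℂ) (ρ D : ℂ) (hρ : ‖ρ‖ ≤ 1)
    (ε : ℝ) (hε : 0 < ε) (hD : ‖D‖ ≤ ε / 4) (hX : IsGaussianMatrix μ X)
    (h0 : matExp μ X = 0)
    (h1 : matExp μ (fun ω => X ω * (X ω)ᴴ) = 1) (h2 : matExp μ (fun ω => (X ω)ᴴ * X ω) = 1)
    (h3 : matExp μ (fun ω => X ω * X ω) = (ρ + D) • (1 : Matrix (Fin N) (Fin N) ℂ))
    (x : ℝ) (hx : 0 < x) (hv : vTildeParam μ X ≤ x) (k : ℕ)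
    (hk : (((k + 1 : ℕ) : ℝ) * x ^ 4) * ((k + 1 : ℕ) : ℝ) ^ 2 ≤ 1 / 6) (T : ℝ)
    (hT : T ≤ (((1 + ε / 4) ^ k - 1) / 2) ^ 2) :
    T * (1 - μ.real {ω | ∀ z ∈ eigs (X ω), z ∈ ellipticNbhd ρ ε}) ≤
      N * (6 * ((k + 1 : ℕ) : ℝ)) ^ 2 := by
  have hcov := cov_small hN X h0 h1 h2 x hx.le hv
  obtain ⟨n, A0, A, g, hg, hi, hXe⟩ := hX
  have hXf : X = fun ω => A0 + ∑ i, g i ω • A i := funext hXe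
  have hA0 : A0 = 0 := by
    rw [← h0, hXf]; exact (matExp_affine hg hi A0 A).symm
  have hXf : X = fun ω => ∑ i, g i ω • A i := by rw [hXf, hA0]; simp
  clear hXe
  subst hXf
  have e1 : ∑ i, A i * (A i)ᴴ = 1 := by
    rw [← h1, ← matExp_mul hg hi]; simp only [X_ct]
  have e2 : ∑ i, (A i)ᴴ * A i = 1 := by
    rw [← h2, ← matExp_mul hg hi]; simp only [X_ct]
  have e3 : ∑ i, A i * A i = (ρ + D) • (1 : Matrix (Fin N) (Fin N) ℂ) := by
    rw [← h3, ← matExp_mul hg hi]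
  rw [cov_eq hg hi A h0] at hcov
  have hVB : VB A (x ^ 4) := fun y => (vb_of_cov A y).trans
    (mul_le_mul_of_nonneg_right hcov (Finset.sum_nonneg fun _ _ => by positivity))
  obtain ⟨I, B⟩ := moment_bound hg hi A (x ^ 4) (by positivity) hVB (ρ + D) e3 e2 e1 (k + 1)
    (((k + 1 : ℕ) : ℝ) * x ^ 4) (by positivity) le_rfl hk
  set f : Ω → ℝ := fun ω => ∑ b, ∑ c, ‖FockData.P (ρ + D) (∑ i, g i ω • A i) (k + 1) c b‖ ^ 2
    with hf
  have hf0 : 0 ≤ᵐ[μ] f := Eventually.of_forall fun ω =>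
    Finset.sum_nonneg fun _ _ => Finset.sum_nonneg fun _ _ => by positivity
  set T' := (((1 + ε / 4) ^ k - 1) / 2) ^ 2 with hT'
  have M := mul_meas_ge_le_integral_of_nonneg hf0 I T'
  set G := {ω | ∀ z ∈ eigs (∑ i, g i ω • A i), z ∈ ellipticNbhd ρ ε} with hG
  have hcover : 1 ≤ μ.real G + μ.real {ω | T' ≤ f ω} := by
    rw [← probReal_univ (μ := μ)]
    refine (measureReal_mono (fun ω _ => ?_)).trans (measureReal_union_le _ _)
    by_cases h : ω ∈ G
    · exact Or.inl h
    · exact Or.inr (bad_bound _ ρ D hρ ε hε hD k h)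
  have hle : μ.real G ≤ 1 := measureReal_le_one
  have hT0 : 0 ≤ T' := sq_nonneg _
  calc T * (1 - μ.real G) ≤ T' * (1 - μ.real G) :=
        mul_le_mul_of_nonneg_right hT (by linarith)
    _ ≤ T' * μ.real {ω | T' ≤ f ω} := mul_le_mul_of_nonneg_left (by linarith) hT0
    _ ≤ _ := M.trans B

/-- Master theorem, Gaussian case, no outliers: with probability at least 1 − C₁N^{−1.5},
all eigenvalues of X lie in 𝓔_{ρ,ε}. -/
theorem stmt2 (ρ : ℂ) (hρ : ‖ρ‖ ≤ 1) (ε : ℝ) (hε : 0 < ε) :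
    ∃ C₁ c₀ : ℝ, 0 < C₁ ∧ 0 < c₀ ∧
      ∀ (N : ℕ), 2 ≤ N →
      ∀ (Ω : Type) (_ : MeasurableSpace Ω) (μ : Measure Ω), IsProbabilityMeasure μ →
      ∀ (X : Ω → Matrix (Fin N) (Fin N) ℂ) (D : ℂ),
        IsGaussianMatrix μ X →
        matExp μ X = 0 →
        matExp μ (fun ω => X ω * (X ω)ᴴ) = 1 →
        matExp μ (fun ω => (X ω)ᴴ * X ω) = 1 →
        matExp μ (fun ω => X ω * X ω) = (ρ + D) • (1 : Matrix (Fin N) (Fin N) ℂ) →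
        ‖D‖ ≤ c₀ / Real.log N →
        vTildeParam μ X ≤ (Real.log N)⁻¹ →
        sigmaStarParam μ X ≤ (Real.log N) ^ (-(3/2 : ℝ)) →
        ENNReal.ofReal (1 - C₁ * (N : ℝ) ^ (-(1.5 : ℝ))) ≤
          μ {ω | ∀ z ∈ eigs (X ω), z ∈ ellipticNbhd ρ ε} := by
  obtain ⟨κ, Λ, hκ, hΛ, hpar⟩ := param_choice ε hε
  refine ⟨Real.exp (1.5 * Λ) + 576 * κ ^ 2, ε / 8, by positivity, by positivity, ?_⟩
  intro N hN Ω _ μ hμ X D hX h0 h1 h2 h3 hD hv _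
  have hN2 : (2 : ℝ) ≤ N := by exact_mod_cast hN
  have hN0 : (0 : ℝ) < N := by linarith
  have hL2 : 1 / 2 ≤ Real.log N := by
    have a : Real.log 2 ≤ Real.log N := Real.log_le_log (by norm_num) hN2
    have := Real.log_two_gt_d9
    linarith
  have hpw : 0 < (N : ℝ) ^ (-(1.5 : ℝ)) := Real.rpow_pos_of_pos hN0 _
  rcases lt_or_ge (Real.log N) Λ with hs | hl
  · have : 1 ≤ Real.exp (1.5 * Λ) * (N : ℝ) ^ (-(1.5 : ℝ)) := by
      rw [Real.rpow_def_of_pos hN0, ← Real.exp_add]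
      exact Real.one_le_exp (by linarith)
    rw [ENNReal.ofReal_of_nonpos]
    · exact zero_le
    · have : 0 ≤ 576 * κ ^ 2 * (N : ℝ) ^ (-(1.5 : ℝ)) := by positivity
      linarith
  · obtain ⟨k, hk1, hk2, hk3⟩ := hpar N hN hl
    have hL0 : 0 < Real.log N := by linarith
    have hD' : ‖D‖ ≤ ε / 4 := by
      refine hD.trans ?_
      rw [div_le_iff₀ hL0]
      nlinarith
    have hN3 : (8 : ℝ) ≤ (N : ℝ) ^ 3 := by
      have := pow_le_pow_left₀ (by norm_num) hN2 3
      linarith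
    have hT : (N : ℝ) ^ 6 / 16 ≤ (((1 + ε / 4) ^ k - 1) / 2) ^ 2 := by
      have a : (N : ℝ) ^ 3 / 4 ≤ ((1 + ε / 4) ^ k - 1) / 2 := by linarith
      have := pow_le_pow_left₀ (by positivity) a 2
      calc (N : ℝ) ^ 6 / 16 = ((N : ℝ) ^ 3 / 4) ^ 2 := by ring
        _ ≤ _ := this
    have B := prob_core hN X ρ D hρ ε hε hD' hX h0 h1 h2 h3 _ (inv_pos.2 hL0) hv k hk3 _ hT
    set p := μ.real {ω | ∀ z ∈ eigs (X ω), z ∈ ellipticNbhd ρ ε} with hp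
    have hLN : Real.log N ≤ N := (Real.log_le_sub_one_of_pos hN0).trans (by linarith)
    have hKN : ((k + 1 : ℕ) : ℝ) ≤ κ * N := hk2.trans (mul_le_mul_of_nonneg_left hLN hκ.le)
    have hKN2 := pow_le_pow_left₀ (Nat.cast_nonneg _) hKN 2
    have B2 : (N : ℝ) ^ 6 / 16 * (1 - p) ≤ 36 * κ ^ 2 * (N : ℝ) ^ 3 := by
      refine B.trans ?_
      have := mul_le_mul_of_nonneg_left hKN2 hN0.le
      calc _ = 36 * (N * ((k + 1 : ℕ) : ℝ) ^ 2) := by ring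
        _ ≤ 36 * (N * (κ * N) ^ 2) := by linarith
        _ = _ := by ring
    have B3 : 1 - p ≤ 576 * κ ^ 2 * (N : ℝ) ^ (-(3 : ℝ)) := by
      have e : (N : ℝ) ^ (-(3 : ℝ)) = ((N : ℝ) ^ 3)⁻¹ := by
        rw [Real.rpow_neg hN0.le]; norm_cast
      rw [e, ← div_eq_mul_inv, le_div_iff₀ (by positivity)]
      have : (N : ℝ) ^ 3 * ((1 - p) * (N : ℝ) ^ 3) ≤ (N : ℝ) ^ 3 * (576 * κ ^ 2) := by
        nlinarith
      exact le_of_mul_le_mul_left this (by positivity)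
    have B4 : (N : ℝ) ^ (-(3 : ℝ)) ≤ (N : ℝ) ^ (-(1.5 : ℝ)) :=
      Real.rpow_le_rpow_of_exponent_le (by linarith) (by norm_num)
    have B5 : 1 - p ≤ 576 * κ ^ 2 * (N : ℝ) ^ (-(1.5 : ℝ)) :=
      B3.trans (mul_le_mul_of_nonneg_left B4 (by positivity))
    refine ENNReal.ofReal_le_of_le_toReal ?_
    change _ ≤ p
    have : 0 ≤ Real.exp (1.5 * Λ) * (N : ℝ) ^ (-(1.5 : ℝ)) := by positivity
    linarith

end
end

section
/- Let (X_N) be the Gaussian random band matrices on increasing d_N-regular digraphs with d_N/(log N)³ → ∞ described in the context. Then for every ε > 0, almost surely, for all sufficiently large N every eigenvalue of d_N^{−1/2}·X_N has modulus at most 1 + ε. -/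
open MeasureTheory ProbabilityTheory Filter Matrix
open scoped ENNReal Classical

noncomputable section

/-- The model of Theorem 1.1: Gaussian random matrices on increasing d_N-regular
digraphs G_N = ([N], E_N), with independent standard real Gaussian entries on the edges. -/
structure GaussianDigraphBandModel (Ω : Type) [MeasurableSpace Ω] (μ : Measure Ω)
    (d : ℕ → ℕ) (E : ℕ → Finset (ℕ × ℕ)) (g : ℕ × ℕ → Ω → ℝ)
    (X : ∀ N : ℕ, Ω → Matrix (Fin N) (Fin N) ℂ) : Prop where
  deg_ge : ∀ N, 1 ≤ N → 1 ≤ d N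
  deg_le : ∀ N, d N ≤ N
  deg_growth : Tendsto (fun N => (d N : ℝ) / (Real.log N) ^ 3) atTop atTop
  edges_lt : ∀ N, ∀ e ∈ E N, e.1 < N ∧ e.2 < N
  edges_mono : ∀ N, E N ⊆ E (N + 1)
  out_degree : ∀ N, ∀ x < N, ((E N).filter (fun e => e.1 = x)).card = d N
  in_degree : ∀ N, ∀ y < N, ((E N).filter (fun e => e.2 = y)).card = d N
  loops : ∀ N, (∀ x < N, (x, x) ∈ E N) ∨ (∀ x < N, (x, x) ∉ E N)
  g_meas : ∀ e, Measurable (g e)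
  g_gaussian : ∀ e ∈ ⋃ N, (E N : Set (ℕ × ℕ)), Measure.map (g e) μ = gaussianReal 0 1
  g_indep : iIndepFun
      (fun e : {e : ℕ × ℕ // e ∈ ⋃ N, (E N : Set (ℕ × ℕ))} => g e.1) μ
  X_def : ∀ N ω (x y : Fin N),
      X N ω x y = if ((x : ℕ), (y : ℕ)) ∈ E N then (g ((x : ℕ), (y : ℕ)) ω : ℂ) else 0

/-- Moments of the standard Gaussian. -/
def gmom (j : ℕ) : ℝ := ∫ x, x ^ j ∂(gaussianReal 0 1)

/-- Expectation of a monomial, as a function of the list of its factors. -/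
def phi {ι : Type*} (L : List ι) : ℝ := ∏ e ∈ L.toFinset, gmom (L.count e)

lemma gmom_nonneg (j : ℕ) : 0 ≤ gmom j := by
  rcases Nat.even_or_odd j with h | h
  · exact integral_nonneg fun x => h.pow_nonneg x
  · have h1 : Measure.map (fun x : ℝ => -x) (gaussianReal 0 1) = gaussianReal 0 1 := by
      rw [gaussianReal_map_neg]; simp
    have h2 : gmom j = - gmom j := by
      conv_lhs => rw [gmom, ← h1]
      rw [integral_map (by fun_prop) (by fun_prop)]
      simp only [h.neg_pow, integral_neg, gmom]
    linarith

lemma phi_nonneg {ι : Type*} (L : List ι) : 0 ≤ phi L :=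
  Finset.prod_nonneg fun _ _ => gmom_nonneg _

lemma phi_map {ι κ : Type*} (f : ι → κ) (L : List ι)
    (hf : ∀ a ∈ L, ∀ b ∈ L, f a = f b → a = b) : phi (L.map f) = phi L := by
  unfold phi
  have h1 : (L.map f).toFinset = L.toFinset.image f := by
    ext x; simp
  rw [h1, Finset.prod_image]
  · refine Finset.prod_congr rfl fun e he => ?_
    congr 1
    rw [List.count, List.countP_map, List.count]
    refine List.countP_congr fun x hx => ?_
    simp only [List.mem_toFinset] at he
    simp only [Function.comp, beq_iff_eq]
    exact ⟨fun h => hf x hx e he h, fun h => by rw [h]⟩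
  · intro a ha b hb h
    exact hf a (by simpa using ha) b (by simpa using hb) h

lemma integrable_pow_gauss (j : ℕ) : Integrable (fun x : ℝ => x ^ j) (gaussianReal 0 1) := by
  have := (memLp_id_gaussianReal (μ := 0) (v := 1) (j : NNReal)).integrable_norm_pow'
  refine this.mono' (by fun_prop) (ae_of_all _ fun x => by simp)

lemma integral_monomial {Ω ι : Type*} [MeasurableSpace Ω] (μ : Measure Ω) [IsProbabilityMeasure μ]
    (f : ι → Ω → ℝ) (hm : ∀ e, Measurable (f e))
    (hg : ∀ e, Measure.map (f e) μ = gaussianReal 0 1) (hi : iIndepFun f μ) (L : List ι) :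
    Integrable (fun ω => (L.map (fun e => f e ω)).prod) μ ∧
      ∫ ω, (L.map (fun e => f e ω)).prod ∂μ = phi L := by
  have h1 : ∀ ω, (L.map (fun e => f e ω)).prod =
      ∏ e : {e // e ∈ L.toFinset}, (f e.1 ω) ^ (L.count e.1) := by
    intro ω
    rw [Finset.prod_list_map_count, ← Finset.prod_coe_sort L.toFinset]
  have hi' : iIndepFun (fun e : {e // e ∈ L.toFinset} => f e.1) μ :=
    hi.precomp Subtype.val_injective
  have hmap := (iIndepFun_iff_map_fun_eq_pi_map (fun e : {e // e ∈ L.toFinset} =>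
    (hm e.1).aemeasurable)).1 hi'
  simp only [hg] at hmap
  have hIntg : Integrable (fun x : {e // e ∈ L.toFinset} → ℝ => ∏ e, (x e) ^ (L.count e.1))
      (Measure.pi fun _ => gaussianReal 0 1) :=
    Integrable.fintype_prod (f := fun (e : {e // e ∈ L.toFinset}) (x : ℝ) => x ^ (L.count e.1))
      fun e => integrable_pow_gauss _
  have hmeas : Measurable (fun ω => fun e : {e // e ∈ L.toFinset} => f e.1 ω) :=
    measurable_pi_lambda _ fun e => hm e.1
  simp only [h1]
  rw [← hmap] at hIntg
  refine ⟨hIntg.comp_measurable hmeas, ?_⟩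
  have h2 := integral_map (μ := μ) hmeas.aemeasurable hIntg.aestronglyMeasurable
  rw [← h2, hmap, integral_fintype_prod_eq_prod
    (f := fun (e : {e // e ∈ L.toFinset}) (x : ℝ) => x ^ (L.count e.1))]
  unfold phi
  rw [← Finset.prod_coe_sort L.toFinset]
  rfl

/-- Second-phase walk sum. -/
def walkQ {α : Type*} (nb : α → Finset α) (y : α) : ℕ → α → List (α × α) → ℝ
  | 0, c, L => if c = y then phi L else 0
  | j + 1, c, L => ∑ v ∈ nb c, walkQ nb y j v ((c, v) :: L)

/-- First-phase walk sum. -/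
def walkP {α : Type*} (nb : α → Finset α) (k : ℕ) (x : α) : ℕ → α → List (α × α) → ℝ
  | 0, c, L => walkQ nb c k x L
  | j + 1, c, L => ∑ v ∈ nb c, walkP nb k x j v ((c, v) :: L)

lemma walkQ_nonneg {α : Type*} (nb : α → Finset α) (y : α) (j : ℕ) :
    ∀ c L, 0 ≤ walkQ nb y j c L := by
  induction j with
  | zero => intro c L; unfold walkQ; split_ifs; exacts [phi_nonneg _, le_rfl]
  | succ j ih => intro c L; unfold walkQ; exact Finset.sum_nonneg fun _ _ => ih _ _

lemma walkP_nonneg {α : Type*} (nb : α → Finset α) (k : ℕ) (x : α) (j : ℕ) :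
    ∀ c L, 0 ≤ walkP nb k x j c L := by
  induction j with
  | zero => intro c L; unfold walkP; exact walkQ_nonneg _ _ _ _ _
  | succ j ih => intro c L; unfold walkP; exact Finset.sum_nonneg fun _ _ => ih _ _

/-- One exploration step: visited vertices are matched by `f`, new vertices with new labels. -/
lemma step_le {α : Type*} {n d : ℕ} (A : Finset α) (hA : A.card ≤ d) (S : Finset α)
    (f : α → Fin n) (hf : Set.InjOn f S) (hn : d + S.card ≤ n)
    (F : α → ℝ) (G : Fin n → ℝ) (hG : ∀ i, 0 ≤ G i)
    (hold : ∀ v ∈ S, F v ≤ G (f v))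
    (hnew : ∀ v ∉ S, ∀ i ∉ S.image f, F v ≤ G i) :
    ∑ v ∈ A, F v ≤ ∑ i, G i := by
  have hc : (A \ S).card ≤ ((S.image f)ᶜ).card := by
    have h1 : (A \ S).card ≤ A.card := Finset.card_le_card Finset.sdiff_subset
    have h2 : (S.image f).card ≤ S.card := Finset.card_image_le
    rw [Finset.card_compl, Fintype.card_fin]; omega
  obtain ⟨φ, hφ1, hφ2⟩ : ∃ φ : α → Fin n, (∀ v ∈ A \ S, φ v ∈ (S.image f)ᶜ) ∧
      Set.InjOn φ (A \ S : Finset α) := by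
    by_cases hne : (A \ S).Nonempty
    · have : Nonempty (Fin n) := by
        obtain ⟨i, _⟩ := Finset.card_pos.1 (lt_of_lt_of_le (Finset.card_pos.2 hne) hc)
        exact ⟨i⟩
      obtain ⟨e⟩ : Nonempty ((A \ S : Finset α) ↪ ((S.image f)ᶜ : Finset (Fin n))) := by
        apply Function.Embedding.nonempty_of_card_le
        rw [Fintype.card_coe, Fintype.card_coe]; exact hc
      refine ⟨fun v => if h : v ∈ A \ S then (e ⟨v, h⟩).1 else Classical.arbitrary _, ?_, ?_⟩
      · intro v hv; simp only [hv, dif_pos]; exact (e ⟨v, hv⟩).2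
      · intro v hv w hw h
        simp only [Finset.mem_coe] at hv hw
        simp only [hv, hw, dif_pos] at h
        simpa using e.injective (Subtype.ext h)
    · refine ⟨f, ?_, ?_⟩
      · intro v hv; exact absurd ⟨v, hv⟩ hne
      · intro v hv; exact absurd ⟨v, hv⟩ hne
  have e1 : ∑ v ∈ A, F v = ∑ v ∈ A ∩ S, F v + ∑ v ∈ A \ S, F v := by
    rw [Finset.sum_inter_add_sum_sdiff]
  rw [e1, ← Finset.sum_add_sum_compl (S.image f)]
  refine add_le_add ?_ ?_
  · calc ∑ v ∈ A ∩ S, F v ≤ ∑ v ∈ A ∩ S, G (f v) :=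
          Finset.sum_le_sum fun v hv => hold v (Finset.mem_inter.1 hv).2
      _ ≤ ∑ v ∈ S, G (f v) :=
          Finset.sum_le_sum_of_subset_of_nonneg Finset.inter_subset_right fun _ _ _ => hG _
      _ = ∑ i ∈ S.image f, G i := by rw [Finset.sum_image hf]
  · calc ∑ v ∈ A \ S, F v ≤ ∑ v ∈ A \ S, G (φ v) :=
          Finset.sum_le_sum fun v hv => hnew v (Finset.mem_sdiff.1 hv).2 _
            (Finset.mem_compl.1 (hφ1 v hv))
      _ = ∑ i ∈ (A \ S).image φ, G i := by rw [Finset.sum_image hφ2]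
      _ ≤ ∑ i ∈ (S.image f)ᶜ, G i := by
          refine Finset.sum_le_sum_of_subset_of_nonneg ?_ fun _ _ _ => hG _
          intro i hi
          obtain ⟨v, hv, rfl⟩ := Finset.mem_image.1 hi
          exact hφ1 v hv

lemma inj_update {α β : Type*} [DecidableEq β] (S : Finset α) (f : α → β) (hf : Set.InjOn f S)
    (v : α) (hv : v ∉ S) (i : β) (hi : i ∉ S.image f) :
    Set.InjOn (Function.update f v i) (insert v S : Finset α) := by
  intro a ha b hb h
  simp only [Finset.coe_insert, Set.mem_insert_iff, Finset.mem_coe] at ha hb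
  have key : ∀ c ∈ S, c ≠ v := fun c hc h => hv (h ▸ hc)
  rcases ha with rfl | ha <;> rcases hb with rfl | hb
  · rfl
  · rw [Function.update_self, Function.update_of_ne (key b hb)] at h
    exact absurd (Finset.mem_image.2 ⟨b, hb, h.symm⟩) hi
  · rw [Function.update_self, Function.update_of_ne (key a ha)] at h
    exact absurd (Finset.mem_image.2 ⟨a, ha, h⟩) hi
  · rw [Function.update_of_ne (key b hb), Function.update_of_ne (key a ha)] at h
    exact hf ha hb h

lemma map_update {α β : Type*} (S : Finset α) (f : α → β) (v : α) (hv : v ∉ S) (i : β)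
    (L : List (α × α)) (hL : ∀ e ∈ L, e.1 ∈ S ∧ e.2 ∈ S) :
    L.map (Prod.map (Function.update f v i) (Function.update f v i)) = L.map (Prod.map f f) := by
  refine List.map_congr_left fun e he => ?_
  have key : ∀ c ∈ S, c ≠ v := fun c hc h => hv (h ▸ hc)
  simp [Prod.map, Function.update_of_ne (key _ (hL e he).1),
    Function.update_of_ne (key _ (hL e he).2)]

lemma walkQ_le {α : Type*} {n d : ℕ} (nb : α → Finset α) (hnb : ∀ a, (nb a).card ≤ d) (y : α)
    (j : ℕ) : ∀ (c : α) (L : List (α × α)) (S : Finset α) (f : α → Fin n),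
      y ∈ S → c ∈ S → (∀ e ∈ L, e.1 ∈ S ∧ e.2 ∈ S) → Set.InjOn f S → d + S.card + j ≤ n →
      walkQ nb y j c L ≤ walkQ (fun _ => Finset.univ) (f y) j (f c) (L.map (Prod.map f f)) := by
  induction j with
  | zero =>
    intro c L S f hy hc hL hf hn
    unfold walkQ
    by_cases h : c = y
    · rw [if_pos h, if_pos (by rw [h]), phi_map]
      rintro ⟨a, a'⟩ ha ⟨b, b'⟩ hb hab
      simp only [Prod.map, Prod.mk.injEq] at hab
      have h1 := hf (hL _ ha).1 (hL _ hb).1 hab.1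
      have h2 := hf (hL _ ha).2 (hL _ hb).2 hab.2
      simp only at h1 h2
      rw [h1, h2]
    · rw [if_neg h]; split_ifs; exacts [phi_nonneg _, le_rfl]
  | succ j ih =>
    intro c L S f hy hc hL hf hn
    unfold walkQ
    refine step_le (nb c) (hnb c) S f hf (by omega) _ _ (fun i => walkQ_nonneg _ _ _ _ _) ?_ ?_
    · intro v hv
      refine ih v ((c, v) :: L) S f hy hv ?_ hf (by omega)
      intro e he
      rcases List.mem_cons.1 he with rfl | he
      exacts [⟨hc, hv⟩, hL e he]
    · intro v hv i hi
      have key : ∀ c ∈ S, c ≠ v := fun c hc h => hv (h ▸ hc)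
      have := ih v ((c, v) :: L) (insert v S) (Function.update f v i)
        (Finset.mem_insert_of_mem hy) (Finset.mem_insert_self _ _) ?_
        (inj_update S f hf v hv i hi) ?_
      · simpa [map_update S f v hv i L hL, Prod.map, Function.update_of_ne (key c hc),
          Function.update_of_ne (key y hy)] using this
      · intro e he
        rcases List.mem_cons.1 he with rfl | he
        · exact ⟨Finset.mem_insert_of_mem hc, Finset.mem_insert_self _ _⟩
        · exact ⟨Finset.mem_insert_of_mem (hL e he).1, Finset.mem_insert_of_mem (hL e he).2⟩
      · rw [Finset.card_insert_of_notMem hv]; omega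

lemma walkP_le {α : Type*} {n d : ℕ} (nb : α → Finset α) (hnb : ∀ a, (nb a).card ≤ d) (k : ℕ)
    (x : α) (j : ℕ) : ∀ (c : α) (L : List (α × α)) (S : Finset α) (f : α → Fin n),
      x ∈ S → c ∈ S → (∀ e ∈ L, e.1 ∈ S ∧ e.2 ∈ S) → Set.InjOn f S → d + S.card + j + k ≤ n →
      walkP nb k x j c L ≤
        walkP (fun _ => Finset.univ) k (f x) j (f c) (L.map (Prod.map f f)) := by
  induction j with
  | zero =>
    intro c L S f hy hc hL hf hn
    unfold walkP
    exact walkQ_le nb hnb c k x L S f hc hy hL hf (by omega)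
  | succ j ih =>
    intro c L S f hy hc hL hf hn
    unfold walkP
    refine step_le (nb c) (hnb c) S f hf (by omega) _ _ (fun i => walkP_nonneg _ _ _ _ _ _) ?_ ?_
    · intro v hv
      refine ih v ((c, v) :: L) S f hy hv ?_ hf (by omega)
      intro e he
      rcases List.mem_cons.1 he with rfl | he
      exacts [⟨hc, hv⟩, hL e he]
    · intro v hv i hi
      have key : ∀ c ∈ S, c ≠ v := fun c hc h => hv (h ▸ hc)
      have := ih v ((c, v) :: L) (insert v S) (Function.update f v i)
        (Finset.mem_insert_of_mem hy) (Finset.mem_insert_self _ _) ?_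
        (inj_update S f hf v hv i hi) ?_
      · simpa [map_update S f v hv i L hL, Prod.map, Function.update_of_ne (key c hc),
          Function.update_of_ne (key x hy)] using this
      · intro e he
        rcases List.mem_cons.1 he with rfl | he
        · exact ⟨Finset.mem_insert_of_mem hc, Finset.mem_insert_self _ _⟩
        · exact ⟨Finset.mem_insert_of_mem (hL e he).1, Finset.mem_insert_of_mem (hL e he).2⟩
      · rw [Finset.card_insert_of_notMem hv]; omega

/-- The expected walk sums are the expected products of matrix powers. -/
lemma integral_walkQ {Ω α : Type*} [MeasurableSpace Ω] [Fintype α] [DecidableEq α] (μ : Measure Ω)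
    (nb : α → Finset α) (g : α × α → Ω → ℝ) (A : Ω → Matrix α α ℝ)
    (hA : ∀ ω x y, A ω x y = if y ∈ nb x then g (x, y) ω else 0)
    (hmono : ∀ L : List (α × α), (∀ e ∈ L, e.2 ∈ nb e.1) →
      Integrable (fun ω => (L.map (fun e => g e ω)).prod) μ ∧
        ∫ ω, (L.map (fun e => g e ω)).prod ∂μ = phi L) (y : α) (j : ℕ) :
    ∀ (c : α) (L : List (α × α)), (∀ e ∈ L, e.2 ∈ nb e.1) →
      Integrable (fun ω => (L.map (fun e => g e ω)).prod * ((A ω) ^ j) c y) μ ∧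
        ∫ ω, (L.map (fun e => g e ω)).prod * ((A ω) ^ j) c y ∂μ = walkQ nb y j c L := by
  induction j with
  | zero =>
    intro c L hL
    unfold walkQ
    by_cases h : c = y
    · simpa [h] using hmono L hL
    · simp [h]
  | succ j ih =>
    intro c L hL
    unfold walkQ
    have h1 : ∀ ω, (L.map (fun e => g e ω)).prod * ((A ω) ^ (j + 1)) c y =
        ∑ v ∈ nb c, (((c, v) :: L).map (fun e => g e ω)).prod * ((A ω) ^ j) v y := by
      intro ω
      rw [pow_succ', Matrix.mul_apply, Finset.mul_sum]
      symm
      refine Finset.sum_subset_zero_on_sdiff (Finset.subset_univ _) ?_ ?_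
      · intro v hv
        rw [hA, if_neg (by simpa using hv)]; ring
      · intro v hv
        rw [hA, if_pos hv, List.map_cons, List.prod_cons]; ring
    have h2 : ∀ v ∈ nb c, ∀ e ∈ (c, v) :: L, e.2 ∈ nb e.1 := by
      intro v hv e he
      rcases List.mem_cons.1 he with rfl | he
      exacts [hv, hL e he]
    simp only [h1]
    refine ⟨integrable_finsetSum _ fun v hv => (ih v _ (h2 v hv)).1, ?_⟩
    rw [integral_finsetSum _ fun v hv => (ih v _ (h2 v hv)).1]
    exact Finset.sum_congr rfl fun v hv => (ih v _ (h2 v hv)).2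

lemma integral_walkP {Ω α : Type*} [MeasurableSpace Ω] [Fintype α] [DecidableEq α] (μ : Measure Ω)
    (nb : α → Finset α) (g : α × α → Ω → ℝ) (A : Ω → Matrix α α ℝ)
    (hA : ∀ ω x y, A ω x y = if y ∈ nb x then g (x, y) ω else 0)
    (hmono : ∀ L : List (α × α), (∀ e ∈ L, e.2 ∈ nb e.1) →
      Integrable (fun ω => (L.map (fun e => g e ω)).prod) μ ∧
        ∫ ω, (L.map (fun e => g e ω)).prod ∂μ = phi L) (k : ℕ) (x : α) (j : ℕ) :
    ∀ (c : α) (L : List (α × α)), (∀ e ∈ L, e.2 ∈ nb e.1) →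
      Integrable (fun ω => (L.map (fun e => g e ω)).prod *
          ∑ y, ((A ω) ^ j) c y * ((A ω) ^ k) x y) μ ∧
        ∫ ω, (L.map (fun e => g e ω)).prod * ∑ y, ((A ω) ^ j) c y * ((A ω) ^ k) x y ∂μ
          = walkP nb k x j c L := by
  induction j with
  | zero =>
    intro c L hL
    unfold walkP
    simpa [Matrix.one_apply] using integral_walkQ μ nb g A hA hmono c k x L hL
  | succ j ih =>
    intro c L hL
    unfold walkP
    have h1 : ∀ ω, (L.map (fun e => g e ω)).prod *
          ∑ y, ((A ω) ^ (j + 1)) c y * ((A ω) ^ k) x y =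
        ∑ v ∈ nb c, (((c, v) :: L).map (fun e => g e ω)).prod *
          ∑ y, ((A ω) ^ j) v y * ((A ω) ^ k) x y := by
      intro ω
      have : ∑ y, ((A ω) ^ (j + 1)) c y * ((A ω) ^ k) x y =
          ∑ v, A ω c v * ∑ y, ((A ω) ^ j) v y * ((A ω) ^ k) x y := by
        simp_rw [pow_succ', Matrix.mul_apply, Finset.sum_mul, Finset.mul_sum]
        rw [Finset.sum_comm]
        exact Finset.sum_congr rfl fun _ _ => Finset.sum_congr rfl fun _ _ => by ring
      rw [this, Finset.mul_sum]
      symm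
      refine Finset.sum_subset_zero_on_sdiff (Finset.subset_univ _) ?_ ?_
      · intro v hv
        rw [hA, if_neg (by simpa using hv)]; ring
      · intro v hv
        rw [hA, if_pos hv, List.map_cons, List.prod_cons]; ring
    have h2 : ∀ v ∈ nb c, ∀ e ∈ (c, v) :: L, e.2 ∈ nb e.1 := by
      intro v hv e he
      rcases List.mem_cons.1 he with rfl | he
      exacts [hv, hL e he]
    simp only [h1]
    refine ⟨integrable_finsetSum _ fun v hv => (ih v _ (h2 v hv)).1, ?_⟩
    rw [integral_finsetSum _ fun v hv => (ih v _ (h2 v hv)).1]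
    exact Finset.sum_congr rfl fun v hv => (ih v _ (h2 v hv)).2

/-- Row second moment of the `k`-th power as a walk sum. -/
lemma integral_row {Ω α : Type*} [MeasurableSpace Ω] [Fintype α] [DecidableEq α] (μ : Measure Ω)
    (nb : α → Finset α) (g : α × α → Ω → ℝ) (A : Ω → Matrix α α ℝ)
    (hA : ∀ ω x y, A ω x y = if y ∈ nb x then g (x, y) ω else 0)
    (hmono : ∀ L : List (α × α), (∀ e ∈ L, e.2 ∈ nb e.1) →
      Integrable (fun ω => (L.map (fun e => g e ω)).prod) μ ∧
        ∫ ω, (L.map (fun e => g e ω)).prod ∂μ = phi L) (k : ℕ) (x : α) :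
    ∫⁻ ω, ENNReal.ofReal (∑ y, (((A ω) ^ k) x y) ^ 2) ∂μ
      = ENNReal.ofReal (walkP nb k x k x []) := by
  have := integral_walkP μ nb g A hA hmono k x k x [] (by simp)
  simp only [List.map_nil, List.prod_nil, one_mul, ← pow_two] at this
  rw [← this.2, ofReal_integral_eq_lintegral_ofReal this.1]
  exact ae_of_all _ fun ω => Finset.sum_nonneg fun _ _ => sq_nonneg _

/-- The law of a family of independent standard Gaussians. -/
def gam (ι : Type*) [Fintype ι] : Measure (ι → ℝ) := Measure.pi fun _ => gaussianReal 0 1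

instance {ι : Type*} [Fintype ι] : IsProbabilityMeasure (gam ι) := by
  unfold gam; infer_instance

lemma gam_invariant {ι : Type*} [Fintype ι] (T : (ι → ℝ) → (ι → ℝ))
    (hadd : ∀ x y, T (x + y) = T x + T y) (hsmul : ∀ (c : ℝ) x, T (c • x) = c • T x)
    (hinv : ∀ x, T (T x) = x) (hnorm : ∀ x, ∑ p, (T x p) ^ 2 = ∑ p, (x p) ^ 2) :
    MeasurePreserving T (gam ι) (gam ι) := by
  let R : EuclideanSpace ℝ ι ≃ₗᵢ[ℝ] EuclideanSpace ℝ ι :=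
    { toFun := fun x => WithLp.toLp 2 (T (WithLp.ofLp x))
      invFun := fun x => WithLp.toLp 2 (T (WithLp.ofLp x))
      map_add' := fun x y => by simp [hadd]
      map_smul' := fun c x => by simp [hsmul]
      left_inv := fun x => by simp [hinv]
      right_inv := fun x => by simp [hinv]
      norm_map' := fun x => by
        rw [EuclideanSpace.norm_eq, EuclideanSpace.norm_eq]
        congr 1
        simpa using hnorm (WithLp.ofLp x) }
  have hR := stdGaussian_map (E := EuclideanSpace ℝ ι) R
  have h0 := map_pi_eq_stdGaussian (ι := ι)
  have hto : Measurable (WithLp.toLp 2 : (ι → ℝ) → EuclideanSpace ℝ ι) := by fun_prop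
  have hof : Measurable (WithLp.ofLp : EuclideanSpace ℝ ι → (ι → ℝ)) := by fun_prop
  have hTR : T = fun x => WithLp.ofLp (R (WithLp.toLp 2 x)) := rfl
  have hRm : Measurable R := R.continuous.measurable
  have hgam : gam ι = (stdGaussian (EuclideanSpace ℝ ι)).map WithLp.ofLp := by
    rw [← h0, Measure.map_map hof hto]
    exact Measure.map_id.symm
  refine ⟨by rw [hTR]; exact hof.comp (hRm.comp hto), ?_⟩
  have : T = WithLp.ofLp ∘ R ∘ (WithLp.toLp 2) := hTR
  rw [this, ← Measure.map_map hof (hRm.comp hto), ← Measure.map_map hRm hto]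
  rw [show (gam ι).map (WithLp.toLp 2) = stdGaussian (EuclideanSpace ℝ ι) from h0, hR, ← hgam]

lemma gam_piecewise {ι : Type*} [Fintype ι] (S : ι → Prop) [DecidablePred S] (H : (ι → ℝ) → ℝ≥0∞)
    (hH : Measurable H) :
    ∫⁻ y, H y ∂(gam ι) = ∫⁻ z, ∫⁻ y, H (fun p => if S p then z p else y p) ∂(gam ι) ∂(gam ι) := by
  have hm : Measurable (fun q : (ι → ℝ) × (ι → ℝ) => fun p => if S p then q.1 p else q.2 p) := by
    refine measurable_pi_lambda _ fun p => ?_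
    by_cases h : S p <;> simp only [h, if_true, if_false] <;> fun_prop
  have h1 : ((gam ι).prod (gam ι)).map
      (fun q : (ι → ℝ) × (ι → ℝ) => fun p => if S p then q.1 p else q.2 p) = gam ι := by
    symm
    refine Measure.pi_eq fun s hs => ?_
    rw [Measure.map_apply hm (MeasurableSet.univ_pi hs)]
    have : (fun q : (ι → ℝ) × (ι → ℝ) => fun p => if S p then q.1 p else q.2 p) ⁻¹'
        (Set.univ.pi s) = (Set.univ.pi fun p => if S p then s p else Set.univ) ×ˢ
          (Set.univ.pi fun p => if S p then Set.univ else s p) := by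
      ext q
      simp only [Set.mem_preimage, Set.mem_pi, Set.mem_univ, true_imp_iff, Set.mem_prod]
      constructor
      · intro h
        constructor <;> intro p <;> have := h p <;> by_cases hp : S p <;> simp_all
      · rintro ⟨h, h'⟩ p
        have := h p; have := h' p
        by_cases hp : S p <;> simp_all
    rw [this, Measure.prod_prod]
    unfold gam
    rw [Measure.pi_pi, Measure.pi_pi, ← Finset.prod_mul_distrib]
    refine Finset.prod_congr rfl fun p _ => ?_
    by_cases hp : S p <;> simp [hp]
  conv_lhs => rw [← h1]
  rw [lintegral_map hH hm]
  exact lintegral_prod _ (hH.comp hm).aemeasurable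

lemma gauss_exp_sq (t : ℝ) (ht : 0 ≤ t) :
    ∫⁻ x, ENNReal.ofReal (Real.exp (t / (1 + 2 * t) * x ^ 2)) ∂(gaussianReal 0 1)
      ≤ ENNReal.ofReal (Real.exp t) := by
  have hpos : (0 : ℝ) < 1 + 2 * t := by linarith
  let v : NNReal := ⟨1 + 2 * t, hpos.le⟩
  have hv : v ≠ 0 := by
    intro h; have h2 : 1 + 2 * t = 0 := congrArg NNReal.toReal h
    linarith
  rw [gaussianReal_of_var_ne_zero 0 one_ne_zero,
    lintegral_withDensity_eq_lintegral_mul _ (measurable_gaussianPDF _ _) (by fun_prop)]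
  have h1 : ∀ x, (gaussianPDF 0 1 * fun x => ENNReal.ofReal (Real.exp (t / (1 + 2 * t) * x ^ 2))) x
      = ENNReal.ofReal (√(1 + 2 * t)) * gaussianPDF 0 v x := by
    intro x
    simp only [Pi.mul_apply, gaussianPDF_def, gaussianPDFReal_def]
    rw [← ENNReal.ofReal_mul (by positivity), ← ENNReal.ofReal_mul (by positivity)]
    congr 1
    have hvv : ((v : NNReal) : ℝ) = 1 + 2 * t := rfl
    rw [hvv, mul_assoc, ← Real.exp_add, Real.sqrt_mul (by positivity) (1 + 2 * t)]
    have hs : √(1 + 2 * t) ≠ 0 := (Real.sqrt_pos.2 hpos).ne'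
    have he : -(x - 0) ^ 2 / (2 * ((1 : NNReal) : ℝ)) + t / (1 + 2 * t) * x ^ 2 =
        -(x - 0) ^ 2 / (2 * (1 + 2 * t)) := by
      simp only [NNReal.coe_one]; field_simp; ring
    rw [he]
    simp only [NNReal.coe_one, mul_one]
    field_simp
  simp only [h1]
  rw [lintegral_const_mul _ (measurable_gaussianPDF _ _), lintegral_gaussianPDF_eq_one 0 hv, mul_one]
  refine ENNReal.ofReal_le_ofReal ?_
  rw [Real.sqrt_le_left (Real.exp_pos _).le, ← Real.exp_nat_mul]
  have := Real.add_one_le_exp (2 * t)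
  push_cast; linarith

/-- Moments of chi-square variables. -/
lemma chi_moment {ι : Type*} [Fintype ι] (S : Finset ι) (k : ℕ) :
    ∫⁻ z, ENNReal.ofReal ((∑ p ∈ S, (z p) ^ 2) ^ k) ∂(gam ι)
      ≤ ENNReal.ofReal (((S.card : ℝ) + 2 * k) ^ k) := by
  rcases Nat.eq_zero_or_pos k with rfl | hk
  · simp
  rcases Finset.eq_empty_or_nonempty S with rfl | hS
  · simp [hk.ne']
  have hkr : (0 : ℝ) < k := by exact_mod_cast hk
  have hmr : (0 : ℝ) < S.card := by exact_mod_cast Finset.card_pos.2 hS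
  set m : ℝ := (S.card : ℝ) with hm
  set t : ℝ := k / m with ht
  have ht0 : 0 ≤ t := by positivity
  have hlam : t / (1 + 2 * t) = k / (m + 2 * k) := by rw [ht]; field_simp
  have hpt : ∀ z : ι → ℝ, ENNReal.ofReal ((∑ p ∈ S, (z p) ^ 2) ^ k) ≤
      ENNReal.ofReal ((m + 2 * k) ^ k * Real.exp (-k)) *
        ∏ p ∈ S, ENNReal.ofReal (Real.exp (t / (1 + 2 * t) * (z p) ^ 2)) := by
    intro z
    rw [← ENNReal.ofReal_prod_of_nonneg fun _ _ => (Real.exp_pos _).le,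
      ← ENNReal.ofReal_mul (by positivity), ← Real.exp_sum, ← Finset.mul_sum, hlam]
    refine ENNReal.ofReal_le_ofReal ?_
    set s := ∑ p ∈ S, (z p) ^ 2 with hs
    have hs0 : 0 ≤ s := Finset.sum_nonneg fun _ _ => sq_nonneg _
    have h1 : s / (m + 2 * k) ≤ Real.exp (s / (m + 2 * k) - 1) := by
      have := Real.add_one_le_exp (s / (m + 2 * k) - 1); linarith
    have h2 : (s / (m + 2 * k)) ^ k ≤ (Real.exp (s / (m + 2 * k) - 1)) ^ k :=
      pow_le_pow_left₀ (by positivity) h1 k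
    rw [div_pow, div_le_iff₀ (by positivity), ← Real.exp_nat_mul] at h2
    refine h2.trans (le_of_eq ?_)
    rw [mul_assoc, ← Real.exp_add, mul_comm]
    congr 2
    field_simp
    ring
  refine (lintegral_mono hpt).trans ?_
  rw [lintegral_const_mul _ (by fun_prop)]
  have hind : iIndepFun (fun (p : ι) (z : ι → ℝ) =>
      ENNReal.ofReal (Real.exp (t / (1 + 2 * t) * (z p) ^ 2))) (gam ι) :=
    iIndepFun_pi (X := fun _ (x : ℝ) => ENNReal.ofReal (Real.exp (t / (1 + 2 * t) * x ^ 2)))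
      fun _ => by fun_prop
  rw [lintegral_prod_eq_prod_lintegral_of_indepFun S _ hind (fun i => by fun_prop)]
  have h3 : ∀ p ∈ S, ∫⁻ z : ι → ℝ, ENNReal.ofReal (Real.exp (t / (1 + 2 * t) * (z p) ^ 2)) ∂(gam ι)
      ≤ ENNReal.ofReal (Real.exp t) := by
    intro p _
    refine le_trans (le_of_eq ?_) (gauss_exp_sq t ht0)
    exact (measurePreserving_eval (fun _ : ι => gaussianReal 0 1) p).lintegral_comp
      (f := fun x => ENNReal.ofReal (Real.exp (t / (1 + 2 * t) * x ^ 2))) (by fun_prop)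
  refine (mul_le_mul_right (Finset.prod_le_prod' h3) _).trans ?_
  rw [Finset.prod_const, ← ENNReal.ofReal_pow (Real.exp_pos _).le,
    ← ENNReal.ofReal_mul (by positivity), ← Real.exp_nat_mul, mul_assoc, ← Real.exp_add]
  refine ENNReal.ofReal_le_ofReal (le_of_eq ?_)
  rw [← hm, ht, mul_div_cancel₀ _ hmr.ne']
  simp

lemma householder {n : ℕ} (J : ℕ) (hJ : J < n) (a : Fin n → ℝ) :
    ∃ Q : Matrix (Fin n) (Fin n) ℝ, Q * Q = 1 ∧ Qᵀ = Q ∧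
      (∀ i l : Fin n, i.val < J → Q i l = if i = l then 1 else 0) ∧
      (∀ l : Fin n, J < l.val → (Q *ᵥ a) l = 0) := by
  set s : ℝ := √(∑ l : Fin n, if l.val < J then 0 else a l ^ 2) with hs
  have hs2 : s ^ 2 = ∑ l : Fin n, if l.val < J then 0 else a l ^ 2 := by
    rw [hs, Real.sq_sqrt]
    exact Finset.sum_nonneg fun l _ => by split_ifs <;> positivity
  set a' : Fin n → ℝ := fun l => if l.val < J then a l else if l = ⟨J, hJ⟩ then s else 0 with ha'
  have hnorm : a' ⬝ᵥ a' = a ⬝ᵥ a := by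
    have h1 : ∀ l, a' l * a' l = (if l.val < J then a l ^ 2 else 0) +
        (if l = ⟨J, hJ⟩ then s ^ 2 else 0) := by
      intro l
      simp only [ha']
      by_cases h : l.val < J
      · have : l ≠ ⟨J, hJ⟩ := by rintro rfl; simp at h
        simp [h, this]; ring
      · by_cases h2 : l = ⟨J, hJ⟩ <;> simp [h, h2] ; ring
    have h2 : ∀ l, a l * a l = (if l.val < J then a l ^ 2 else 0) +
        (if l.val < J then 0 else a l ^ 2) := by
      intro l; split_ifs <;> ring
    simp only [dotProduct, h1, h2, Finset.sum_add_distrib, ← hs2]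
    simp
  set w := a - a' with hw
  have hw0 : ∀ i : Fin n, i.val < J → w i = 0 := by
    intro i hi; simp [hw, ha', hi]
  have htail : ∀ l : Fin n, J < l.val → a' l = 0 := by
    intro l hl
    have : l ≠ ⟨J, hJ⟩ := by rintro rfl; simp at hl
    simp [ha', this, hl.le.not_gt]
  by_cases hz : w ⬝ᵥ w = 0
  · refine ⟨1, by simp, by simp, fun i l _ => by rw [Matrix.one_apply], fun l hl => ?_⟩
    have hw' : w = 0 := by simpa using hz
    have : a = a' := sub_eq_zero.1 hw'
    rw [Matrix.one_mulVec, this]; exact htail l hl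
  · set c : ℝ := 2 / (w ⬝ᵥ w) with hc
    have hwa : 2 * (w ⬝ᵥ a) = w ⬝ᵥ w := by
      have e : a' ⬝ᵥ a = a ⬝ᵥ a' := dotProduct_comm _ _
      simp only [hw, sub_dotProduct, dotProduct_sub, hnorm, e]; ring
    refine ⟨1 - c • vecMulVec w w, ?_, ?_, ?_, ?_⟩
    · have h1 : vecMulVec w w * vecMulVec w w = (w ⬝ᵥ w) • vecMulVec w w := by
        ext i l
        rw [Matrix.vecMulVec_mul_vecMulVec]
        simp [vecMulVec_apply]; ring
      have h2 : c * c * (w ⬝ᵥ w) = 2 * c := by rw [hc]; field_simp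
      rw [sub_mul, mul_sub, mul_sub, one_mul, mul_one, one_mul, smul_mul_smul_comm, h1, smul_smul,
        h2, two_mul, add_smul]
      abel
    · ext i l; simp [Matrix.transpose_apply, vecMulVec_apply, Matrix.one_apply, eq_comm, mul_comm]
    · intro i l hi
      simp [vecMulVec_apply, hw0 i hi, Matrix.one_apply]
    · intro l hl
      have h3 : ((1 - c • vecMulVec w w) *ᵥ a) = a - (c * (w ⬝ᵥ a)) • w := by
        rw [Matrix.sub_mulVec, Matrix.one_mulVec, Matrix.smul_mulVec, Matrix.vecMulVec_mulVec]
        ext i; simp; ring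
      have h4 : c * (w ⬝ᵥ a) = 1 := by rw [hc, ← hwa]; field_simp; rw [div_self]; intro h; apply hz; rw [← hwa, h, mul_zero]
      rw [h3, h4, one_smul, hw, sub_sub_cancel]
      exact htail l hl

/-- The matrix with given entries. -/
def toMat {n : ℕ} (z : Fin n × Fin n → ℝ) : Matrix (Fin n) (Fin n) ℝ := fun i l => z (i, l)

/-- Squared norm of the first row of the `k`-th power. -/
def rowF {n : ℕ} [NeZero n] (k : ℕ) (z : Fin n × Fin n → ℝ) : ℝ :=
  ∑ l, ((toMat z ^ k) 0 l) ^ 2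

/-- Conjugation by `Q`. -/
def conjQ {n : ℕ} (Q : Matrix (Fin n) (Fin n) ℝ) (z : Fin n × Fin n → ℝ) : Fin n × Fin n → ℝ :=
  fun p => (Q * toMat z * Q) p.1 p.2

/-- Rows below `j` from `x`, the others from `y`. -/
def mix {n : ℕ} (j : ℕ) (x y : Fin n × Fin n → ℝ) : Fin n × Fin n → ℝ :=
  fun p => if p.1.val < j then x p else y p

lemma toMat_conjQ {n : ℕ} (Q : Matrix (Fin n) (Fin n) ℝ) (z : Fin n × Fin n → ℝ) :
    toMat (conjQ Q z) = Q * toMat z * Q := rfl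

lemma conjQ_measurePreserving {n : ℕ} (Q : Matrix (Fin n) (Fin n) ℝ) (hQ : Q * Q = 1)
    (hQt : Qᵀ = Q) :
    MeasurePreserving (conjQ Q) (gam (Fin n × Fin n)) (gam (Fin n × Fin n)) := by
  have hadd : ∀ x y : Fin n × Fin n → ℝ, toMat (x + y) = toMat x + toMat y := fun _ _ => rfl
  have hsm : ∀ (c : ℝ) (x : Fin n × Fin n → ℝ), toMat (c • x) = c • toMat x := fun _ _ => rfl
  refine gam_invariant _ ?_ ?_ ?_ ?_
  · intro x y; funext p; simp [conjQ, hadd, mul_add, add_mul]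
  · intro c x; funext p; simp [conjQ, hsm]
  · intro x; funext p
    simp only [conjQ, toMat_conjQ]
    rw [show Q * (Q * toMat x * Q) * Q = (Q * Q) * toMat x * (Q * Q) by simp only [mul_assoc], hQ]
    simp [toMat]
  · intro x
    have h1 : ∀ z : Fin n × Fin n → ℝ, ∑ p, z p ^ 2 = (toMat z * (toMat z)ᵀ).trace := by
      intro z
      rw [Fintype.sum_prod_type]
      simp [Matrix.trace, Matrix.mul_apply, toMat, pow_two]
    rw [h1, h1, toMat_conjQ, Matrix.transpose_mul, Matrix.transpose_mul, hQt]
    rw [show Q * toMat x * Q * (Q * ((toMat x)ᵀ * Q)) = Q * (toMat x * (Q * Q) * (toMat x)ᵀ * Q) by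
      simp only [mul_assoc], hQ, Matrix.trace_mul_comm, mul_assoc, hQ]
    simp

lemma sum_sq_vecMul {n : ℕ} (Q : Matrix (Fin n) (Fin n) ℝ) (hQ : Q * Q = 1) (hQt : Qᵀ = Q)
    (b : Fin n → ℝ) : ∑ l, (∑ i, b i * Q i l) ^ 2 = ∑ l, b l ^ 2 := by
  have h : (b ᵥ* Q) ⬝ᵥ (b ᵥ* Q) = b ⬝ᵥ b := by
    rw [← Matrix.dotProduct_mulVec, ← Matrix.vecMul_transpose, Matrix.vecMul_vecMul, hQt, hQ,
      Matrix.vecMul_one]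
  simpa [dotProduct, Matrix.vecMul, pow_two] using h

lemma conjQ_row {n : ℕ} (J : ℕ) (Q : Matrix (Fin n) (Fin n) ℝ)
    (hQ0 : ∀ i l : Fin n, i.val < J → Q i l = if i = l then 1 else 0)
    (B : Matrix (Fin n) (Fin n) ℝ) (i l : Fin n) (hi : i.val < J) :
    (Q * B * Q) i l = ∑ m, B i m * Q m l := by
  rw [Matrix.mul_apply]
  refine Finset.sum_congr rfl fun m _ => ?_
  rw [Matrix.mul_apply]
  simp [hQ0 i _ hi]

lemma rowF_conjQ {n : ℕ} [NeZero n] (k : ℕ) (J : ℕ) (hJ : 0 < J) (Q : Matrix (Fin n) (Fin n) ℝ)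
    (hQ : Q * Q = 1) (hQt : Qᵀ = Q)
    (hQ0 : ∀ i l : Fin n, i.val < J → Q i l = if i = l then 1 else 0) (z : Fin n × Fin n → ℝ) :
    rowF k (conjQ Q z) = rowF k z := by
  have hp : ∀ k : ℕ, (Q * toMat z * Q) ^ k = Q * (toMat z) ^ k * Q := by
    intro k
    induction k with
    | zero => simp [hQ]
    | succ k ih =>
      rw [pow_succ, ih, pow_succ, show Q * toMat z ^ k * Q * (Q * toMat z * Q) =
        Q * (toMat z ^ k * (Q * Q) * toMat z) * Q by simp only [mul_assoc], hQ, mul_one]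
  unfold rowF
  rw [toMat_conjQ, hp]
  have h0 : (0 : Fin n).val < J := by simpa using hJ
  simp only [conjQ_row J Q hQ0 _ 0 _ h0]
  exact sum_sq_vecMul Q hQ hQt _

lemma conjQ_mix {n : ℕ} (J : ℕ) (Q : Matrix (Fin n) (Fin n) ℝ) (hQt : Qᵀ = Q)
    (hQ0 : ∀ i l : Fin n, i.val < J → Q i l = if i = l then 1 else 0) (x y : Fin n × Fin n → ℝ) :
    conjQ Q (mix J x y) = mix J (conjQ Q x) (conjQ Q y) := by
  funext ⟨i, l⟩
  by_cases hi : i.val < J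
  · simp only [conjQ, mix, hi, if_true, conjQ_row J Q hQ0 _ i l hi, toMat]
  · simp only [conjQ, mix, hi, if_false]
    rw [Matrix.mul_apply, Matrix.mul_apply]
    refine Finset.sum_congr rfl fun m _ => ?_
    congr 1
    rw [Matrix.mul_apply, Matrix.mul_apply]
    refine Finset.sum_congr rfl fun m' _ => ?_
    by_cases hm : m'.val < J
    · have : Q i m' = 0 := by
        rw [← hQt, Matrix.transpose_apply, hQ0 _ _ hm, if_neg]
        rintro rfl; exact hi hm
      simp [this]
    · simp [toMat, mix, hm]

/-- Upper Hessenberg condition for the rows below `j`. -/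
def Hess {n : ℕ} (j : ℕ) (x : Fin n × Fin n → ℝ) : Prop :=
  ∀ i l : Fin n, i.val < j → i.val + 1 < l.val → x (i, l) = 0

/-- Squared norm of row `i`. -/
def rowN {n : ℕ} (x : Fin n × Fin n → ℝ) (i : Fin n) : ℝ := ∑ l, x (i, l) ^ 2

/-- Squared norm of the lower triangular part of row `i`. -/
def lowN {n : ℕ} (x : Fin n × Fin n → ℝ) (i : Fin n) : ℝ :=
  ∑ l ∈ Finset.univ.filter (fun l : Fin n => l ≤ i), x (i, l) ^ 2

lemma rowN_nonneg {n : ℕ} (x : Fin n × Fin n → ℝ) (i : Fin n) : 0 ≤ rowN x i :=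
  Finset.sum_nonneg fun _ _ => sq_nonneg _

lemma lowN_nonneg {n : ℕ} (x : Fin n × Fin n → ℝ) (i : Fin n) : 0 ≤ lowN x i :=
  Finset.sum_nonneg fun _ _ => sq_nonneg _

/-- One step of the Hessenberg recursion. -/
lemma hess_step {n : ℕ} (k : ℕ) (A : Matrix (Fin n) (Fin n) ℝ) (x : Fin n × Fin n → ℝ)
    (hA : A = toMat x) (hH : Hess k x) (M δ : ℝ) (hδ : 0 < δ)
    (hM : ∀ i : Fin n, i.val < k → rowN x i ≤ M) (v : Fin n → ℝ)
    (hv : ∀ i : Fin n, k ≤ i.val → v i = 0) :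
    ∑ l, ((v ᵥ* A) l) ^ 2 ≤ ((1 + δ) * M + (1 + δ⁻¹) *
      ∑ i ∈ Finset.univ.filter (fun i : Fin n => i.val < k), lowN x i) * ∑ i, v i ^ 2 := by
  set K := Finset.univ.filter (fun i : Fin n => i.val < k) with hK
  set lo : Fin n → ℝ := fun l => ∑ i ∈ K.filter (fun i => l ≤ i), v i * x (i, l) with hlo
  set up : Fin n → ℝ := fun l => ∑ i ∈ K.filter (fun i => i.val + 1 = l.val), v i * x (i, l) with hup
  have hdec : ∀ l, (v ᵥ* A) l = lo l + up l := by
    intro l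
    rw [hA]
    simp only [Matrix.vecMul, dotProduct, toMat, hlo, hup, Finset.sum_filter, hK,
      ← Finset.sum_add_distrib]
    refine Finset.sum_congr rfl fun i _ => ?_
    by_cases hi : i.val < k
    · simp only [hi, if_true]
      by_cases h1 : l ≤ i
      · have : ¬ (i.val + 1 = l.val) := by have : l.val ≤ i.val := h1; omega
        simp [h1, this]
      · by_cases h2 : i.val + 1 = l.val
        · simp [h1, h2]
        · have : x (i, l) = 0 := hH i l hi (by
            have : ¬ l.val ≤ i.val := h1
            omega)
          simp [this]
    · simp [hi, hv i (by omega)]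
  have hlo2 : ∑ l, lo l ^ 2 ≤ (∑ i ∈ K, lowN x i) * ∑ i, v i ^ 2 := by
    have h1 : ∀ l, lo l ^ 2 ≤ (∑ i, v i ^ 2) * ∑ i ∈ K.filter (fun i => l ≤ i), x (i, l) ^ 2 := by
      intro l
      refine (Finset.sum_mul_sq_le_sq_mul_sq _ _ _).trans ?_
      refine mul_le_mul_of_nonneg_right ?_ (Finset.sum_nonneg fun _ _ => sq_nonneg _)
      exact Finset.sum_le_sum_of_subset_of_nonneg (Finset.subset_univ _) fun _ _ _ => sq_nonneg _
    refine (Finset.sum_le_sum fun l _ => h1 l).trans (le_of_eq ?_)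
    rw [← Finset.mul_sum, mul_comm]
    congr 1
    simp only [lowN, Finset.sum_filter]
    rw [Finset.sum_comm]
  have hup2 : ∑ l, up l ^ 2 ≤ M * ∑ i, v i ^ 2 := by
    have h1 : ∀ l, up l ^ 2 ≤ ∑ i ∈ K.filter (fun i => i.val + 1 = l.val), (v i * x (i, l)) ^ 2 := by
      intro l
      refine sq_sum_le_card_mul_sum_sq.trans ?_
      have hc : (K.filter (fun i => i.val + 1 = l.val)).card ≤ 1 := by
        refine Finset.card_le_one.2 fun a ha b hb => ?_
        simp only [Finset.mem_filter] at ha hb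
        exact Fin.ext (by omega)
      have hc' : ((K.filter (fun i => i.val + 1 = l.val)).card : ℝ) ≤ 1 := by exact_mod_cast hc
      exact mul_le_of_le_one_left (Finset.sum_nonneg fun _ _ => sq_nonneg _) hc'
    refine (Finset.sum_le_sum fun l _ => h1 l).trans ?_
    simp only [Finset.sum_filter]
    rw [Finset.sum_comm]
    calc ∑ i ∈ K, ∑ l : Fin n, (if i.val + 1 = l.val then (v i * x (i, l)) ^ 2 else 0)
        ≤ ∑ i ∈ K, M * v i ^ 2 := by
          refine Finset.sum_le_sum fun i hi => ?_
          have hik : i.val < k := by simpa [hK] using hi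
          calc ∑ l : Fin n, (if i.val + 1 = l.val then (v i * x (i, l)) ^ 2 else 0)
              ≤ ∑ l : Fin n, v i ^ 2 * x (i, l) ^ 2 := by
                refine Finset.sum_le_sum fun l _ => ?_
                split_ifs
                · rw [mul_pow]
                · positivity
            _ = rowN x i * v i ^ 2 := by rw [← Finset.mul_sum, rowN, mul_comm]
            _ ≤ M * v i ^ 2 := mul_le_mul_of_nonneg_right (hM i hik) (sq_nonneg _)
      _ = M * ∑ i ∈ K, v i ^ 2 := by rw [Finset.mul_sum]
      _ = M * ∑ i, v i ^ 2 := by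
          congr 1
          refine Finset.sum_subset (Finset.subset_univ _) fun i _ hi => ?_
          have : k ≤ i.val := by simpa [hK] using hi
          simp [hv i this]
  calc ∑ l, ((v ᵥ* A) l) ^ 2 ≤ ∑ l, ((1 + δ) * up l ^ 2 + (1 + δ⁻¹) * lo l ^ 2) := by
        refine Finset.sum_le_sum fun l _ => ?_
        rw [hdec]
        have h1 : 0 ≤ δ⁻¹ * (δ * up l - lo l) ^ 2 := by positivity
        have h2 : δ⁻¹ * (δ * up l - lo l) ^ 2 = δ * up l ^ 2 - 2 * (up l * lo l) + δ⁻¹ * lo l ^ 2 := by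
          field_simp; ring
        nlinarith
    _ = (1 + δ) * ∑ l, up l ^ 2 + (1 + δ⁻¹) * ∑ l, lo l ^ 2 := by
        rw [Finset.sum_add_distrib, Finset.mul_sum, Finset.mul_sum]
    _ ≤ (1 + δ) * (M * ∑ i, v i ^ 2) + (1 + δ⁻¹) * ((∑ i ∈ K, lowN x i) * ∑ i, v i ^ 2) := by
        gcongr
    _ = _ := by ring

lemma hess_pow {n : ℕ} [NeZero n] (k : ℕ) (x : Fin n × Fin n → ℝ) (hH : Hess k x) (M δ : ℝ)
    (hδ : 0 < δ) (hM0 : 0 ≤ M) (hM : ∀ i : Fin n, i.val < k → rowN x i ≤ M) (t : ℕ) (ht : t ≤ k) :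
    (∀ l : Fin n, t < l.val → (toMat x ^ t) 0 l = 0) ∧
    ∑ l, ((toMat x ^ t) 0 l) ^ 2 ≤ ((1 + δ) * M + (1 + δ⁻¹) *
      ∑ i ∈ Finset.univ.filter (fun i : Fin n => i.val < k), lowN x i) ^ t := by
  induction t with
  | zero =>
    refine ⟨fun l hl => ?_, ?_⟩
    · rw [pow_zero, Matrix.one_apply, if_neg]; rintro rfl; simp at hl
    · simp [Matrix.one_apply]
  | succ t ih =>
    obtain ⟨h1, h2⟩ := ih (by omega)
    have hrow : ∀ l, (toMat x ^ (t + 1)) 0 l = (((toMat x ^ t) 0) ᵥ* toMat x) l := by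
      intro l; rw [pow_succ, Matrix.mul_apply]; rfl
    have hlow : 0 ≤ ∑ i ∈ Finset.univ.filter (fun i : Fin n => i.val < k), lowN x i :=
      Finset.sum_nonneg fun _ _ => lowN_nonneg _ _
    refine ⟨fun l hl => ?_, ?_⟩
    · rw [hrow]
      simp only [Matrix.vecMul, dotProduct]
      refine Finset.sum_eq_zero fun i _ => ?_
      by_cases hi : t < i.val
      · rw [h1 i hi, zero_mul]
      · have : toMat x i l = 0 := hH i l (by omega) (by omega)
        rw [this, mul_zero]
    · simp only [hrow]
      refine (hess_step k _ x rfl hH M δ hδ hM _ fun i hi => h1 i (by omega)).trans ?_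
      rw [pow_succ']
      exact mul_le_mul_of_nonneg_left h2 (by positivity)

/-- The cost attached to row `i`. -/
def rowCost {n : ℕ} (k : ℕ) (δ : ℝ) (x : Fin n × Fin n → ℝ) (i : Fin n) : ℝ :=
  ((1 + δ) ^ 2) ^ k * rowN x i ^ k + ((1 + δ⁻¹) ^ 2 * k) ^ k * lowN x i ^ k

lemma rowCost_nonneg {n : ℕ} (k : ℕ) (δ : ℝ) (x : Fin n × Fin n → ℝ) (i : Fin n) :
    0 ≤ rowCost k δ x i := by
  have := rowN_nonneg x i
  have := lowN_nonneg x i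
  unfold rowCost; positivity

lemma rowF_le_rowCost {n : ℕ} [NeZero n] (k : ℕ) (hk : 0 < k) (x : Fin n × Fin n → ℝ)
    (hH : Hess k x) (δ : ℝ) (hδ : 0 < δ) :
    rowF k x ≤ ∑ i ∈ Finset.univ.filter (fun i : Fin n => i.val < k), rowCost k δ x i := by
  set K := Finset.univ.filter (fun i : Fin n => i.val < k) with hK
  have hne : K.Nonempty := ⟨0, by simp [hK, hk]⟩
  have hcard : (K.card : ℝ) ≤ k := by
    have : K.card ≤ (Finset.range k).card := by
      refine Finset.card_le_card_of_injOn (fun i => i.val) ?_ ?_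
      · intro i hi; simpa [hK] using hi
      · intro i _ j _ h; exact Fin.ext h
    rw [Finset.card_range] at this
    exact_mod_cast this
  obtain ⟨i0, hi0, hmax⟩ := Finset.exists_max_image K (rowN x) hne
  obtain ⟨i1, hi1, hmax1⟩ := Finset.exists_max_image K (lowN x) hne
  set M := rowN x i0 with hMdef
  set B := ∑ i ∈ K, lowN x i with hB
  have hM0 : 0 ≤ M := rowN_nonneg _ _
  have hB0 : 0 ≤ B := Finset.sum_nonneg fun _ _ => lowN_nonneg _ _
  have h1 := (hess_pow k x hH M δ hδ hM0 (fun i hi => hmax i (by simp [hK, hi])) k le_rfl).2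
  have hBk : B ≤ k * lowN x i1 := by
    calc B ≤ ∑ i ∈ K, lowN x i1 := Finset.sum_le_sum fun i hi => hmax1 i hi
      _ = K.card * lowN x i1 := by rw [Finset.sum_const, nsmul_eq_mul]
      _ ≤ k * lowN x i1 := mul_le_mul_of_nonneg_right hcard (lowN_nonneg _ _)
  have h2 : ((1 + δ) * M + (1 + δ⁻¹) * B) ^ k ≤
      ((1 + δ) ^ 2) ^ k * M ^ k + ((1 + δ⁻¹) ^ 2 * B) ^ k := by
    by_cases hc : (1 + δ⁻¹) * B ≤ δ * ((1 + δ) * M)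
    · refine le_trans (pow_le_pow_left₀ (by positivity)
        (show _ ≤ (1 + δ) ^ 2 * M by nlinarith) k) ?_
      rw [mul_pow]
      exact le_add_of_nonneg_right (by positivity)
    · have hc' : (1 + δ) * M ≤ δ⁻¹ * ((1 + δ⁻¹) * B) := by
        rw [inv_mul_eq_div, le_div_iff₀ hδ]; linarith
      refine le_trans (pow_le_pow_left₀ (by positivity)
        (show _ ≤ (1 + δ⁻¹) ^ 2 * B by nlinarith) k) ?_
      exact le_add_of_nonneg_left (by positivity)
  have h3 : M ^ k ≤ ∑ i ∈ K, rowN x i ^ k :=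
    Finset.single_le_sum (f := fun i => rowN x i ^ k)
      (fun i _ => pow_nonneg (rowN_nonneg x i) k) hi0
  have h4 : lowN x i1 ^ k ≤ ∑ i ∈ K, lowN x i ^ k :=
    Finset.single_le_sum (f := fun i => lowN x i ^ k)
      (fun i _ => pow_nonneg (lowN_nonneg x i) k) hi1
  have h5 : ((1 + δ⁻¹) ^ 2 * B) ^ k ≤ ((1 + δ⁻¹) ^ 2 * k) ^ k * lowN x i1 ^ k := by
    rw [← mul_pow]
    refine pow_le_pow_left₀ (by positivity) ?_ k
    rw [mul_assoc]
    exact mul_le_mul_of_nonneg_left hBk (by positivity)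
  unfold rowF rowCost
  rw [Finset.sum_add_distrib, ← Finset.mul_sum, ← Finset.mul_sum]
  refine h1.trans (h2.trans (add_le_add ?_ (h5.trans ?_)))
  · exact mul_le_mul_of_nonneg_left h3 (by positivity)
  · exact mul_le_mul_of_nonneg_left h4 (by positivity)

lemma measurable_rowF {n : ℕ} [NeZero n] (k : ℕ) :
    Measurable (fun z : Fin n × Fin n → ℝ => ENNReal.ofReal (rowF k z)) := by
  have h0 : Continuous (fun z : Fin n × Fin n → ℝ => toMat z) := by
    refine continuous_pi fun i => continuous_pi fun l => ?_
    exact continuous_apply (i, l)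
  have h1 : Continuous (fun z : Fin n × Fin n → ℝ => toMat z ^ k) := h0.pow k
  have h2 : Continuous (fun z : Fin n × Fin n → ℝ => rowF k z) := by
    unfold rowF
    refine continuous_finsetSum _ fun l _ => ?_
    exact ((continuous_apply l).comp ((continuous_apply (0 : Fin n)).comp h1)).pow 2
  exact h2.measurable.ennreal_ofReal

lemma measurable_mix {n : ℕ} (j : ℕ) (x : Fin n × Fin n → ℝ) : Measurable (mix j x) := by
  refine measurable_pi_lambda _ fun p => ?_
  unfold mix
  by_cases h : p.1.val < j <;> simp only [h, if_true, if_false] <;> fun_prop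

/-- Partially averaged row norm. -/
def psi {n : ℕ} [NeZero n] (k j : ℕ) (x : Fin n × Fin n → ℝ) : ℝ≥0∞ :=
  ∫⁻ y, ENNReal.ofReal (rowF k (mix j x y)) ∂(gam (Fin n × Fin n))

lemma psi_conjQ {n : ℕ} [NeZero n] (k J : ℕ) (hJ : 0 < J) (Q : Matrix (Fin n) (Fin n) ℝ)
    (hQ : Q * Q = 1) (hQt : Qᵀ = Q)
    (hQ0 : ∀ i l : Fin n, i.val < J → Q i l = if i = l then 1 else 0) (x : Fin n × Fin n → ℝ) :
    psi k J (conjQ Q x) = psi k J x := by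
  have hm : Measurable (fun y => ENNReal.ofReal (rowF k (mix J (conjQ Q x) y))) :=
    (measurable_rowF k).comp (measurable_mix J _)
  unfold psi
  rw [← (conjQ_measurePreserving Q hQ hQt).lintegral_comp hm]
  refine lintegral_congr fun y => ?_
  rw [← conjQ_mix J Q hQt hQ0, rowF_conjQ k J hJ Q hQ hQt hQ0]

lemma psi_succ {n : ℕ} [NeZero n] (k j : ℕ) (x : Fin n × Fin n → ℝ) :
    psi k j x = ∫⁻ z, psi k (j + 1) (mix j x z) ∂(gam (Fin n × Fin n)) := by
  have hm : Measurable (fun y => ENNReal.ofReal (rowF k (mix j x y))) :=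
    (measurable_rowF k).comp (measurable_mix j _)
  unfold psi
  rw [gam_piecewise (fun p : Fin n × Fin n => p.1.val < j + 1) _ hm]
  refine lintegral_congr fun z => lintegral_congr fun y => ?_
  congr 2
  funext p
  simp only [mix]
  by_cases h : p.1.val < j
  · simp [h, Nat.lt_succ_of_lt h]
  · simp [h]

lemma rowCost_congr {n : ℕ} (k : ℕ) (δ : ℝ) (x y : Fin n × Fin n → ℝ) (i : Fin n)
    (h : ∀ l, x (i, l) = y (i, l)) : rowCost k δ x i = rowCost k δ y i := by
  simp only [rowCost, rowN, lowN, h]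

lemma rowCost_integral {n : ℕ} (k : ℕ) (δ : ℝ) (hδ : 0 < δ) (i : Fin n) (hi : i.val < k) :
    ∫⁻ z, ENNReal.ofReal (rowCost k δ z i) ∂(gam (Fin n × Fin n)) ≤
      ENNReal.ofReal (((1 + δ) ^ 2) ^ k * ((n : ℝ) + 2 * k) ^ k +
        ((1 + δ⁻¹) ^ 2 * k) ^ k * (3 * k) ^ k) := by
  have hr : ∀ z : Fin n × Fin n → ℝ,
      rowN z i = ∑ p ∈ ({i} : Finset (Fin n)) ×ˢ Finset.univ, z p ^ 2 := by
    intro z; simp [rowN]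
  have hl : ∀ z : Fin n × Fin n → ℝ,
      lowN z i = ∑ p ∈ ({i} : Finset (Fin n)) ×ˢ
        (Finset.univ.filter fun l : Fin n => l ≤ i), z p ^ 2 := by
    intro z; rw [Finset.sum_product]; simp [lowN]
  have h1 := chi_moment (({i} : Finset (Fin n)) ×ˢ (Finset.univ : Finset (Fin n))) k
  have h2 := chi_moment (({i} : Finset (Fin n)) ×ˢ
        (Finset.univ.filter fun l : Fin n => l ≤ i)) k
  simp only [← hr, ← hl] at h1 h2
  have c1 : ((({i} : Finset (Fin n)) ×ˢ (Finset.univ : Finset (Fin n))).card : ℝ) = n := by simp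
  have c2 : ((({i} : Finset (Fin n)) ×ˢ
        (Finset.univ.filter fun l : Fin n => l ≤ i)).card : ℝ) ≤ k := by
    rw [Finset.card_product, Finset.card_singleton, one_mul]
    have : (Finset.univ.filter fun l : Fin n => l ≤ i).card ≤ k := by
      rw [← Finset.card_range k]
      refine Finset.card_le_card_of_injOn (fun i => i.val) ?_ ?_
      · intro l hl
        have : l ≤ i := by simpa using hl
        have : l.val ≤ i.val := this
        simp; omega
      · intro i _ j _ h; exact Fin.ext h
    exact_mod_cast this
  rw [c1] at h1
  have m1 : Measurable fun z : Fin n × Fin n → ℝ => ENNReal.ofReal (rowN z i ^ k) := by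
    unfold rowN; fun_prop
  have m2 : Measurable fun z : Fin n × Fin n → ℝ => ENNReal.ofReal (lowN z i ^ k) := by
    unfold lowN; fun_prop
  have hsplit : ∀ z : Fin n × Fin n → ℝ, ENNReal.ofReal (rowCost k δ z i) =
      ENNReal.ofReal (((1 + δ) ^ 2) ^ k) * ENNReal.ofReal (rowN z i ^ k) +
      ENNReal.ofReal (((1 + δ⁻¹) ^ 2 * k) ^ k) * ENNReal.ofReal (lowN z i ^ k) := by
    intro z
    have := rowN_nonneg z i
    have := lowN_nonneg z i
    rw [rowCost, ENNReal.ofReal_add (by positivity) (by positivity),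
      ENNReal.ofReal_mul (by positivity), ENNReal.ofReal_mul (by positivity)]
  simp only [hsplit]
  rw [lintegral_add_left (m1.const_mul _), lintegral_const_mul _ m1, lintegral_const_mul _ m2,
    ENNReal.ofReal_add (by positivity) (by positivity),
      ENNReal.ofReal_mul (by positivity), ENNReal.ofReal_mul (p := ((1 + δ⁻¹) ^ 2 * k) ^ k) (by positivity)]
  have h2' := h2.trans (ENNReal.ofReal_le_ofReal (pow_le_pow_left₀ (by positivity)
    (show _ ≤ 3 * (k : ℝ) by linarith) k))
  gcongr

lemma psi_le {n : ℕ} [NeZero n] (k : ℕ) (hk : 0 < k) (hkn : k < n) (δ : ℝ) (hδ : 0 < δ) (m : ℕ) :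
    ∀ (j : ℕ) (x : Fin n × Fin n → ℝ), j + m = k → Hess j x →
      psi k j x ≤ ENNReal.ofReal
        (∑ i ∈ Finset.univ.filter (fun i : Fin n => i.val < j), rowCost k δ x i) +
        m * ENNReal.ofReal (((1 + δ) ^ 2) ^ k * ((n : ℝ) + 2 * k) ^ k +
        ((1 + δ⁻¹) ^ 2 * k) ^ k * (3 * k) ^ k) := by
  set C := ENNReal.ofReal (((1 + δ) ^ 2) ^ k * ((n : ℝ) + 2 * k) ^ k +
        ((1 + δ⁻¹) ^ 2 * k) ^ k * (3 * k) ^ k) with hC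
  induction m with
  | zero =>
    intro j x hj hH
    obtain rfl : j = k := by omega
    rw [Nat.cast_zero, zero_mul, add_zero]
    unfold psi
    have hpt : ∀ y, ENNReal.ofReal (rowF j (mix j x y)) ≤ ENNReal.ofReal
        (∑ i ∈ Finset.univ.filter (fun i : Fin n => i.val < j), rowCost j δ x i) := by
      intro y
      refine ENNReal.ofReal_le_ofReal ?_
      have hH' : Hess j (mix j x y) := by
        intro i l hi hl
        simp only [mix, hi, if_true]
        exact hH i l hi hl
      refine (rowF_le_rowCost j hk _ hH' δ hδ).trans (le_of_eq ?_)
      refine Finset.sum_congr rfl fun i hi => rowCost_congr _ _ _ _ _ fun l => ?_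
      have : i.val < j := by simpa using hi
      simp [mix, this]
    refine (lintegral_mono hpt).trans ?_
    simp
  | succ m ih =>
    intro j x hj hH
    have hjn : j < n := by omega
    rw [psi_succ]
    have hpt : ∀ z, psi k (j + 1) (mix j x z) ≤ (ENNReal.ofReal
        (∑ i ∈ Finset.univ.filter (fun i : Fin n => i.val < j), rowCost k δ x i) + m * C) +
        ENNReal.ofReal (rowCost k δ z ⟨j, hjn⟩) := by
      intro z
      set u := mix j x z with hu
      obtain ⟨Q, hQ, hQt, hQ0, hQa⟩ := householder (j + 1) (by omega) (fun l => u (⟨j, hjn⟩, l))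
      have hQ0' : ∀ i l : Fin n, l.val < j + 1 → Q i l = if i = l then 1 else 0 := by
        intro i l hl
        rw [← hQt, Matrix.transpose_apply, hQ0 _ _ hl]
        simp [eq_comm]
      have hrow : ∀ i l : Fin n, i.val < j + 1 → conjQ Q u (i, l) = ∑ m, u (i, m) * Q m l := by
        intro i l hi
        exact conjQ_row (j + 1) Q hQ0 (toMat u) i l hi
      rw [← psi_conjQ k (j + 1) (by omega) Q hQ hQt hQ0]
      have hH' : Hess (j + 1) (conjQ Q u) := by
        intro i l hi hl
        rw [hrow i l hi]
        by_cases hij : i.val < j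
        · refine Finset.sum_eq_zero fun m _ => ?_
          by_cases hm : i.val + 1 < m.val
          · have : u (i, m) = 0 := by
              simp only [hu, mix, hij, if_true]; exact hH i m hij hm
            rw [this, zero_mul]
          · rw [hQ0 m l (by omega), if_neg, mul_zero]
            rintro rfl; omega
        · obtain rfl : i = ⟨j, hjn⟩ := Fin.ext (by simp; omega)
          have := hQa l (by simpa using hl)
          rw [← this, ← Matrix.vecMul_transpose, hQt]
          rfl
      have hcost : ∀ i : Fin n, i.val < j + 1 → rowCost k δ (conjQ Q u) i = rowCost k δ u i := by
        intro i hi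
        have e1 : rowN (conjQ Q u) i = rowN u i := by
          simp only [rowN, hrow i _ hi]
          exact sum_sq_vecMul Q hQ hQt fun m => u (i, m)
        have e2 : lowN (conjQ Q u) i = lowN u i := by
          unfold lowN
          refine Finset.sum_congr rfl fun l hl => ?_
          have hli : l ≤ i := by simpa using hl
          have hli' : l.val ≤ i.val := hli
          rw [hrow i l hi]
          simp [hQ0' _ l (by omega)]
        simp only [rowCost, e1, e2]
      refine (ih (j + 1) _ (by omega) hH').trans (le_of_eq ?_)
      have hset : Finset.univ.filter (fun i : Fin n => i.val < j + 1) =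
          insert ⟨j, hjn⟩ (Finset.univ.filter (fun i : Fin n => i.val < j)) := by
        ext i
        simp only [Finset.mem_filter, Finset.mem_univ, true_and, Finset.mem_insert, Fin.ext_iff]
        omega
      have hs : ∑ i ∈ Finset.univ.filter (fun i : Fin n => i.val < j + 1),
            rowCost k δ (conjQ Q u) i =
          rowCost k δ z ⟨j, hjn⟩ +
            ∑ i ∈ Finset.univ.filter (fun i : Fin n => i.val < j), rowCost k δ x i := by
        rw [hset, Finset.sum_insert (by simp)]
        congr 1
        · rw [hcost _ (by simp)]
          exact rowCost_congr _ _ _ _ _ fun l => by simp [hu, mix]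
        · refine Finset.sum_congr rfl fun i hi => ?_
          have hij : i.val < j := by simpa using hi
          rw [hcost _ (by omega)]
          exact rowCost_congr _ _ _ _ _ fun l => by simp [hu, mix, hij]
      rw [hs, ENNReal.ofReal_add (rowCost_nonneg _ _ _ _)
        (Finset.sum_nonneg fun _ _ => rowCost_nonneg _ _ _ _)]
      ring
    refine (lintegral_mono hpt).trans ?_
    rw [lintegral_add_left measurable_const]
    have := rowCost_integral k δ hδ ⟨j, hjn⟩ (by simp; omega)
    rw [lintegral_const, measure_univ, mul_one]
    refine (add_le_add le_rfl this).trans (le_of_eq ?_)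
    push_cast
    ring

/-- Row norms of powers of the Ginibre matrix. -/
lemma ginibre_bound {n : ℕ} [NeZero n] (k : ℕ) (hk : 0 < k) (hkn : k < n) (δ : ℝ) (hδ : 0 < δ) :
    ∫⁻ z, ENNReal.ofReal (rowF k z) ∂(gam (Fin n × Fin n)) ≤
        k * ENNReal.ofReal (((1 + δ) ^ 2) ^ k * ((n : ℝ) + 2 * k) ^ k +
        ((1 + δ⁻¹) ^ 2 * k) ^ k * (3 * k) ^ k) := by
  have := psi_le (n := n) k hk hkn δ hδ k 0 0 (by omega) (fun i l hi => by omega)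
  have hmix : ∀ y : Fin n × Fin n → ℝ, mix 0 0 y = y := fun y => by funext p; simp [mix]
  simpa [psi, hmix] using this

lemma ginibre_walk {n : ℕ} [NeZero n] (k : ℕ) :
    ∫⁻ z, ENNReal.ofReal (rowF k z) ∂(gam (Fin n × Fin n)) =
      ENNReal.ofReal (walkP (fun _ : Fin n => Finset.univ) k 0 k 0 []) := by
  have h := integral_row (gam (Fin n × Fin n)) (fun _ : Fin n => Finset.univ)
    (fun e z => z e) (fun z => toMat z) (fun z x y => by simp [toMat]) (fun L _ => by
      refine integral_monomial (gam (Fin n × Fin n)) (fun e z => z e)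
        (fun e => measurable_pi_apply e) (fun e => ?_) ?_ L
      · exact (measurePreserving_eval (fun _ : Fin n × Fin n => gaussianReal 0 1) e).map_eq
      · exact iIndepFun_pi (μ := fun _ : Fin n × Fin n => gaussianReal 0 1)
          (X := fun _ x => x) (fun _ => aemeasurable_id)) k 0
  exact h

section
variable {Ω : Type} [MeasurableSpace Ω] {μ : Measure Ω}
    {d : ℕ → ℕ} {E : ℕ → Finset (ℕ × ℕ)} {g : ℕ × ℕ → Ω → ℝ}
    {X : ∀ N : ℕ, Ω → Matrix (Fin N) (Fin N) ℂ}

/-- The real version of the model matrix. -/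
def realX (E : ℕ → Finset (ℕ × ℕ)) (g : ℕ × ℕ → Ω → ℝ) (N : ℕ) (ω : Ω) :
    Matrix (Fin N) (Fin N) ℝ :=
  fun x y => if ((x : ℕ), (y : ℕ)) ∈ E N then g ((x : ℕ), (y : ℕ)) ω else 0

/-- Out-neighbours. -/
def outNb (E : ℕ → Finset (ℕ × ℕ)) (N : ℕ) (x : Fin N) : Finset (Fin N) :=
  Finset.univ.filter fun y => ((x : ℕ), (y : ℕ)) ∈ E N

lemma outNb_card (hmodel : GaussianDigraphBandModel Ω μ d E g X) (N : ℕ) (x : Fin N) :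
    (outNb E N x).card ≤ d N := by
  rw [← hmodel.out_degree N x x.2]
  refine Finset.card_le_card_of_injOn (fun y => ((x : ℕ), (y : ℕ))) ?_ ?_
  · intro y hy
    have : ((x : ℕ), (y : ℕ)) ∈ E N := by simpa [outNb] using hy
    simp [this]
  · intro a _ b _ h
    exact Fin.ext (by simpa using h)

lemma model_mono [IsProbabilityMeasure μ] (hmodel : GaussianDigraphBandModel Ω μ d E g X) (N : ℕ)
    (L : List (Fin N × Fin N)) (hL : ∀ e ∈ L, e.2 ∈ outNb E N e.1) :
    Integrable (fun ω => (L.map (fun e => g ((e.1 : ℕ), (e.2 : ℕ)) ω)).prod) μ ∧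
        ∫ ω, (L.map (fun e => g ((e.1 : ℕ), (e.2 : ℕ)) ω)).prod ∂μ = phi L := by
  have hmem : ∀ e ∈ L, ((e.1 : ℕ), (e.2 : ℕ)) ∈ ⋃ N, (E N : Set (ℕ × ℕ)) := by
    intro e he
    have := hL e he
    simp only [outNb, Finset.mem_filter, Finset.mem_univ, true_and] at this
    exact Set.mem_iUnion.2 ⟨N, this⟩
  set L' : List {e : ℕ × ℕ // e ∈ ⋃ N, (E N : Set (ℕ × ℕ))} :=
    L.pmap (fun e h => ⟨((e.1 : ℕ), (e.2 : ℕ)), h⟩) hmem with hL'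
  have hval : L'.map Subtype.val = L.map (fun e => ((e.1 : ℕ), (e.2 : ℕ))) := by
    rw [hL', List.map_pmap]
    simp
  have h := integral_monomial μ (fun e : {e : ℕ × ℕ // e ∈ ⋃ N, (E N : Set (ℕ × ℕ))} => g e.1)
    (fun e => hmodel.g_meas e.1) (fun e => hmodel.g_gaussian e.1 e.2) hmodel.g_indep L'
  have hprod : ∀ ω, (L'.map (fun e => g e.1 ω)).prod =
      (L.map (fun e => g ((e.1 : ℕ), (e.2 : ℕ)) ω)).prod := by
    intro ω
    have := congrArg (fun l : List (ℕ × ℕ) => (l.map (fun e => g e ω)).prod) hval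
    simpa only [List.map_map, Function.comp_def] using this
  have hphi : phi L' = phi L := by
    rw [← phi_map Subtype.val L' (fun a _ b _ hab => Subtype.ext hab), hval]
    refine phi_map _ _ fun a _ b _ hab => ?_
    simp only [Prod.mk.injEq] at hab
    exact Prod.ext (Fin.ext hab.1) (Fin.ext hab.2)
  simp only [hprod] at h
  rwa [hphi] at h

lemma model_row [IsProbabilityMeasure μ] (hmodel : GaussianDigraphBandModel Ω μ d E g X) (N : ℕ)
    (x : Fin N) (k : ℕ) (hk : 0 < k) (δ : ℝ) (hδ : 0 < δ) (h1 : 4 * (k : ℝ) + 1 ≤ δ * d N)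
    (h2 : (1 + δ⁻¹) ^ 2 * (3 * (k : ℝ) ^ 2) ≤ d N) :
    ∫⁻ ω, ENNReal.ofReal (∑ y, ((realX E g N ω ^ k) x y) ^ 2) ∂μ ≤
      ENNReal.ofReal (k * (2 * ((1 + δ) ^ 3) ^ k * (d N : ℝ) ^ k)) := by
  have hrow := integral_row μ (outNb E N) (fun e ω => g ((e.1 : ℕ), (e.2 : ℕ)) ω)
    (fun ω => realX E g N ω) (fun ω x y => by simp [realX, outNb])
    (fun L hL => model_mono hmodel N L hL) k x
  rw [hrow]
  have hcmp := walkP_le (n := d N + 2 * k + 1) (outNb E N) (outNb_card hmodel N) k x k x [] {x}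
    (fun _ => 0) (by simp) (by simp) (by simp) (by simp) (by simp; omega)
  refine (ENNReal.ofReal_le_ofReal hcmp).trans ?_
  rw [List.map_nil, ← ginibre_walk]
  refine (ginibre_bound k hk (by omega) δ hδ).trans ?_
  rw [← ENNReal.ofReal_natCast, ← ENNReal.ofReal_mul (by positivity)]
  refine ENNReal.ofReal_le_ofReal ?_
  refine mul_le_mul_of_nonneg_left ?_ (by positivity)
  have e1 : (((d N + 2 * k + 1 : ℕ) : ℝ) + 2 * k) ^ k ≤ ((1 + δ) * d N) ^ k := by
    refine pow_le_pow_left₀ (by positivity) ?_ k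
    push_cast
    linarith
  have e2 : ((1 + δ⁻¹) ^ 2 * (k : ℝ)) ^ k * (3 * (k : ℝ)) ^ k ≤ (d N : ℝ) ^ k := by
    rw [← mul_pow]
    refine pow_le_pow_left₀ (by positivity) ?_ k
    refine le_trans (le_of_eq ?_) h2
    ring
  have e3 : (1 : ℝ) ≤ ((1 + δ) ^ 3) ^ k :=
    one_le_pow₀ (one_le_pow₀ (by linarith))
  have e4 : ((1 + δ) ^ 2) ^ k * ((1 + δ) * (d N : ℝ)) ^ k = ((1 + δ) ^ 3) ^ k * (d N : ℝ) ^ k := by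
    rw [← mul_pow, ← mul_pow]
    congr 1
    ring
  have e5 : (d N : ℝ) ^ k ≤ ((1 + δ) ^ 3) ^ k * (d N : ℝ) ^ k :=
    le_mul_of_one_le_left (by positivity) e3
  calc _ ≤ ((1 + δ) ^ 2) ^ k * ((1 + δ) * (d N : ℝ)) ^ k + (d N : ℝ) ^ k := by gcongr
    _ ≤ _ := by rw [e4]; linarith

lemma measurable_realX_pow (hmodel : GaussianDigraphBandModel Ω μ d E g X) (N k : ℕ)
    (x y : Fin N) : Measurable fun ω => (realX E g N ω ^ k) x y := by
  induction k generalizing x y with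
  | zero => simp
  | succ k ih =>
    simp only [pow_succ, Matrix.mul_apply]
    refine Finset.measurable_fun_sum _ fun m _ => (ih x m).mul ?_
    unfold realX
    by_cases h : ((m : ℕ), (y : ℕ)) ∈ E N
    · simpa [h] using hmodel.g_meas _
    · simp [h]

/-- Squared Frobenius norm of the `k`-th power. -/
def frob (E : ℕ → Finset (ℕ × ℕ)) (g : ℕ × ℕ → Ω → ℝ) (N k : ℕ) (ω : Ω) : ℝ :=
  ∑ x, ∑ y, ((realX E g N ω ^ k) x y) ^ 2

lemma model_frob [IsProbabilityMeasure μ] (hmodel : GaussianDigraphBandModel Ω μ d E g X) (N : ℕ)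
    (k : ℕ) (hk : 0 < k) (δ : ℝ) (hδ : 0 < δ) (h1 : 4 * (k : ℝ) + 1 ≤ δ * d N)
    (h2 : (1 + δ⁻¹) ^ 2 * (3 * (k : ℝ) ^ 2) ≤ d N) :
    ∫⁻ ω, ENNReal.ofReal (frob E g N k ω) ∂μ ≤
      ENNReal.ofReal (N * (k * (2 * ((1 + δ) ^ 3) ^ k * (d N : ℝ) ^ k))) := by
  unfold frob
  have : ∀ ω, ENNReal.ofReal (∑ x, ∑ y, ((realX E g N ω ^ k) x y) ^ 2) =
      ∑ x, ENNReal.ofReal (∑ y, ((realX E g N ω ^ k) x y) ^ 2) := fun ω =>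
    ENNReal.ofReal_sum_of_nonneg fun _ _ => Finset.sum_nonneg fun _ _ => sq_nonneg _
  simp only [this]
  rw [lintegral_finsetSum]
  · refine (Finset.sum_le_sum fun x _ => model_row hmodel N x k hk δ hδ h1 h2).trans ?_
    rw [Finset.sum_const, Finset.card_univ, Fintype.card_fin, nsmul_eq_mul,
      ENNReal.ofReal_mul (p := (N : ℝ)) (by positivity), ENNReal.ofReal_natCast]
  · intro x _
    exact (Finset.measurable_fun_sum _ fun y _ =>
      (measurable_realX_pow hmodel N k x y).pow_const 2).ennreal_ofReal

lemma eig_frob_s6 {N : ℕ} (A : Matrix (Fin N) (Fin N) ℝ) (c : ℝ) (hc : 0 < c) (k : ℕ) (z : ℂ)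
    (hz : z ∈ eigs (((Real.sqrt c : ℂ))⁻¹ • A.map (fun a : ℝ => (a : ℂ)))) :
    (‖z‖ ^ 2) ^ k * c ^ k ≤ ∑ x, ∑ y, ((A ^ k) x y) ^ 2 := by
  set s : ℂ := (Real.sqrt c : ℂ) with hs
  have hs0 : s ≠ 0 := by
    rw [hs]; exact_mod_cast (Real.sqrt_pos.2 hc).ne'
  set B := A.map (fun a : ℝ => (a : ℂ)) with hB
  have hroot : (s⁻¹ • B).charpoly.IsRoot z := Polynomial.isRoot_of_mem_roots hz
  rw [← Matrix.mem_spectrum_iff_isRoot_charpoly, ← Matrix.spectrum_toLin',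
    ← Module.End.hasEigenvalue_iff_mem_spectrum] at hroot
  obtain ⟨v, hv⟩ := hroot.exists_hasEigenvector
  have hv0 : v ≠ 0 := hv.2
  have hv1 : (s⁻¹ • B) *ᵥ v = z • v := by
    have := hv.apply_eq_smul
    rwa [Matrix.toLin'_apply] at this
  have hv2 : B *ᵥ v = (s * z) • v := by
    rw [mul_smul, ← hv1, Matrix.smul_mulVec, smul_smul, mul_inv_cancel₀ hs0, one_smul]
  have hv3 : ∀ j : ℕ, (B ^ j) *ᵥ v = (s * z) ^ j • v := by
    intro j
    induction j with
    | zero => simp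
    | succ j ih =>
      rw [pow_succ, ← Matrix.mulVec_mulVec, hv2, Matrix.mulVec_smul, ih, smul_smul, pow_succ]
      congr 1
      ring
  have hBk : B ^ k = (A ^ k).map (fun a : ℝ => (a : ℂ)) := by
    have := (Matrix.map_pow A Complex.ofRealHom k)
    exact this.symm
  have hpt : ∀ x, (‖z‖ ^ 2) ^ k * c ^ k * ‖v x‖ ^ 2 ≤
      (∑ y, ((A ^ k) x y) ^ 2) * ∑ y, ‖v y‖ ^ 2 := by
    intro x
    have e := congrFun (hv3 k) x
    rw [hBk] at e
    have e' : ‖(s * z) ^ k * v x‖ ≤ ∑ y, |(A ^ k) x y| * ‖v y‖ := by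
      have : (s * z) ^ k * v x = ∑ y, (((A ^ k) x y : ℝ) : ℂ) * v y := by
        rw [← smul_eq_mul, ← Pi.smul_apply, ← e]
        simp [Matrix.mulVec, dotProduct]
      rw [this]
      refine (norm_sum_le _ _).trans (le_of_eq ?_)
      simp
    have hsn : ‖s‖ ^ 2 = c := by
      rw [hs, Complex.norm_real, Real.norm_eq_abs, sq_abs, Real.sq_sqrt hc.le]
    have e2 : (‖z‖ ^ 2) ^ k * c ^ k * ‖v x‖ ^ 2 = ‖(s * z) ^ k * v x‖ ^ 2 := by
      rw [norm_mul, norm_pow, norm_mul, ← hsn]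
      ring
    rw [e2]
    calc _ ≤ (∑ y, |(A ^ k) x y| * ‖v y‖) ^ 2 := by gcongr
      _ ≤ (∑ y, |(A ^ k) x y| ^ 2) * ∑ y, ‖v y‖ ^ 2 := Finset.sum_mul_sq_le_sq_mul_sq _ _ _
      _ = _ := by simp only [sq_abs]
  have hsum := Finset.sum_le_sum fun x (_ : x ∈ Finset.univ) => hpt x
  rw [← Finset.mul_sum, ← Finset.sum_mul] at hsum
  have hpos : 0 < ∑ y, ‖v y‖ ^ 2 := by
    obtain ⟨y, hy⟩ := Function.ne_iff.1 hv0
    refine Finset.sum_pos' (fun _ _ => by positivity) ⟨y, Finset.mem_univ _, ?_⟩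
    have : 0 < ‖v y‖ := norm_pos_iff.2 hy
    positivity
  exact le_of_mul_le_mul_right hsum hpos

lemma model_prob [IsProbabilityMeasure μ] (hmodel : GaussianDigraphBandModel Ω μ d E g X) (N : ℕ)
    (hd : 0 < d N) (ε : ℝ) (hε : 0 < ε)
    (k : ℕ) (hk : 0 < k) (δ : ℝ) (hδ : 0 < δ) (h1 : 4 * (k : ℝ) + 1 ≤ δ * d N)
    (h2 : (1 + δ⁻¹) ^ 2 * (3 * (k : ℝ) ^ 2) ≤ d N) (hδε : (1 + δ) ^ 3 ≤ 1 + ε) :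
    μ {ω | ((1 + ε) ^ 2) ^ k * (d N : ℝ) ^ k ≤ frob E g N k ω} ≤
      ENNReal.ofReal (2 * N * k * ((1 + ε) ^ k)⁻¹) := by
  set t : ℝ := ((1 + ε) ^ 2) ^ k * (d N : ℝ) ^ k with ht
  have hd' : (0 : ℝ) < d N := by exact_mod_cast hd
  have htp : 0 < t := by positivity
  have hmeas : Measurable fun ω => ENNReal.ofReal (frob E g N k ω) := by
    unfold frob
    exact (Finset.measurable_fun_sum _ fun x _ => Finset.measurable_fun_sum _ fun y _ =>
      (measurable_realX_pow hmodel N k x y).pow_const 2).ennreal_ofReal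
  have hsub : {ω | t ≤ frob E g N k ω} ⊆
      {ω | ENNReal.ofReal t ≤ ENNReal.ofReal (frob E g N k ω)} :=
    fun ω h => ENNReal.ofReal_le_ofReal h
  refine (measure_mono hsub).trans ?_
  refine (meas_ge_le_lintegral_div hmeas.aemeasurable (by simpa using htp)
    ENNReal.ofReal_ne_top).trans ?_
  refine (ENNReal.div_le_div_right (model_frob hmodel N k hk δ hδ h1 h2) _).trans ?_
  rw [← ENNReal.ofReal_div_of_pos htp]
  refine ENNReal.ofReal_le_ofReal ?_
  rw [div_le_iff₀ htp, ht]
  have e1 : ((1 + δ) ^ 3) ^ k ≤ (1 + ε) ^ k := pow_le_pow_left₀ (by positivity) hδε k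
  have e2 : ((1 + ε) ^ k)⁻¹ * ((1 + ε) ^ 2) ^ k = (1 + ε) ^ k := by
    have : (1 + ε) ^ k ≠ 0 := by positivity
    rw [← pow_mul, mul_comm 2 k, pow_mul]
    field_simp
  calc (N : ℝ) * (k * (2 * ((1 + δ) ^ 3) ^ k * (d N : ℝ) ^ k))
      ≤ (N : ℝ) * (k * (2 * (1 + ε) ^ k * (d N : ℝ) ^ k)) := by gcongr
    _ = 2 * N * k * (((1 + ε) ^ k)⁻¹ * ((1 + ε) ^ 2) ^ k) * (d N : ℝ) ^ k := by rw [e2]; ring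
    _ = _ := by ring

end

/-- Choice of the power and the eventual numerical estimates. -/
lemma asymp (d : ℕ → ℕ)
    (hd : Tendsto (fun N => (d N : ℝ) / (Real.log N) ^ 3) atTop atTop) (ε : ℝ) (hε : 0 < ε)
    (δ : ℝ) (hδ : 0 < δ) :
    ∃ (C : ℝ) (k : ℕ → ℕ), 0 < C ∧ ∀ᶠ N in atTop, 1 ≤ N ∧ 0 < k N ∧
      4 * (k N : ℝ) + 1 ≤ δ * d N ∧ (1 + δ⁻¹) ^ 2 * (3 * (k N : ℝ) ^ 2) ≤ d N ∧
      2 * N * k N * ((1 + ε) ^ k N)⁻¹ ≤ C * (1 / (N : ℝ) ^ 2) := by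
  have hl : 0 < Real.log (1 + ε) := Real.log_pos (by linarith)
  set c : ℝ := 4 / Real.log (1 + ε) with hc
  have hcp : 0 < c := by positivity
  set K : ℝ := max ((4 * (c + 2) + 1) / δ) ((1 + δ⁻¹) ^ 2 * (3 * (c + 2) ^ 2)) with hK
  have hKp : 0 < K := lt_max_of_lt_left (by positivity)
  refine ⟨2 * (c + 2), fun N => ⌈c * Real.log N⌉₊ + 1, by positivity, ?_⟩
  filter_upwards [hd.eventually_ge_atTop K, eventually_ge_atTop 3] with N hN hN3
  have hN3' : (3 : ℝ) ≤ N := by exact_mod_cast hN3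
  have hlog1 : 1 ≤ Real.log N := by
    rw [Real.le_log_iff_exp_le (by linarith)]
    linarith [Real.exp_one_lt_d9]
  set l := Real.log N with hlN
  have hlN' : l ≤ N := (Real.log_le_sub_one_of_pos (by linarith)).trans (by linarith)
  set k := ⌈c * l⌉₊ + 1 with hk
  have hk1 : (k : ℝ) ≤ (c + 2) * l := by
    have := (Nat.ceil_lt_add_one (show 0 ≤ c * l by positivity)).le
    rw [hk]; push_cast
    nlinarith
  have hk2 : c * l ≤ k := by
    have := Nat.le_ceil (c * l)
    rw [hk]; push_cast; linarith
  have hdN : K * l ^ 3 ≤ d N := (le_div_iff₀ (by positivity)).1 hN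
  have hl2 : l ^ 2 ≤ l ^ 3 := pow_le_pow_right₀ hlog1 (by norm_num)
  have hl3 : l ≤ l ^ 3 := le_self_pow₀ hlog1 (by norm_num)
  refine ⟨by omega, by omega, ?_, ?_, ?_⟩
  · have : (4 * (c + 2) + 1) / δ ≤ K := le_max_left _ _
    rw [div_le_iff₀ hδ] at this
    calc 4 * (k : ℝ) + 1 ≤ (4 * (c + 2) + 1) * l := by nlinarith
      _ ≤ K * δ * l := by gcongr
      _ ≤ K * δ * l ^ 3 := by gcongr
      _ = δ * (K * l ^ 3) := by ring
      _ ≤ _ := by gcongr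
  · have : (1 + δ⁻¹) ^ 2 * (3 * (c + 2) ^ 2) ≤ K := le_max_right _ _
    calc (1 + δ⁻¹) ^ 2 * (3 * (k : ℝ) ^ 2) ≤ (1 + δ⁻¹) ^ 2 * (3 * ((c + 2) * l) ^ 2) := by gcongr
      _ = ((1 + δ⁻¹) ^ 2 * (3 * (c + 2) ^ 2)) * l ^ 2 := by ring
      _ ≤ K * l ^ 3 := by gcongr
      _ ≤ _ := hdN
  · have hpow : (N : ℝ) ^ 4 ≤ (1 + ε) ^ k := by
      rw [← Real.log_le_log_iff (by positivity) (by positivity), Real.log_pow, Real.log_pow]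
      have : c * Real.log (1 + ε) = 4 := by rw [hc]; field_simp
      push_cast
      calc 4 * l = (c * l) * Real.log (1 + ε) := by rw [← this]; ring
        _ ≤ _ := by gcongr
    have hNp : (0 : ℝ) < N := by linarith
    calc 2 * (N : ℝ) * k * ((1 + ε) ^ k)⁻¹ ≤ 2 * N * ((c + 2) * N) * ((N : ℝ) ^ 4)⁻¹ := by
          gcongr
          exact hk1.trans (by gcongr)
      _ = 2 * (c + 2) * (1 / (N : ℝ) ^ 2) := by field_simp

/-- Theorem 1.1 (1), Gaussian case: almost surely, eventually in N, all eigenvalues of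
d_N^{−1/2}·X_N have modulus at most 1 + ε. -/
theorem stmt6 (Ω : Type) [MeasurableSpace Ω] (μ : Measure Ω) [IsProbabilityMeasure μ]
    (d : ℕ → ℕ) (E : ℕ → Finset (ℕ × ℕ)) (g : ℕ × ℕ → Ω → ℝ)
    (X : ∀ N : ℕ, Ω → Matrix (Fin N) (Fin N) ℂ)
    (hmodel : GaussianDigraphBandModel Ω μ d E g X)
    (ε : ℝ) (hε : 0 < ε) :
    ∀ᵐ ω ∂μ, ∀ᶠ N in atTop,
      ∀ z ∈ eigs (((Real.sqrt (d N) : ℂ))⁻¹ • X N ω), ‖z‖ ≤ 1 + ε := by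
  set δ : ℝ := min 1 (ε / 7) with hδdef
  have hδ : 0 < δ := lt_min one_pos (by positivity)
  have hδ1 : δ ≤ 1 := min_le_left _ _
  have hδ2 : δ ≤ ε / 7 := min_le_right _ _
  have hδε : (1 + δ) ^ 3 ≤ 1 + ε := by nlinarith [mul_nonneg hδ.le hδ.le, sq_nonneg δ]
  obtain ⟨C, k, hC, hev⟩ := asymp d hmodel.deg_growth ε hε δ hδ
  obtain ⟨N₀, hN₀⟩ := eventually_atTop.1 hev
  set s : ℕ → Set Ω := fun N => if N₀ ≤ N then
    {ω | ((1 + ε) ^ 2) ^ k N * (d N : ℝ) ^ k N ≤ frob E g N (k N) ω} else ∅ with hs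
  have hbound : ∀ N, μ (s N) ≤ ENNReal.ofReal (C * (1 / (N : ℝ) ^ 2)) := by
    intro N
    by_cases hN : N₀ ≤ N
    · obtain ⟨a1, a2, a3, a4, a5⟩ := hN₀ N hN
      simp only [hs, hN, if_true]
      exact (model_prob hmodel N (hmodel.deg_ge N a1) ε hε (k N) a2 δ hδ a3 a4 hδε).trans
        (ENNReal.ofReal_le_ofReal a5)
    · simp [hs, hN]
  have hsummable : Summable fun N : ℕ => C * (1 / (N : ℝ) ^ 2) :=
    (Real.summable_one_div_nat_pow.2 (by norm_num)).mul_left C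
  have htop : (∑' N, μ (s N)) ≠ ∞ :=
    ne_top_of_le_ne_top hsummable.tsum_ofReal_ne_top (ENNReal.tsum_le_tsum hbound)
  filter_upwards [ae_eventually_notMem htop] with ω hω
  filter_upwards [hω, eventually_ge_atTop N₀] with N hN hNN z hz
  by_contra hcon
  push Not at hcon
  apply hN
  simp only [hs, hNN, if_true, Set.mem_ofPred_eq]
  obtain ⟨a1, -⟩ := hN₀ N hNN
  have hX : X N ω = (realX E g N ω).map (fun a : ℝ => (a : ℂ)) := by
    ext x y
    rw [hmodel.X_def, Matrix.map_apply, realX]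
    split_ifs <;> simp
  rw [hX] at hz
  have hdp : (0 : ℝ) < d N := by exact_mod_cast hmodel.deg_ge N a1
  refine le_trans ?_ (eig_frob_s6 (realX E g N ω) (d N) hdp (k N) z hz)
  gcongr

end
end

section
/- For every η > 0, every z ∈ ℂ, and every ρ₀ ∈ ℂ with |ρ₀| ≤ 1, there exist a real number V > 0 and a complex number b such that V·(1 − 1/(V² + |b|²)) + η = 0 and conj(b)·ρ₀ + b/(V² + |b|²) + z = 0. -/
noncomputable section

/-- Lemma 3.1: existence of a solution (V, b), V > 0, to the scalar Dyson equations
V(1 − 1/(V² + |b|²)) + η = 0 and conj(b)·ρ₀ + b/(V² + |b|²) + z = 0. -/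
theorem stmt13 (η : ℝ) (hη : 0 < η) (z ρ₀ : ℂ) (hρ : ‖ρ₀‖ ≤ 1) :
    ∃ (V : ℝ) (b : ℂ), 0 < V ∧
      V * (1 - 1 / (V ^ 2 + ‖b‖ ^ 2)) + η = 0 ∧
      (starRingEnd ℂ) b * ρ₀ + b / (((V : ℂ)) ^ 2 + ((‖b‖ : ℝ) : ℂ) ^ 2) + z = 0 := by
  let b : ℝ → ℂ := fun u => (-z * u + (starRingEnd ℂ) z * ρ₀) / ((u ^ 2 - ‖ρ₀‖ ^ 2 : ℝ) : ℂ)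
  have hD : ∀ u : ℝ, 1 < u → 0 < u ^ 2 - ‖ρ₀‖ ^ 2 := by
    intro u hu
    nlinarith [norm_nonneg ρ₀]
  have hb : ∀ u : ℝ, 1 < u → b u * u + (starRingEnd ℂ) (b u) * ρ₀ = -z := by
    intro u hu
    have h1 : ((u ^ 2 - ‖ρ₀‖ ^ 2 : ℝ) : ℂ) ≠ 0 := by
      exact_mod_cast (hD u hu).ne'
    have h2 : ρ₀ * (starRingEnd ℂ) ρ₀ = ((‖ρ₀‖ ^ 2 : ℝ) : ℂ) := by
      rw [Complex.mul_conj, Complex.normSq_eq_norm_sq]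
    simp only [b, map_div₀, map_add, map_mul, map_neg, Complex.conj_conj, Complex.conj_ofReal]
    rw [div_mul_eq_mul_div, div_mul_eq_mul_div, ← add_div, div_eq_iff h1]
    push_cast at h2 ⊢
    linear_combination z * h2
  have hbn : ∀ u : ℝ, 1 < u → ‖b u‖ * (u - 1) ≤ ‖z‖ := by
    intro u hu
    have h1 : b u * u = -z - (starRingEnd ℂ) (b u) * ρ₀ := by
      rw [← hb u hu]; ring
    have h2 : ‖b u * u‖ ≤ ‖z‖ + ‖b u‖ * ‖ρ₀‖ := by
      rw [h1]
      refine (norm_sub_le _ _).trans ?_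
      simp
    rw [norm_mul, Complex.norm_real, Real.norm_of_nonneg (by linarith)] at h2
    nlinarith [norm_nonneg (b u)]
  let f : ℝ → ℝ := fun u => u * ((η / (u - 1)) ^ 2 + ‖b u‖ ^ 2)
  set C := η ^ 2 + ‖z‖ ^ 2 with hC
  have hle : 1 + η ≤ C + 2 := by nlinarith [sq_nonneg (η - 1), sq_nonneg ‖z‖]
  have hcont : ContinuousOn f (Set.Icc (1 + η) (C + 2)) := by
    have hbc : ContinuousOn b (Set.Icc (1 + η) (C + 2)) := by
      apply ContinuousOn.div
      · fun_prop
      · fun_prop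
      · intro u hu
        exact_mod_cast (hD u (by linarith [hu.1])).ne'
    have hvc : ContinuousOn (fun u : ℝ => η / (u - 1)) (Set.Icc (1 + η) (C + 2)) := by
      apply ContinuousOn.div
      · fun_prop
      · fun_prop
      · intro u hu
        have := hu.1
        linarith
    exact continuousOn_id.mul ((hvc.pow 2).add (hbc.norm.pow 2))
  have hfl : 1 ≤ f (1 + η) := by
    simp only [f, add_sub_cancel_left, div_self hη.ne']
    nlinarith [sq_nonneg ‖b (1 + η)‖]
  have hfr : f (C + 2) ≤ 1 := by
    have hC0 : 0 ≤ C := by positivity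
    have h1 := hbn (C + 2) (by linarith)
    have h3 : (‖b (C+2)‖ * (C + 2 - 1)) ^ 2 ≤ ‖z‖ ^ 2 := by
      gcongr
      exact mul_nonneg (norm_nonneg _) (by linarith)
    have h4 : (0:ℝ) < (C + 2 - 1) ^ 2 := by
      apply pow_pos; linarith
    have h5 : f (C + 2) * (C + 2 - 1) ^ 2 = (C + 2) * (η ^ 2 + (‖b (C+2)‖ * (C + 2 - 1)) ^ 2) := by
      have : C + 2 - 1 ≠ 0 := by linarith
      simp only [f]
      field_simp
    have h6 : (C + 2) * (η ^ 2 + (‖b (C+2)‖ * (C + 2 - 1)) ^ 2) ≤ (C + 2) * C := by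
      apply mul_le_mul_of_nonneg_left _ (by linarith)
      linarith
    refine le_of_mul_le_mul_right ?_ h4
    rw [h5]
    nlinarith
  obtain ⟨u, hu, hfu⟩ := intermediate_value_Icc' hle hcont ⟨hfr, hfl⟩
  have hu1 : 1 < u := by linarith [hu.1]
  have hu0 : u ≠ 0 := by linarith
  have key : (η / (u - 1)) ^ 2 + ‖b u‖ ^ 2 = u⁻¹ := eq_inv_of_mul_eq_one_right hfu
  refine ⟨η / (u - 1), b u, div_pos hη (by linarith), ?_, ?_⟩
  · rw [key]
    have : u - 1 ≠ 0 := by linarith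
    field_simp
    ring
  · have k2 : (((η / (u - 1) : ℝ) : ℂ)) ^ 2 + ((‖b u‖ : ℝ) : ℂ) ^ 2 = (u : ℂ)⁻¹ := by
      exact_mod_cast congrArg (fun x : ℝ => (x : ℂ)) key
    rw [k2, div_inv_eq_mul]
    linear_combination hb u hu1

end
end

section
/- Let ρ ∈ ℂ with 0 < |ρ| ≤ 1. Then the map λ ↦ λ + ρ/λ is a bijection from {λ ∈ ℂ : |λ| > 1} onto ℂ∖𝓔_ρ. -/
noncomputable section

open ComplexConjugate in
theorem aux_mem (a b : ℂ) (ha : ‖a‖ ≤ 1) (hb : ‖b‖ ≤ 1) : a + b ∈ ellipticSet (a * b) := by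
  have ha0 := norm_nonneg a
  have hb0 := norm_nonneg b
  have hca : a * conj a = ((‖a‖ ^ 2 : ℝ) : ℂ) := by
    rw [Complex.mul_conj, Complex.normSq_eq_norm_sq]
  have hcb : b * conj b = ((‖b‖ ^ 2 : ℝ) : ℂ) := by
    rw [Complex.mul_conj, Complex.normSq_eq_norm_sq]
  by_cases hab : ‖a‖ * ‖b‖ = 1
  · have ha1 : ‖a‖ = 1 := by nlinarith
    refine ⟨a, ha, ?_⟩
    rw [ha1] at hca
    push_cast at hca
    linear_combination (-b) * hca
  · have hlt : ‖a‖ * ‖b‖ < 1 := lt_of_le_of_ne (by nlinarith) hab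
    have hD : 0 < 1 - ‖a‖ ^ 2 * ‖b‖ ^ 2 := by nlinarith [mul_nonneg ha0 hb0]
    have hDc : (((1 - ‖a‖ ^ 2 * ‖b‖ ^ 2 : ℝ)) : ℂ) ≠ 0 := by exact_mod_cast hD.ne'
    refine ⟨(a * ((1 - ‖b‖ ^ 2 : ℝ) : ℂ) + b * ((1 - ‖a‖ ^ 2 : ℝ) : ℂ)) /
      ((1 - ‖a‖ ^ 2 * ‖b‖ ^ 2 : ℝ) : ℂ), ?_, ?_⟩
    · rw [norm_div, Complex.norm_real, Real.norm_of_nonneg hD.le, div_le_one hD]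
      refine (norm_add_le _ _).trans ?_
      rw [norm_mul, norm_mul, Complex.norm_real, Complex.norm_real,
        Real.norm_of_nonneg (by nlinarith), Real.norm_of_nonneg (by nlinarith)]
      nlinarith [mul_nonneg (mul_nonneg (sub_nonneg.2 ha) (sub_nonneg.2 hb)) (sub_nonneg.2 hlt.le)]
    · simp only [map_div₀, map_add, map_mul, Complex.conj_ofReal]
      rw [← mul_div_assoc, ← add_div, eq_div_iff hDc]
      push_cast at hca hcb ⊢
      linear_combination (-(b * (1 - (‖b‖ : ℂ) ^ 2))) * hca + (-(a * (1 - (‖a‖ : ℂ) ^ 2))) * hcb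

open ComplexConjugate in
theorem aux_maps (ρ l x : ℂ) (h1 : ‖ρ‖ ≤ 1) (hl : 1 < ‖l‖) (hx : ‖x‖ ≤ 1)
    (h : l + ρ / l = x + ρ * conj x) : False := by
  have hl0 : l ≠ 0 := by rintro rfl; simp at hl; linarith
  have e : l * (l - x) = ρ * (conj x * l - 1) := by
    field_simp at h
    linear_combination h
  have e2 : ‖l‖ * ‖l - x‖ ≤ ‖conj x * l - 1‖ := by
    rw [← norm_mul, e, norm_mul]
    exact mul_le_of_le_one_left (norm_nonneg _) h1
  have e3 : ‖conj x * l - 1‖ ^ 2 - ‖l - x‖ ^ 2 = (1 - ‖x‖ ^ 2) * (1 - ‖l‖ ^ 2) := by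
    simp only [← Complex.normSq_eq_norm_sq, Complex.normSq_apply]
    simp
    ring
  have e4 : (‖l‖ * ‖l - x‖) ^ 2 ≤ ‖conj x * l - 1‖ ^ 2 := by gcongr
  have e5 : 0 ≤ (1 - ‖x‖ ^ 2) * (‖l‖ ^ 2 - 1) :=
    mul_nonneg (by nlinarith [norm_nonneg x]) (by nlinarith)
  have e6 : 0 < ‖l - x‖ := by
    rw [norm_pos_iff, sub_ne_zero]
    rintro rfl
    linarith
  have e7 : 0 < (‖l‖ ^ 2 - 1) * ‖l - x‖ ^ 2 := mul_pos (by nlinarith) (by positivity)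
  nlinarith

/-- For 0 < |ρ| ≤ 1, the map λ ↦ λ + ρ/λ is a bijection from {|λ| > 1} onto ℂ∖𝓔_ρ. -/
theorem stmt16 (ρ : ℂ) (h0 : 0 < ‖ρ‖) (h1 : ‖ρ‖ ≤ 1) :
    Set.BijOn (fun l : ℂ => l + ρ / l) {l : ℂ | 1 < ‖l‖} (ellipticSet ρ)ᶜ := by
  refine ⟨?_, ?_, ?_⟩
  · rintro l hl ⟨x, hx, h⟩
    exact aux_maps ρ l x h1 hl hx h
  · intro l hl m hm h
    simp only [Set.mem_setOf_eq] at hl hm h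
    have hl0 : l ≠ 0 := by rintro rfl; simp at hl; linarith
    have hm0 : m ≠ 0 := by rintro rfl; simp at hm; linarith
    have e : (l - m) * (l * m - ρ) = 0 := by
      field_simp at h
      linear_combination h
    rcases mul_eq_zero.1 e with e | e
    · exact sub_eq_zero.1 e
    · exfalso
      rw [← sub_eq_zero.1 e, norm_mul] at h1
      nlinarith
  · intro z hz
    obtain ⟨s, hs⟩ := IsAlgClosed.exists_pow_nat_eq (z ^ 2 - 4 * ρ) (n := 2) (by norm_num)
    have hab : (z + s) / 2 * ((z - s) / 2) = ρ := by linear_combination (-1 / 4) * hs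
    have hsum : (z + s) / 2 + (z - s) / 2 = z := by ring
    generalize (z + s) / 2 = a at hab hsum
    generalize (z - s) / 2 = b at hab hsum
    have hρ : ρ ≠ 0 := norm_pos_iff.1 h0
    have ha0 : a ≠ 0 := by rintro rfl; simp at hab; exact hρ hab.symm
    have hb0 : b ≠ 0 := by rintro rfl; simp at hab; exact hρ hab.symm
    by_cases ha : 1 < ‖a‖
    · refine ⟨a, ha, ?_⟩
      simp only [← hab, ← hsum]
      field_simp
    by_cases hb : 1 < ‖b‖
    · refine ⟨b, hb, ?_⟩
      simp only [← hab, ← hsum]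
      field_simp
      ring
    exact absurd (hab ▸ hsum ▸ aux_mem a b (not_lt.1 ha) (not_lt.1 hb)) hz

end
end

section
/- Let ρ ∈ ℂ with |ρ| ≤ 1, let C be an N×N complex matrix, and let z ∈ ℂ∖𝓔_ρ. Then det(I_N + m_ρ(z)·C) = 0 if and only if z = λ + ρ/λ for some eigenvalue λ of C with |λ| > 1. -/
open scoped Classical

noncomputable section

/-- m_ρ(z): for ρ ≠ 0 the unique root w of ρw² + zw + 1 = 0 with |w| < 1; m₀(z) = −1/z. -/
def mRho (ρ z : ℂ) : ℂ :=
  if ρ = 0 then -z⁻¹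
  else if h : ∃ w : ℂ, ρ * w ^ 2 + z * w + 1 = 0 ∧ ‖w‖ < 1 then h.choose else 0

theorem det_iff_aux {N : ℕ} (C : Matrix (Fin N) (Fin N) ℂ) (m : ℂ) (hm : m ≠ 0) :
    ((1 : Matrix (Fin N) (Fin N) ℂ) + m • C).det = 0 ↔ -m⁻¹ ∈ eigs C := by
  unfold eigs
  rw [Polynomial.mem_roots (Matrix.charpoly_monic C).ne_zero, Polynomial.IsRoot.def,
    Matrix.eval_charpoly]
  have : (1 : Matrix (Fin N) (Fin N) ℂ) + m • C = (-m) • (Matrix.scalar (Fin N) (-m⁻¹) - C) := by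
    rw [smul_sub, Matrix.scalar_apply, ← Matrix.smul_one_eq_diagonal, smul_smul]
    simp [hm]
  rw [this, Matrix.det_smul]
  simp [hm]

theorem mRho_unique_aux (ρ z v w : ℂ) (hρ : ‖ρ‖ ≤ 1) (hv : ρ * v ^ 2 + z * v + 1 = 0)
    (hw : ρ * w ^ 2 + z * w + 1 = 0) (hv1 : ‖v‖ < 1) (hw1 : ‖w‖ < 1) : v = w := by
  by_contra hne
  have h1 : ρ * (v + w) + z = 0 := by
    apply mul_left_cancel₀ (sub_ne_zero.mpr hne)
    linear_combination hv - hw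
  have h2 : ρ * (v * w) = 1 := by linear_combination v * h1 - hv
  have h3 := congrArg norm h2
  rw [norm_mul, norm_mul, norm_one] at h3
  have h4 : ‖v‖ * ‖w‖ < 1 := by nlinarith [norm_nonneg v, norm_nonneg w]
  nlinarith [norm_nonneg ρ, mul_nonneg (norm_nonneg v) (norm_nonneg w)]

/-- Specification of `mRho`: it is nonzero only if it is a root inside the disk. -/
theorem mRho_spec_aux (ρ z : ℂ) (hz : z ∉ ellipticSet ρ) (hm : mRho ρ z ≠ 0) :
    ρ * mRho ρ z ^ 2 + z * mRho ρ z + 1 = 0 ∧ ‖mRho ρ z‖ < 1 := by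
  by_cases h0 : ρ = 0
  · subst h0
    have hz1 : 1 < ‖z‖ := by
      by_contra hc
      exact hz ⟨z, not_lt.mp hc, by simp⟩
    have hz0 : z ≠ 0 := by
      rintro rfl
      norm_num at hz1
    simp only [mRho, if_true]
    refine ⟨by field_simp; simp, ?_⟩
    rw [norm_neg, norm_inv]
    exact inv_lt_one_of_one_lt₀ hz1
  · by_cases h : ∃ w : ℂ, ρ * w ^ 2 + z * w + 1 = 0 ∧ ‖w‖ < 1
    · have : mRho ρ z = h.choose := by simp only [mRho, if_neg h0, dif_pos h]
      rw [this]
      exact h.choose_spec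
    · exact absurd (by simp only [mRho, if_neg h0, dif_neg h]) hm

theorem mRho_ne_zero_aux (ρ z w : ℂ) (hz0 : z ≠ 0)
    (hw : ρ * w ^ 2 + z * w + 1 = 0) (hw1 : ‖w‖ < 1) : mRho ρ z ≠ 0 := by
  by_cases h0 : ρ = 0
  · simp [mRho, h0, hz0]
  · have h : ∃ w : ℂ, ρ * w ^ 2 + z * w + 1 = 0 ∧ ‖w‖ < 1 := ⟨w, hw, hw1⟩
    have he : mRho ρ z = h.choose := by simp only [mRho, if_neg h0, dif_pos h]
    intro hc
    have := h.choose_spec.1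
    rw [← he, hc] at this
    norm_num at this

/-- For z ∉ 𝓔_ρ, det(I + m_ρ(z)·C) = 0 iff z = λ + ρ/λ for some eigenvalue λ of C with
|λ| > 1. -/
theorem stmt17 (ρ : ℂ) (hρ : ‖ρ‖ ≤ 1) (N : ℕ) (C : Matrix (Fin N) (Fin N) ℂ)
    (z : ℂ) (hz : z ∉ ellipticSet ρ) :
    ((1 : Matrix (Fin N) (Fin N) ℂ) + mRho ρ z • C).det = 0 ↔
      ∃ l ∈ eigs C, 1 < ‖l‖ ∧ z = l + ρ / l := by
  constructor
  · intro hd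
    have hm : mRho ρ z ≠ 0 := by
      intro h
      rw [h] at hd
      simp at hd
    obtain ⟨h1, h2⟩ := mRho_spec_aux ρ z hz hm
    refine ⟨_, (det_iff_aux C _ hm).mp hd, ?_, ?_⟩
    · rw [norm_neg, norm_inv]
      exact (one_lt_inv₀ (norm_pos_iff.mpr hm)).mpr h2
    · generalize mRho ρ z = m at *
      field_simp
      linear_combination h1
  · rintro ⟨l, hl, hl1, hzl⟩
    have hl0 : l ≠ 0 := by
      rintro rfl
      norm_num at hl1
    have hw : ρ * (-l⁻¹) ^ 2 + z * (-l⁻¹) + 1 = 0 := by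
      rw [hzl]
      field_simp
      ring
    have hw1 : ‖-l⁻¹‖ < 1 := by
      rw [norm_neg, norm_inv]
      exact inv_lt_one_of_one_lt₀ hl1
    have hz0 : z ≠ 0 := by
      rintro rfl
      exact hz ⟨0, by simp, by simp⟩
    have hm := mRho_ne_zero_aux ρ z _ hz0 hw hw1
    obtain ⟨h1, h2⟩ := mRho_spec_aux ρ z hz hm
    have he := mRho_unique_aux ρ z _ _ hρ h1 hw h2 hw1
    rw [det_iff_aux C _ hm, he]
    simpa using hl

end
end
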